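/- Uniform time Hölder regularity on ℝ^N: under the same hypotheses — u a viscosity solution of 1_{f,ψ} on ℝ^N × (0,T) satisfying ψ(y) − c₁|x−y|^{γ_ψ} − c₂ t^{1/(q(α+1)−α)} ≤ u(x,t) ≤ ψ(y) + c₁|x−y|^{γ_ψ} + c₂ t^{1/(q(α+1)−α)}, f uniformly continuous, bounded and γ_f-Hölder in t uniformly in x, ψ bounded and γ_ψ-Hölder — there exists a constant C₂ such that for all x ∈ ℝ^N and all t, t+s ∈ (0,T) with s > 0: |u(x,t+s) − u(x,t)| ≤ C₂ s^{γ*}, where γ* = min(γ_f, 1/(q(α+1)−α)), q = q₁/γ_ψ and q₁ = max(2, (α+2)/(α+1)). -/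

import Mathlib

open Set Filter Metric
open scoped RealInnerProductSpace

noncomputable section

/-- Euclidean space `ℝ^N`. -/
abbrev EucSp (N : ℕ) := EuclideanSpace ℝ (Fin N)

/-- `N × N` real matrices. -/
abbrev MatN (N : ℕ) := Matrix (Fin N) (Fin N) ℝ

variable {N : ℕ}

/-- Spatial Hessian matrix of a function `φ : ℝ^N → ℝ`. -/
noncomputable def hessMat (φ : EucSp N → ℝ) (x : EucSp N) : MatN N := fun i j =>
  iteratedFDeriv ℝ 2 φ x ![EuclideanSpace.single i (1 : ℝ), EuclideanSpace.single j (1 : ℝ)]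

/-- Upper semicontinuous envelope `u*`. -/
noncomputable def uscEnv (u : EucSp N → ℝ → ℝ) (x : EucSp N) (t : ℝ) : ℝ :=
  Filter.limsup (fun p : EucSp N × ℝ => u p.1 p.2) (nhds (x, t))

/-- Lower semicontinuous envelope `u_*`. -/
noncomputable def lscEnv (u : EucSp N → ℝ → ℝ) (x : EucSp N) (t : ℝ) : ℝ :=
  Filter.liminf (fun p : EucSp N × ℝ => u p.1 p.2) (nhds (x, t))

/-- The first order term `h(x,t)·p |p|^α`. -/
noncomputable def gradTerm (h : EucSp N → ℝ → EucSp N) (α : ℝ) (x : EucSp N) (t : ℝ)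
    (p : EucSp N) : ℝ :=
  ⟪h x t, p⟫ * ‖p‖ ^ α

/-- Viscosity subsolution of `u_t - F(x,∇u,D²u) - h(x,t)·∇u|∇u|^α ≤ f` in `Ω × (0,T)`,
in the sense of Definition 1 of the paper. -/
def IsSubSol (Ω : Set (EucSp N)) (T : ℝ) (F : EucSp N → EucSp N → MatN N → ℝ)
    (h : EucSp N → ℝ → EucSp N) (α : ℝ) (f : EucSp N → ℝ → ℝ)
    (u : EucSp N → ℝ → ℝ) : Prop :=
  ∀ x₀ ∈ Ω, ∀ t₀ ∈ Set.Ioo (0 : ℝ) T,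
    (∀ φ : EucSp N → ℝ → ℝ,
      ContDiff ℝ 2 (fun p : EucSp N × ℝ => φ p.1 p.2) →
      (∀ᶠ p : EucSp N × ℝ in nhds (x₀, t₀), uscEnv u p.1 p.2 ≤ φ p.1 p.2) →
      uscEnv u x₀ t₀ = φ x₀ t₀ →
      gradient (fun x => φ x t₀) x₀ ≠ 0 →
      deriv (fun s => φ x₀ s) t₀
          - F x₀ (gradient (fun x => φ x t₀) x₀) (hessMat (fun x => φ x t₀) x₀)
          - gradTerm h α x₀ t₀ (gradient (fun x => φ x t₀) x₀)
        ≤ f x₀ t₀) ∧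
    (∀ δ₁ > (0 : ℝ), ∀ φ : ℝ → ℝ, ContDiff ℝ 2 φ → φ t₀ = 0 →
      (∀ t ∈ Set.Ioo (t₀ - δ₁) (t₀ + δ₁), uscEnv u x₀ t - φ t ≤ uscEnv u x₀ t₀) →
      (∀ᶠ x in nhds x₀,
        sSup ((fun t => uscEnv u x t - φ t) '' Set.Ioo (t₀ - δ₁) (t₀ + δ₁)) =
          sSup ((fun t => uscEnv u x₀ t - φ t) '' Set.Ioo (t₀ - δ₁) (t₀ + δ₁))) →
      deriv φ t₀ ≤ f x₀ t₀)

/-- Viscosity supersolution of `u_t - F(x,∇u,D²u) - h(x,t)·∇u|∇u|^α ≥ f` in `Ω × (0,T)`,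
in the sense of Definition 1 of the paper. -/
def IsSuperSol (Ω : Set (EucSp N)) (T : ℝ) (F : EucSp N → EucSp N → MatN N → ℝ)
    (h : EucSp N → ℝ → EucSp N) (α : ℝ) (f : EucSp N → ℝ → ℝ)
    (u : EucSp N → ℝ → ℝ) : Prop :=
  ∀ x₀ ∈ Ω, ∀ t₀ ∈ Set.Ioo (0 : ℝ) T,
    (∀ φ : EucSp N → ℝ → ℝ,
      ContDiff ℝ 2 (fun p : EucSp N × ℝ => φ p.1 p.2) →
      (∀ᶠ p : EucSp N × ℝ in nhds (x₀, t₀), φ p.1 p.2 ≤ lscEnv u p.1 p.2) →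
      lscEnv u x₀ t₀ = φ x₀ t₀ →
      gradient (fun x => φ x t₀) x₀ ≠ 0 →
      f x₀ t₀ ≤
        deriv (fun s => φ x₀ s) t₀
          - F x₀ (gradient (fun x => φ x t₀) x₀) (hessMat (fun x => φ x t₀) x₀)
          - gradTerm h α x₀ t₀ (gradient (fun x => φ x t₀) x₀)) ∧
    (∀ δ₁ > (0 : ℝ), ∀ φ : ℝ → ℝ, ContDiff ℝ 2 φ → φ t₀ = 0 →
      (∀ t ∈ Set.Ioo (t₀ - δ₁) (t₀ + δ₁), lscEnv u x₀ t₀ ≤ lscEnv u x₀ t - φ t) →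
      (∀ᶠ x in nhds x₀,
        sInf ((fun t => lscEnv u x t - φ t) '' Set.Ioo (t₀ - δ₁) (t₀ + δ₁)) =
          sInf ((fun t => lscEnv u x₀ t - φ t) '' Set.Ioo (t₀ - δ₁) (t₀ + δ₁))) →
      f x₀ t₀ ≤ deriv φ t₀)

/-- Continuity of `F` on `Ω × (ℝ^N∖{0}) × S`. -/
def Fcont (Ω : Set (EucSp N)) (F : EucSp N → EucSp N → MatN N → ℝ) : Prop :=
  ContinuousOn (fun z : EucSp N × EucSp N × MatN N => F z.1 z.2.1 z.2.2)
    (Ω ×ˢ ({p : EucSp N | p ≠ 0} ×ˢ (Set.univ : Set (MatN N))))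

/-- Hypothesis (H1): homogeneity. -/
def H1 (Ω : Set (EucSp N)) (F : EucSp N → EucSp N → MatN N → ℝ) (α : ℝ) : Prop :=
  ∀ x ∈ Ω, ∀ p : EucSp N, p ≠ 0 → ∀ X : MatN N, X.IsSymm →
    ∀ t : ℝ, t ≠ 0 → ∀ μ : ℝ, 0 ≤ μ →
      F x (t • p) (μ • X) = |t| ^ α * μ * F x p X

/-- Hypothesis (H2): uniform ellipticity. -/
def H2 (Ω : Set (EucSp N)) (F : EucSp N → EucSp N → MatN N → ℝ) (α a A : ℝ) : Prop :=
  0 < a ∧ a ≤ A ∧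
    ∀ x ∈ Ω, ∀ p : EucSp N, p ≠ 0 → ∀ M P : MatN N, M.IsSymm → P.IsSymm → P.PosSemidef →
      a * ‖p‖ ^ α * P.trace ≤ F x p (M + P) - F x p M ∧
        F x p (M + P) - F x p M ≤ A * ‖p‖ ^ α * P.trace

/-- Hypothesis (H3): continuity estimate for doubled variables. -/
def H3 (Ω : Set (EucSp N)) (F : EucSp N → EucSp N → MatN N → ℝ) : Prop :=
  ∃ ω : ℝ → ℝ, Continuous ω ∧ ω 0 = 0 ∧
    ∀ X Y : MatN N, X.IsSymm → Y.IsSymm → ∀ ζ : ℝ, 0 < ζ →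
      (Matrix.fromBlocks X 0 0 Y +
        ζ • (1 : Matrix (Fin N ⊕ Fin N) (Fin N ⊕ Fin N) ℝ)).PosSemidef →
      ((4 * ζ) • Matrix.fromBlocks (1 : MatN N) (-1) (-1) (1 : MatN N) -
        Matrix.fromBlocks X 0 0 Y).PosSemidef →
      ∀ x ∈ Ω, ∀ y ∈ Ω, x ≠ y →
        F x (ζ • (x - y)) X - F y (ζ • (x - y)) (-Y) ≤ ω (ζ * ‖x - y‖ ^ 2)

/-- Frobenius norm of a matrix. -/
noncomputable def frobNorm (X : MatN N) : ℝ := Real.sqrt (∑ i, ∑ j, (X i j) ^ 2)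

/-- Hypothesis (H4): Hölder-type continuity of `F` in `x`. -/
def H4 (Ω : Set (EucSp N)) (F : EucSp N → EucSp N → MatN N → ℝ) (α : ℝ) : Prop :=
  ∃ ω' : ℝ → ℝ, Continuous ω' ∧ ω' 0 = 0 ∧
    ∀ x ∈ Ω, ∀ y ∈ Ω, ∀ p : EucSp N, p ≠ 0 → ∀ X : MatN N, X.IsSymm →
      |F x p X - F y p X| ≤ ω' ‖x - y‖ * ‖p‖ ^ α * frobNorm X

/-- Hypothesis (H5): regularity of `h`. -/
def H5 (Ω : Set (EucSp N)) (T : ℝ) (h : EucSp N → ℝ → EucSp N) (α : ℝ) : Prop :=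
  ∃ ωh : ℝ, 0 < ωh ∧ ωh ≤ 1 ∧ ∃ ch : ℝ, 0 < ch ∧
    (∀ x ∈ Ω, ∀ t ∈ Set.Ioo (0 : ℝ) T, ∀ s ∈ Set.Ioo (0 : ℝ) T,
      ‖h x t - h x s‖ ≤ ch * |t - s| ^ ωh) ∧
    (α ≤ 0 → ∀ x ∈ Ω, ∀ y ∈ Ω, ∀ t ∈ Set.Ioo (0 : ℝ) T,
      ‖h x t - h y t‖ ≤ ch * ‖x - y‖ ^ (1 + α)) ∧
    (0 < α → ∀ x ∈ Ω, ∀ y ∈ Ω, ∀ t ∈ Set.Ioo (0 : ℝ) T,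
      ⟪h x t - h y t, x - y⟫ ≤ 0)

/-- Hypothesis (H6): uniform Lipschitz-type condition on `F` in the gradient variable. -/
def H6 (F : EucSp N → EucSp N → MatN N → ℝ) (α : ℝ) : Prop :=
  ∃ C : ℝ, 0 < C ∧ ∀ x : EucSp N, ∀ p : EucSp N, p ≠ 0 → ∀ q : EucSp N, ‖q‖ < ‖p‖ / 2 →
    ∀ X : MatN N, X.IsSymm →
      |F x (p + q) X - F x p X| ≤ C * ‖p‖ ^ (α - 1) * ‖q‖ * frobNorm X

/-- `h` is continuous and bounded on `Ω × (0,T)`. -/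
def HContBdd (Ω : Set (EucSp N)) (T : ℝ) (h : EucSp N → ℝ → EucSp N) : Prop :=
  ContinuousOn (fun p : EucSp N × ℝ => h p.1 p.2) (Ω ×ˢ Set.Ioo 0 T) ∧
    ∃ C : ℝ, ∀ x ∈ Ω, ∀ t ∈ Set.Ioo (0 : ℝ) T, ‖h x t‖ ≤ C

/-- Uniform exterior cone condition. -/
def UnifExtCone (Ω : Set (EucSp N)) : Prop :=
  ∃ φ₀ ∈ Set.Ioo (0 : ℝ) Real.pi, ∃ r : ℝ, 0 < r ∧
    ∀ z ∈ frontier Ω, ∃ n : EucSp N, ‖n‖ = 1 ∧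
      {x : EucSp N | ⟪x - z, n⟫ ≤ Real.cos φ₀ * ‖x - z‖} ∩ closure Ω ∩
        Metric.ball z r = {z}

/-- `u = ψ` on the parabolic boundary `(∂Ω × (0,T)) ∪ (Ω × {0})`. -/
def BoundaryEq (Ω : Set (EucSp N)) (T : ℝ) (u ψ : EucSp N → ℝ → ℝ) : Prop :=
  (∀ x ∈ frontier Ω, ∀ t ∈ Set.Ioo (0 : ℝ) T, u x t = ψ x t) ∧
    (∀ x ∈ Ω, u x 0 = ψ x 0)

/-- The global barrier family of Proposition 1 of the paper, with Hölder
exponent `γ` and constants `c₁ ≤ W_z(x)/|x-z|^γ ≤ c₂`. -/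
def IsBarrierFamily (Ω : Set (EucSp N)) (T : ℝ) (F : EucSp N → EucSp N → MatN N → ℝ)
    (h : EucSp N → ℝ → EucSp N) (α γ c₁ c₂ : ℝ) : Prop :=
  γ ∈ Set.Ioo (0 : ℝ) 1 ∧ 0 < c₁ ∧ 0 < c₂ ∧
    ∀ z ∈ frontier Ω, ∃ W : EucSp N → ℝ,
      ContinuousOn W (closure Ω) ∧ W z = 0 ∧
      (∀ x ∈ Ω, x ≠ z → 0 < W x) ∧
      (∀ x ∈ Ω, gradient W x ≠ 0) ∧
      (∀ x ∈ Ω, c₁ * ‖x - z‖ ^ γ ≤ W x ∧ W x ≤ c₂ * ‖x - z‖ ^ γ) ∧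
      (∀ x₀ ∈ Ω, ∀ φ : EucSp N → ℝ, ContDiff ℝ 2 φ →
        (∀ᶠ x in nhds x₀, φ x ≤ W x) → φ x₀ = W x₀ → gradient φ x₀ ≠ 0 →
        ∀ t ∈ Set.Ioo (0 : ℝ) T,
          F x₀ (gradient φ x₀) (hessMat φ x₀) + gradTerm h α x₀ t (gradient φ x₀) ≤ -1)

/-- `ψ` is `γ`-Hölder in `x` (with constant `cψ`) and Lipschitz in `t`
(with constant `Lψ`). -/
def PsiHolderLip (Ω : Set (EucSp N)) (T γ cψ Lψ : ℝ) (ψ : EucSp N → ℝ → ℝ) : Prop :=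
  (∀ x ∈ closure Ω, ∀ y ∈ closure Ω, ∀ t ∈ Set.Icc (0 : ℝ) T,
      |ψ x t - ψ y t| ≤ cψ * ‖x - y‖ ^ γ) ∧
    (∀ x ∈ closure Ω, ∀ t ∈ Set.Icc (0 : ℝ) T, ∀ s ∈ Set.Icc (0 : ℝ) T,
      |ψ x t - ψ x s| ≤ Lψ * |t - s|)

/-- A continuous viscosity solution of the problem `1_{f,ψ}` on a bounded domain. -/
def IsSolution (Ω : Set (EucSp N)) (T : ℝ) (F : EucSp N → EucSp N → MatN N → ℝ)
    (h : EucSp N → ℝ → EucSp N) (α : ℝ) (f : EucSp N → ℝ → ℝ)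
    (ψ : EucSp N → ℝ → ℝ) (u : EucSp N → ℝ → ℝ) : Prop :=
  ContinuousOn (fun p : EucSp N × ℝ => u p.1 p.2) (closure Ω ×ˢ Set.Icc 0 T) ∧
    IsSubSol Ω T F h α f u ∧ IsSuperSol Ω T F h α f u ∧ BoundaryEq Ω T u ψ

/-- A continuous viscosity solution of `1_{f,ψ}` on `ℝ^N × (0,T)` with initial datum `ψ`. -/
def IsSolutionRN {N : ℕ} (T : ℝ) (F : EucSp N → EucSp N → MatN N → ℝ)
    (h : EucSp N → ℝ → EucSp N) (α : ℝ) (f : EucSp N → ℝ → ℝ)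
    (ψ : EucSp N → ℝ) (u : EucSp N → ℝ → ℝ) : Prop :=
  ContinuousOn (fun p : EucSp N × ℝ => u p.1 p.2)
      ((Set.univ : Set (EucSp N)) ×ˢ Set.Ico 0 T) ∧
    IsSubSol (Set.univ : Set (EucSp N)) T F h α f u ∧
    IsSuperSol (Set.univ : Set (EucSp N)) T F h α f u ∧
    ∀ x : EucSp N, u x 0 = ψ x

theorem le_of_increment_le_sq {θ : ℝ → ℝ} {K : ℝ}
    (hθ : ∀ s t : ℝ, 0 ≤ s → s ≤ t → t ≤ 1 → θ t - θ s ≤ K * (t - s) ^ 2) : θ 1 ≤ θ 0 := by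
  have key : ∀ n : ℕ, θ 1 - θ 0 ≤ K * (1 / ((n : ℝ) + 1)) := by
    intro n
    have hn : (0 : ℝ) < (n : ℝ) + 1 := by positivity
    have hsum := Finset.sum_range_sub (fun i : ℕ => θ ((i : ℝ) / ((n : ℝ) + 1))) (n + 1)
    have hle : ∑ i ∈ Finset.range (n + 1),
        (θ (((i + 1 : ℕ) : ℝ) / ((n : ℝ) + 1)) - θ ((i : ℝ) / ((n : ℝ) + 1))) ≤
        ∑ _i ∈ Finset.range (n + 1), K * (1 / ((n : ℝ) + 1)) ^ 2 := by
      refine Finset.sum_le_sum fun i hi => ?_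
      have hi' : (i : ℝ) + 1 ≤ (n : ℝ) + 1 := by
        have := Finset.mem_range.mp hi
        exact_mod_cast this
      refine (hθ _ _ (by positivity) (by gcongr; simp) ?_).trans (le_of_eq ?_)
      · rw [div_le_one hn]; push_cast; exact hi'
      · congr 2; push_cast; ring
    rw [hsum] at hle
    simp only [Finset.sum_const, Finset.card_range, nsmul_eq_mul, Nat.cast_add, Nat.cast_one,
      div_self hn.ne', Nat.cast_zero, zero_div] at hle
    refine hle.trans (le_of_eq ?_)
    field_simp
  have hlim : Tendsto (fun n : ℕ => K * (1 / ((n : ℝ) + 1))) atTop (nhds (K * 0)) :=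
    tendsto_one_div_add_atTop_nhds_zero_nat.const_mul K
  have := ge_of_tendsto' hlim key
  linarith

section Subgradient

variable {E : Type*} [NormedAddCommGroup E] [InnerProductSpace ℝ E]

theorem taylor_of_subgradient {g : E → ℝ} {sg : E → E}
    (hsg : ∀ ξ y, g ξ + ⟪sg ξ, y - ξ⟫ ≤ g y) (ξ : E) (X : E →L[ℝ] E)
    (hX : ∀ ε > 0, ∀ᶠ v in nhds (0 : E), ‖sg (ξ + v) - sg ξ - X v‖ ≤ ε * ‖v‖) :
    ∀ ε > 0, ∀ᶠ v in nhds (0 : E),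
      |g (ξ + v) - g ξ - ⟪sg ξ, v⟫ - 1 / 2 * ⟪X v, v⟫| ≤ ε * ‖v‖ ^ 2 := by
  intro ε hε
  obtain ⟨ρ, hρ, hb⟩ := Metric.eventually_nhds_iff_ball.mp (hX ε hε)
  refine Metric.eventually_nhds_iff_ball.mpr ⟨ρ, hρ, fun v hv => ?_⟩
  have hv' : ‖v‖ < ρ := by simpa using hv
  set a := ⟪X v, v⟫ with ha
  have hq : ∀ t : ℝ, 0 ≤ t → t ≤ 1 →
      |⟪sg (ξ + t • v), v⟫ - ⟪sg ξ, v⟫ - t * a| ≤ ε * ‖v‖ ^ 2 := by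
    intro t h0 h1
    have hn : ‖t • v‖ ≤ ‖v‖ := by
      rw [norm_smul, Real.norm_eq_abs, abs_of_nonneg h0]
      exact mul_le_of_le_one_left (norm_nonneg _) h1
    have h2 := hb (t • v) (by simpa using hn.trans_lt hv')
    have h3 : ⟪sg (ξ + t • v), v⟫ - ⟪sg ξ, v⟫ - t * a
        = ⟪sg (ξ + t • v) - sg ξ - X (t • v), v⟫ := by
      rw [inner_sub_left, inner_sub_left, map_smul, real_inner_smul_left]
    rw [h3]
    refine (abs_real_inner_le_norm _ _).trans ?_
    calc _ ≤ (ε * ‖t • v‖) * ‖v‖ := by gcongr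
      _ ≤ (ε * ‖v‖) * ‖v‖ := by gcongr
      _ = _ := by ring
  have hstep : ∀ s t : ℝ, g (ξ + s • v) + (t - s) * ⟪sg (ξ + s • v), v⟫ ≤ g (ξ + t • v) := by
    intro s t
    have h := hsg (ξ + s • v) (ξ + t • v)
    have : ξ + t • v - (ξ + s • v) = (t - s) • v := by rw [sub_smul]; abel
    rwa [this, real_inner_smul_right] at h
  have up := le_of_increment_le_sq
    (θ := fun t => g (ξ + t • v) - t * ⟪sg ξ, v⟫ - t ^ 2 / 2 * a - t * (ε * ‖v‖ ^ 2))
    (K := a / 2) (by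
      intro s t hs hst ht
      have h1 := hstep t s
      have h2 := (abs_le.mp (hq t (hs.trans hst) ht)).2
      have h3 := mul_le_mul_of_nonneg_left h2 (sub_nonneg.mpr hst)
      nlinarith)
  have lo := le_of_increment_le_sq
    (θ := fun t => -(g (ξ + t • v) - t * ⟪sg ξ, v⟫ - t ^ 2 / 2 * a) - t * (ε * ‖v‖ ^ 2))
    (K := a / 2) (by
      intro s t hs hst ht
      have h1 := hstep s t
      have h2 := (abs_le.mp (hq s hs (hst.trans ht))).1
      have h3 := mul_le_mul_of_nonneg_left h2 (sub_nonneg.mpr hst)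
      nlinarith)
  simp only [one_smul, zero_smul, add_zero] at up lo
  rw [abs_le]
  constructor <;> nlinarith

theorem subgradient_eq_of_le_quadratic {g : E → ℝ} {sg : E → E}
    (hsg : ∀ ξ y, g ξ + ⟪sg ξ, y - ξ⟫ ≤ g y) {ξ P : E} {C ρ : ℝ} (hC : 0 ≤ C) (hρ : 0 < ρ)
    (hup : ∀ v, ‖v‖ ≤ ρ → g (ξ + v) ≤ g ξ + ⟪P, v⟫ + C / 2 * ‖v‖ ^ 2) : sg ξ = P := by
  by_contra hne
  set d := sg ξ - P with hd
  have hd0 : 0 < ‖d‖ := norm_pos_iff.mpr (sub_ne_zero.mpr hne)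
  set t := min (ρ / ‖d‖) (1 / (C + 1)) with ht
  have ht0 : 0 < t := lt_min (by positivity) (by positivity)
  have h1 := hup (t • d) (by
    rw [norm_smul, Real.norm_eq_abs, abs_of_pos ht0]
    calc t * ‖d‖ ≤ ρ / ‖d‖ * ‖d‖ := by gcongr; exact min_le_left _ _
      _ = ρ := by field_simp)
  have h2 := hsg ξ (ξ + t • d)
  rw [add_sub_cancel_left] at h2
  have h3 : ⟪sg ξ, t • d⟫ - ⟪P, t • d⟫ = t * ‖d‖ ^ 2 := by
    rw [← inner_sub_left, ← hd, real_inner_smul_right, real_inner_self_eq_norm_sq]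
  rw [norm_smul, Real.norm_eq_abs, abs_of_pos ht0] at h1
  have h4 : t * ‖d‖ ^ 2 ≤ C / 2 * (t * ‖d‖) ^ 2 := by linarith
  have h5 : t * (C + 1) ≤ 1 := by
    calc t * (C + 1) ≤ 1 / (C + 1) * (C + 1) := by gcongr; exact min_le_right _ _
      _ = 1 := by field_simp
  have h6 : 0 < t * ‖d‖ ^ 2 := by positivity
  nlinarith [mul_nonneg hC ht0.le]

theorem subgradient_growth {g : E → ℝ} {sg : E → E}
    (hsg : ∀ ξ y, g ξ + ⟪sg ξ, y - ξ⟫ ≤ g y) {ξ : E} {C ρ : ℝ}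
    (hup : ∀ v, ‖v‖ ≤ ρ → g (ξ + v) ≤ g ξ + ⟪sg ξ, v⟫ + C / 2 * ‖v‖ ^ 2)
    (hC : 0 ≤ C) (v : E) (hv : ‖v‖ ≤ ρ / 2) : ‖sg (ξ + v) - sg ξ‖ ≤ 2 * C * ‖v‖ := by
  set d := sg (ξ + v) - sg ξ with hd
  rcases eq_or_ne d 0 with h0 | h0
  · rw [h0, norm_zero]; positivity
  rcases eq_or_ne v 0 with hv0 | hv0
  · rw [hd, hv0]; simp
  have hdp : 0 < ‖d‖ := norm_pos_iff.mpr h0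
  have hvp : 0 < ‖v‖ := norm_pos_iff.mpr hv0
  set w := (‖v‖ / ‖d‖) • d with hw
  have hwn : ‖w‖ = ‖v‖ := by
    rw [hw, norm_smul, Real.norm_eq_abs, abs_of_pos (by positivity)]; field_simp
  have hvw : ‖v + w‖ ≤ 2 * ‖v‖ := (norm_add_le _ _).trans (by rw [hwn]; linarith)
  have h1 := hup (v + w) (by linarith)
  have h2 := hsg (ξ + v) (ξ + (v + w))
  have h3 := hsg ξ (ξ + v)
  rw [show ξ + (v + w) - (ξ + v) = w by abel] at h2
  rw [add_sub_cancel_left] at h3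
  rw [inner_add_right] at h1
  have h4 : ⟪sg (ξ + v), w⟫ - ⟪sg ξ, w⟫ = ‖v‖ * ‖d‖ := by
    rw [← inner_sub_left, ← hd, hw, real_inner_smul_right, real_inner_self_eq_norm_sq]
    field_simp
  have h5 : ‖v + w‖ ^ 2 ≤ (2 * ‖v‖) ^ 2 := by gcongr
  have h6 : ‖v‖ * ‖d‖ ≤ ‖v‖ * (2 * C * ‖v‖) := by nlinarith
  exact le_of_mul_le_mul_left h6 hvp

/-- A linear functional bound of second order is inherited by the Hessian. -/
theorem nonneg_of_sq_lower_bound {Q : E → ℝ} (hQ : ∀ (t : ℝ) v, Q (t • v) = t ^ 2 * Q v)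
    (h : ∀ ε > 0, ∀ᶠ v in nhds (0 : E), -(ε * ‖v‖ ^ 2) ≤ Q v) (v : E) : 0 ≤ Q v := by
  refine le_of_forall_pos_le_add fun ε hε => ?_
  have hpos : 0 < ε / (‖v‖ ^ 2 + 1) := by positivity
  have ht : Tendsto (fun t : ℝ => t • v) (nhdsWithin 0 (Set.Ioi 0)) (nhds 0) := by
    have : Tendsto (fun t : ℝ => t • v) (nhds 0) (nhds ((0 : ℝ) • v)) :=
      (continuous_id.smul continuous_const).tendsto 0
    rw [zero_smul] at this
    exact this.mono_left nhdsWithin_le_nhds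
  obtain ⟨t, ht1, ht2⟩ := ((ht.eventually (h _ hpos)).and self_mem_nhdsWithin).exists
  have ht0 : (0 : ℝ) < t := ht2
  rw [hQ, norm_smul, Real.norm_eq_abs, abs_of_pos ht0] at ht1
  have h1 : ε / (‖v‖ ^ 2 + 1) * ‖v‖ ^ 2 ≤ ε := by
    rw [div_mul_eq_mul_div, div_le_iff₀ (by positivity)]; nlinarith [sq_nonneg ‖v‖]
  have h2 : 0 ≤ t ^ 2 * (Q v + ε / (‖v‖ ^ 2 + 1) * ‖v‖ ^ 2) := by nlinarith
  have h3 := nonneg_of_mul_nonneg_right h2 (by positivity)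
  linarith

end Subgradient

section JensenAlexandrov
open MeasureTheory

variable {E : Type*} [NormedAddCommGroup E] [InnerProductSpace ℝ E]

theorem continuous_of_bounded_subgradient {g : E → ℝ} {sg : E → E} {R : ℝ}
    (hR : ∀ ξ, ‖sg ξ‖ ≤ R) (hsg : ∀ ξ y, g ξ + ⟪sg ξ, y - ξ⟫ ≤ g y) : Continuous g := by
  have hR0 : 0 ≤ R := (norm_nonneg _).trans (hR 0)
  have hl : LipschitzWith R.toNNReal g := by
    refine LipschitzWith.of_le_add_mul _ fun x y => ?_
    rw [Real.coe_toNNReal _ hR0, dist_comm, dist_eq_norm]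
    have h1 := hsg x y
    have h2 := (abs_le.mp (abs_real_inner_le_norm (sg x) (y - x))).1
    have h3 : ‖sg x‖ * ‖y - x‖ ≤ R * ‖y - x‖ := by gcongr; exact hR x
    linarith
  exact hl.continuous

variable [FiniteDimensional ℝ E]

theorem exists_lipschitz_resolvent {g : E → ℝ} {sg : E → E}
    (hsg : ∀ ξ y, g ξ + ⟪sg ξ, y - ξ⟫ ≤ g y) :
    ∃ (K : NNReal) (J : E → E), LipschitzWith K J ∧ ∀ ξ, J (ξ + sg ξ) = ξ := by
  have hmono : ∀ x y, ‖x - y‖ ≤ ‖(x + sg x) - (y + sg y)‖ := by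
    intro x y
    have h1 := hsg x y
    have h2 := hsg y x
    have h3 : 0 ≤ ⟪sg x - sg y, x - y⟫ := by
      rw [inner_sub_left]
      have : ⟪sg x, y - x⟫ = -⟪sg x, x - y⟫ := by rw [← inner_neg_right, neg_sub]
      linarith
    rcases eq_or_ne x y with rfl | hne
    · simp
    have h4 : 0 < ‖x - y‖ := norm_pos_iff.mpr (sub_ne_zero.mpr hne)
    have h5 : ‖x - y‖ * ‖x - y‖ ≤ ‖(x + sg x) - (y + sg y)‖ * ‖x - y‖ := by
      refine le_trans ?_ (real_inner_le_norm _ _)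
      rw [show (x + sg x) - (y + sg y) = (x - y) + (sg x - sg y) by abel, inner_add_left,
        real_inner_self_eq_norm_mul_norm]
      linarith
    exact le_of_mul_le_mul_right h5 h4
  have hinj : Function.Injective (fun ξ => ξ + sg ξ) := by
    intro x y hxy
    have := hmono x y
    dsimp only at hxy
    rw [hxy, sub_self, norm_zero] at this
    exact sub_eq_zero.mp (norm_le_zero_iff.mp this)
  have hL : LipschitzOnWith 1 (Function.invFun fun ξ => ξ + sg ξ)
      (Set.range fun ξ => ξ + sg ξ) := by
    refine LipschitzOnWith.of_dist_le_mul ?_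
    rintro _ ⟨x, rfl⟩ _ ⟨y, rfl⟩
    rw [Function.leftInverse_invFun hinj x, Function.leftInverse_invFun hinj y]
    simpa [dist_eq_norm] using hmono x y
  obtain ⟨J, hJ, hJe⟩ := hL.extend_finite_dimension
  exact ⟨_, J, hJ, fun ξ => by
    rw [← hJe ⟨ξ, rfl⟩]; exact Function.leftInverse_invFun hinj ξ⟩

theorem exists_apply_mem_ball_differentiableAt {K L : NNReal} {J Φ : E → E}
    (hJ : LipschitzWith K J) (hΦ : LipschitzWith L Φ) {δ : ℝ} (hδ : 0 < δ) (x : E → E)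
    (hx : ∀ p, ‖p‖ < δ → Φ (x p) = p) :
    ∃ p, ‖p‖ < δ ∧ DifferentiableAt ℝ J (x p) := by
  let _ : MeasurableSpace E := borel E
  have _ : BorelSpace E := ⟨rfl⟩
  by_contra hcon
  push Not at hcon
  set μ : Measure E := Measure.hausdorffMeasure (Module.finrank ℝ E : ℝ) with hμ
  have hae : μ {y | ¬ DifferentiableAt ℝ J y} = 0 := hJ.ae_differentiableAt (μ := μ)
  have h0 : μ (Φ '' {y | ¬ DifferentiableAt ℝ J y}) = 0 := by
    have := hΦ.hausdorffMeasure_image_le (d := (Module.finrank ℝ E : ℝ)) (by positivity)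
      {y | ¬ DifferentiableAt ℝ J y}
    rw [← hμ, hae, mul_zero] at this
    exact le_antisymm this zero_le
  have hsub : ball (0 : E) δ ⊆ Φ '' {y | ¬ DifferentiableAt ℝ J y} := by
    intro p hp
    have hp' : ‖p‖ < δ := by simpa using hp
    exact ⟨x p, hcon p hp', hx p hp'⟩
  exact (measure_ball_pos μ (0 : E) hδ).ne' (measure_mono_null hsub h0)

/-- Differentiability of the resolvent gives a first order expansion of the subgradient. -/
theorem subgradient_expansion {sg J : E → E} (hJ : ∀ ξ, J (ξ + sg ξ) = ξ) {ξ : E}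
    (hd : DifferentiableAt ℝ J (ξ + sg ξ)) {C ρ : ℝ} (hC : 0 ≤ C) (hρ : 0 < ρ)
    (hgr : ∀ v, ‖v‖ ≤ ρ → ‖sg (ξ + v) - sg ξ‖ ≤ C * ‖v‖) :
    ∃ X : E →L[ℝ] E, ∀ ε > 0, ∀ᶠ v in nhds (0 : E),
      ‖sg (ξ + v) - sg ξ - X v‖ ≤ ε * ‖v‖ := by
  set D := fderiv ℝ J (ξ + sg ξ) with hD
  set W : E → E := fun v => v + (sg (ξ + v) - sg ξ) with hW
  have hWn : ∀ v, ‖v‖ ≤ ρ → ‖W v‖ ≤ (1 + C) * ‖v‖ := by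
    intro v hv
    calc ‖W v‖ ≤ ‖v‖ + ‖sg (ξ + v) - sg ξ‖ := norm_add_le _ _
      _ ≤ ‖v‖ + C * ‖v‖ := by gcongr; exact hgr v hv
      _ = _ := by ring
  have hexp : ∀ ε > 0, ∀ᶠ v in nhds (0 : E), ‖v - D (W v)‖ ≤ ε * ‖v‖ := by
    intro ε hε
    have h1 := (hasFDerivAt_iff_isLittleO_nhds_zero.mp hd.hasFDerivAt).def
      (show 0 < ε / (1 + C) by positivity)
    obtain ⟨τ, hτ, hb⟩ := Metric.eventually_nhds_iff_ball.mp h1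
    refine Metric.eventually_nhds_iff_ball.mpr ⟨min ρ (τ / (1 + C)), by positivity, fun v hv => ?_⟩
    have hv' : ‖v‖ < min ρ (τ / (1 + C)) := by simpa using hv
    have hv1 : ‖v‖ ≤ ρ := (hv'.trans_le (min_le_left _ _)).le
    have hv2 : ‖v‖ < τ / (1 + C) := hv'.trans_le (min_le_right _ _)
    have hw := hWn v hv1
    have hw2 : ‖W v‖ < τ := by
      refine hw.trans_lt ?_
      rw [lt_div_iff₀ (by positivity)] at hv2
      linarith
    have h2 := hb (W v) (by simpa using hw2)
    have h3 : ξ + sg ξ + W v = (ξ + v) + sg (ξ + v) := by simp only [hW]; abel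
    rw [h3, hJ, hJ, add_sub_cancel_left] at h2
    calc _ ≤ ε / (1 + C) * ‖W v‖ := h2
      _ ≤ ε / (1 + C) * ((1 + C) * ‖v‖) := by gcongr
      _ = _ := by field_simp
  have hsurj : Function.Surjective D := by
    intro e
    have hcl : IsClosed (LinearMap.range (D : E →ₗ[ℝ] E) : Set E) :=
      Submodule.closed_of_finiteDimensional _
    have hmem : e ∈ closure (LinearMap.range (D : E →ₗ[ℝ] E) : Set E) := by
      rw [Metric.mem_closure_iff]
      intro ε hε
      have hpos : 0 < ε / (2 * (‖e‖ + 1)) := by positivity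
      have ht : Tendsto (fun t : ℝ => t • e) (nhdsWithin 0 (Set.Ioi 0)) (nhds 0) := by
        have : Tendsto (fun t : ℝ => t • e) (nhds 0) (nhds ((0 : ℝ) • e)) :=
          (continuous_id.smul continuous_const).tendsto 0
        rw [zero_smul] at this
        exact this.mono_left nhdsWithin_le_nhds
      obtain ⟨t, ht1, ht2⟩ := ((ht.eventually (hexp _ hpos)).and self_mem_nhdsWithin).exists
      have ht0 : (0 : ℝ) < t := ht2
      refine ⟨D (t⁻¹ • W (t • e)), ⟨_, rfl⟩, ?_⟩
      rw [norm_smul, Real.norm_eq_abs, abs_of_pos ht0] at ht1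
      have h4 : e - D (t⁻¹ • W (t • e)) = t⁻¹ • (t • e - D (W (t • e))) := by
        rw [smul_sub, smul_smul, inv_mul_cancel₀ ht0.ne', one_smul, map_smul]
      rw [dist_eq_norm, h4, norm_smul, norm_inv, Real.norm_eq_abs, abs_of_pos ht0]
      calc t⁻¹ * ‖t • e - D (W (t • e))‖ ≤ t⁻¹ * (ε / (2 * (‖e‖ + 1)) * (t * ‖e‖)) := by gcongr
        _ = ε / 2 * (‖e‖ / (‖e‖ + 1)) := by field_simp
        _ ≤ ε / 2 * 1 := by
          gcongr
          rw [div_le_one (by positivity)]; linarith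
        _ < ε := by linarith
    rw [hcl.closure_eq] at hmem
    exact hmem
  have hinj : Function.Injective D := by
    have := (LinearMap.injective_iff_surjective (f := (D : E →ₗ[ℝ] E))).mpr hsurj
    exact this
  let De : E ≃L[ℝ] E := (LinearEquiv.ofBijective (D : E →ₗ[ℝ] E) ⟨hinj, hsurj⟩).toContinuousLinearEquiv
  have hDe : ∀ v, De v = D v := fun v => rfl
  set S : E →L[ℝ] E := (De.symm : E →L[ℝ] E) with hS
  have hSD : ∀ v, S (D v) = v := fun v => by
    rw [← hDe]; exact De.symm_apply_apply v
  refine ⟨S - ContinuousLinearMap.id ℝ E, fun ε hε => ?_⟩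
  filter_upwards [hexp (ε / (‖S‖ + 1)) (by positivity)] with v hv
  have h5 : sg (ξ + v) - sg ξ - (S - ContinuousLinearMap.id ℝ E) v = -(S (v - D (W v))) := by
    rw [map_sub, hSD]
    simp only [sub_apply, ContinuousLinearMap.id_apply, hW]
    abel
  rw [h5, norm_neg]
  calc ‖S (v - D (W v))‖ ≤ ‖S‖ * ‖v - D (W v)‖ := S.le_opNorm _
    _ ≤ (‖S‖ + 1) * (ε / (‖S‖ + 1) * ‖v‖) := by gcongr; linarith
    _ = _ := by field_simp

theorem exists_second_order_expansion {g : E → ℝ} {sg : E → E} {R : ℝ}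
    (hR : ∀ ξ, ‖sg ξ‖ ≤ R) (hsg : ∀ ξ y, g ξ + ⟪sg ξ, y - ξ⟫ ≤ g y)
    (B : E →L[ℝ] E) (hB : ∀ v w, ⟪B v, w⟫ = ⟪B w, v⟫) {r : ℝ} (hr : 0 < r)
    (hmax : ∀ ξ, ‖ξ‖ ≤ r → g ξ ≤ g 0 + 1 / 2 * ⟪B ξ, ξ⟫) {η : ℝ} (hη : 0 < η) :
    ∃ (ξ : E) (X : E →L[ℝ] E), ‖ξ‖ < η ∧ ‖sg ξ‖ < η ∧ (∀ v, 0 ≤ ⟪X v, v⟫) ∧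
      (∀ v, ⟪X v, v⟫ ≤ ⟪B v, v⟫ + η * ‖v‖ ^ 2) ∧
      ∀ ε > 0, ∀ᶠ v in nhds (0 : E),
        |g (ξ + v) - g ξ - ⟪sg ξ, v⟫ - 1 / 2 * ⟪X v, v⟫| ≤ ε * ‖v‖ ^ 2 := by
  have hgc := continuous_of_bounded_subgradient hR hsg
  set B' : E →L[ℝ] E := B + η • ContinuousLinearMap.id ℝ E with hB'
  have hB'in : ∀ v, ⟪B' v, v⟫ = ⟪B v, v⟫ + η * ‖v‖ ^ 2 := by
    intro v
    simp only [hB', add_apply, smul_apply,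
      ContinuousLinearMap.id_apply, inner_add_left, real_inner_smul_left,
      real_inner_self_eq_norm_sq]
  have hB's : ∀ v w, ⟪B' v, w⟫ = ⟪B' w, v⟫ := by
    intro v w
    simp only [hB', add_apply, smul_apply,
      ContinuousLinearMap.id_apply, inner_add_left, real_inner_smul_left, hB v w,
      real_inner_comm v w]
  set C := ‖B'‖ with hC
  have hBC : ∀ v, ⟪B' v, v⟫ ≤ C * ‖v‖ ^ 2 := by
    intro v
    calc ⟪B' v, v⟫ ≤ ‖B' v‖ * ‖v‖ := real_inner_le_norm _ _
      _ ≤ (‖B'‖ * ‖v‖) * ‖v‖ := by gcongr; exact B'.le_opNorm v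
      _ = _ := by rw [hC]; ring
  have hC0 : 0 ≤ C := norm_nonneg _
  set r' := min r (min (η / 2) (η / (4 * (C + 1)))) with hr'
  have hr'0 : 0 < r' := by positivity
  set δ := min (η * r' / 4) (η / 4) with hδ
  have hδ0 : 0 < δ := by positivity
  have hmaxp : ∀ p : E, ∃ ξ : E, ‖p‖ < δ → ‖ξ‖ < r' ∧ ∀ ζ, ‖ζ‖ ≤ r' →
      g ζ - ⟪p, ζ⟫ - 1 / 2 * ⟪B' ζ, ζ⟫ ≤ g ξ - ⟪p, ξ⟫ - 1 / 2 * ⟪B' ξ, ξ⟫ := by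
    intro p
    have hcont : Continuous (fun ζ => g ζ - ⟪p, ζ⟫ - 1 / 2 * ⟪B' ζ, ζ⟫) := by fun_prop
    obtain ⟨ξ, hξm, hξ⟩ := (isCompact_closedBall (0 : E) r').exists_isMaxOn
      ⟨0, by simp [hr'0.le]⟩ hcont.continuousOn
    have hξ' : ‖ξ‖ ≤ r' := by simpa using hξm
    have hall : ∀ ζ, ‖ζ‖ ≤ r' →
      g ζ - ⟪p, ζ⟫ - 1 / 2 * ⟪B' ζ, ζ⟫ ≤ g ξ - ⟪p, ξ⟫ - 1 / 2 * ⟪B' ξ, ξ⟫ :=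
      fun ζ hζ => hξ (by simpa using hζ)
    refine ⟨ξ, fun hp => ⟨?_, hall⟩⟩
    refine lt_of_le_of_ne hξ' fun heq => ?_
    have h0 := hall 0 (by simp [hr'0.le])
    have h1 := hmax ξ (hξ'.trans (min_le_left _ _))
    have h2 := (abs_le.mp (abs_real_inner_le_norm p ξ)).1
    rw [hB'in ξ, heq] at h0
    rw [heq] at h2
    simp only [inner_zero_right, map_zero] at h0
    have h3 : ‖p‖ * r' ≤ η * r' / 4 * r' := by
      gcongr; exact hp.le.trans (min_le_left _ _)
    nlinarith [mul_pos hη (mul_pos hr'0 hr'0)]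
  choose ξ hξ using hmaxp
  have hloc : ∀ p, ‖p‖ < δ → ∀ v, ‖v‖ ≤ r' - ‖ξ p‖ →
      g (ξ p + v) ≤ g (ξ p) + ⟪p + B' (ξ p), v⟫ + 1 / 2 * ⟪B' v, v⟫ := by
    intro p hp v hv
    have h1 := (hξ p hp).2 (ξ p + v) ((norm_add_le _ _).trans (by linarith))
    simp only [map_add, inner_add_left, inner_add_right] at h1 ⊢
    rw [hB's v (ξ p)] at h1
    linarith
  have hloc' : ∀ p, ‖p‖ < δ → ∀ v, ‖v‖ ≤ r' - ‖ξ p‖ →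
      g (ξ p + v) ≤ g (ξ p) + ⟪p + B' (ξ p), v⟫ + C / 2 * ‖v‖ ^ 2 := by
    intro p hp v hv
    have := hloc p hp v hv
    have := hBC v
    linarith
  have hsgeq : ∀ p, ‖p‖ < δ → sg (ξ p) = p + B' (ξ p) := fun p hp =>
    subgradient_eq_of_le_quadratic hsg hC0 (sub_pos.mpr (hξ p hp).1) (hloc' p hp)
  obtain ⟨K, J, hJ, hJs⟩ := exists_lipschitz_resolvent hsg
  have hΦ : LipschitzWith (1 + K + ‖B'‖₊ * K) (fun x => x - J x - B' (J x)) :=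
    (LipschitzWith.id.sub hJ).sub (B'.lipschitz.comp hJ)
  obtain ⟨p, hp, hdiff⟩ := exists_apply_mem_ball_differentiableAt hJ hΦ hδ0
    (fun p => ξ p + sg (ξ p)) (fun p hp => by
      rw [hJs, hsgeq p hp]; abel)
  have hgr := fun v hv => subgradient_growth hsg (ξ := ξ p) (C := C) (ρ := r' - ‖ξ p‖)
    (by rw [hsgeq p hp]; exact hloc' p hp) hC0 v hv
  have hρ : 0 < (r' - ‖ξ p‖) / 2 := half_pos (sub_pos.mpr (hξ p hp).1)
  obtain ⟨X, hX⟩ := subgradient_expansion hJs hdiff (mul_nonneg zero_le_two hC0) hρ hgr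
  have hT := taylor_of_subgradient hsg (ξ p) X hX
  have hξη : ‖ξ p‖ < η := (hξ p hp).1.trans_le
    ((min_le_right _ _).trans ((min_le_left _ _).trans (by linarith)))
  have hXt : ∀ (t : ℝ) v, ⟪X (t • v), t • v⟫ = t ^ 2 * ⟪X v, v⟫ := by
    intro t v
    rw [map_smul, real_inner_smul_left, real_inner_smul_right]; ring
  refine ⟨ξ p, X, hξη, ?_, ?_, ?_, hT⟩
  · rw [hsgeq p hp]
    have h1 : ‖B' (ξ p)‖ ≤ C * (η / (4 * (C + 1))) := by
      refine (B'.le_opNorm _).trans ?_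
      gcongr
      exact (hξ p hp).1.le.trans ((min_le_right _ _).trans (min_le_right _ _))
    have h2 : C * (η / (4 * (C + 1))) ≤ η / 4 := by
      rw [mul_div_assoc', div_le_div_iff₀ (by positivity) (by positivity)]
      nlinarith
    have h3 : ‖p‖ < η / 4 := hp.trans_le (min_le_right _ _)
    have := norm_add_le p (B' (ξ p))
    linarith
  · refine nonneg_of_sq_lower_bound (Q := fun v => ⟪X v, v⟫) hXt fun ε hε => ?_
    filter_upwards [hT (ε / 2) (by positivity)] with v hv
    have h1 := hsg (ξ p) (ξ p + v)
    rw [add_sub_cancel_left] at h1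
    have := (abs_le.mp hv).2
    linarith
  · have := nonneg_of_sq_lower_bound (Q := fun v => ⟪B' v, v⟫ - ⟪X v, v⟫) (fun t v => by
      rw [hXt, map_smul, real_inner_smul_left, real_inner_smul_right]; ring) (fun ε hε => by
      have hb : ∀ᶠ v in nhds (0 : E), ‖v‖ ≤ r' - ‖ξ p‖ := by
        filter_upwards [Metric.closedBall_mem_nhds (0 : E) (sub_pos.mpr (hξ p hp).1)] with v hv
        simpa using hv
      filter_upwards [hT (ε / 2) (by positivity), hb] with v hv hv2
      have h1 := hloc p hp v hv2
      rw [← hsgeq p hp] at h1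
      have := (abs_le.mp hv).1
      linarith)
    intro v
    have h := this v
    rw [← hB'in]
    linarith

end JensenAlexandrov

section QuadForm

variable {E G : Type*} [NormedAddCommGroup E] [InnerProductSpace ℝ E]
  [NormedAddCommGroup G] [InnerProductSpace ℝ G]

/-- Quadratic forms of symmetric operators. -/
def IsQuadForm (q : E → ℝ) : Prop :=
  ∃ B : E →L[ℝ] E, (∀ v w, ⟪B v, w⟫ = ⟪B w, v⟫) ∧ ∀ v, q v = ⟪B v, v⟫

theorem IsQuadForm.add {p q : E → ℝ} (hp : IsQuadForm p) (hq : IsQuadForm q) :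
    IsQuadForm fun v => p v + q v := by
  obtain ⟨B, hB, hBq⟩ := hp
  obtain ⟨C, hC, hCq⟩ := hq
  exact ⟨B + C, fun v w => by simp only [add_apply, inner_add_left, hB v w, hC v w],
    fun v => by simp only [add_apply, inner_add_left, hBq, hCq]⟩

theorem IsQuadForm.const_mul {q : E → ℝ} (hq : IsQuadForm q) (c : ℝ) :
    IsQuadForm fun v => c * q v := by
  obtain ⟨C, hC, hCq⟩ := hq
  exact ⟨c • C, fun v w => by simp only [smul_apply, real_inner_smul_left, hC v w],
    fun v => by simp only [smul_apply, real_inner_smul_left, hCq]⟩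

theorem isQuadForm_norm_sq : IsQuadForm fun v : E => ‖v‖ ^ 2 :=
  ⟨ContinuousLinearMap.id ℝ E, fun v w => by simp [real_inner_comm],
    fun v => by simp⟩

theorem IsQuadForm.map_smul {q : E → ℝ} (hq : IsQuadForm q) (t : ℝ) (v : E) :
    q (t • v) = t ^ 2 * q v := by
  obtain ⟨C, hC, hCq⟩ := hq
  rw [hCq, hCq, _root_.map_smul, real_inner_smul_left, real_inner_smul_right]; ring

variable [FiniteDimensional ℝ E] [FiniteDimensional ℝ G]

theorem isQuadForm_of_operator (X : E →L[ℝ] E) : IsQuadForm fun v => ⟪X v, v⟫ := by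
  refine ⟨(1 / 2 : ℝ) • (X + X.adjoint), fun v w => ?_, fun v => ?_⟩
  · simp only [smul_apply, add_apply, real_inner_smul_left, inner_add_left,
      ContinuousLinearMap.adjoint_inner_left]
    rw [real_inner_comm (X w) v, real_inner_comm (X v) w]; ring
  · simp only [smul_apply, add_apply, real_inner_smul_left, inner_add_left,
      ContinuousLinearMap.adjoint_inner_left]
    rw [real_inner_comm (X v) v]; ring

theorem IsQuadForm.comp {q : G → ℝ} (hq : IsQuadForm q) (D : E →L[ℝ] G) :
    IsQuadForm fun v => q (D v) := by
  obtain ⟨C, hC, hCq⟩ := hq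
  exact ⟨D.adjoint ∘L C ∘L D, fun v w => by
      simp only [ContinuousLinearMap.comp_apply, ContinuousLinearMap.adjoint_inner_left, hC (D v)],
    fun v => by
      simp only [ContinuousLinearMap.comp_apply, ContinuousLinearMap.adjoint_inner_left, hCq]⟩

theorem isQuadForm_sq (D : E →L[ℝ] ℝ) : IsQuadForm fun v : E => D v ^ 2 := by
  simpa using (isQuadForm_norm_sq (E := ℝ)).comp D

end QuadForm

section TheoremOnSums

variable {H : Type*} [NormedAddCommGroup H] [InnerProductSpace ℝ H] [FiniteDimensional ℝ H]

/-- `q` is the quadratic part of a superjet of `U` at `z` with gradient `p`. -/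
def HasUpperJet (U : H → ℝ) (z p : H) (q : H → ℝ) : Prop :=
  ∀ ε > 0, ∀ᶠ v in nhds (0 : H), U (z + v) ≤ U z + ⟪p, v⟫ + 1 / 2 * q v + ε * ‖v‖ ^ 2

theorem exists_sup_convolution {U : H → ℝ} {z₀ : H} {r : ℝ} (hr : 0 < r)
    (hU : ContinuousOn U (closedBall z₀ r)) (P : H) (lam : ℝ) :
    ∃ Z : H → H, ∀ ξ, ‖Z ξ - z₀‖ ≤ r ∧ ∀ z, ‖z - z₀‖ ≤ r →
      U z - ⟪P, z - z₀⟫ - lam / 2 * ‖z - z₀ - ξ‖ ^ 2 ≤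
        U (Z ξ) - ⟪P, Z ξ - z₀⟫ - lam / 2 * ‖Z ξ - z₀ - ξ‖ ^ 2 := by
  have : ∀ ξ : H, ∃ z' : H, ‖z' - z₀‖ ≤ r ∧ ∀ z, ‖z - z₀‖ ≤ r →
      U z - ⟪P, z - z₀⟫ - lam / 2 * ‖z - z₀ - ξ‖ ^ 2 ≤
        U z' - ⟪P, z' - z₀⟫ - lam / 2 * ‖z' - z₀ - ξ‖ ^ 2 := by
    intro ξ
    have hc : ContinuousOn (fun z => U z - ⟪P, z - z₀⟫ - lam / 2 * ‖z - z₀ - ξ‖ ^ 2)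
        (closedBall z₀ r) := by
      refine (hU.sub ?_).sub ?_
      · exact Continuous.continuousOn (by fun_prop)
      · exact Continuous.continuousOn (by fun_prop)
    obtain ⟨z', hz', hm⟩ := (isCompact_closedBall z₀ r).exists_isMaxOn
      ⟨z₀, mem_closedBall_self hr.le⟩ hc
    exact ⟨z', mem_closedBall_iff_norm.mp hz', fun z hz => hm (mem_closedBall_iff_norm.mpr hz)⟩
  choose Z hZ using this
  exact ⟨Z, hZ⟩

theorem exists_doubled_jets {U V : H → ℝ} {z₀ w₀ P Q : H} {r lam : ℝ} (hr : 0 < r)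
    (hlam : 0 < lam) (hU : ContinuousOn U (closedBall z₀ r))
    (hV : ContinuousOn V (closedBall w₀ r)) {q : WithLp 2 (H × H) → ℝ} (hq : IsQuadForm q)
    (hmax : ∀ z w : H, ‖z - z₀‖ ≤ r → ‖w - w₀‖ ≤ r → ∀ ξ : WithLp 2 (H × H),
      U z + V w ≤ U z₀ + V w₀ + ⟪P, z - z₀⟫ + ⟪Q, w - w₀⟫ +
        1 / 2 * (q ξ + lam * (‖z - z₀ - ξ.fst‖ ^ 2 + ‖w - w₀ - ξ.snd‖ ^ 2)))
    {η : ℝ} (hη : 0 < η) :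
    ∃ (z w P' Q' : H) (qU qV : H → ℝ), ‖z - z₀‖ < η ∧ ‖w - w₀‖ < η ∧ ‖P' - P‖ < η ∧
      ‖Q' - Q‖ < η ∧ IsQuadForm qU ∧ IsQuadForm qV ∧ HasUpperJet U z P' qU ∧
      HasUpperJet V w Q' qV ∧ (∀ v, -(lam * ‖v‖ ^ 2) ≤ qU v) ∧ (∀ v, -(lam * ‖v‖ ^ 2) ≤ qV v) ∧
      ∀ v₁ v₂, qU v₁ + qV v₂ ≤ q (WithLp.toLp 2 (v₁, v₂)) + η * (‖v₁‖ ^ 2 + ‖v₂‖ ^ 2) := by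
  obtain ⟨Z, hZ⟩ := exists_sup_convolution hr hU P lam
  obtain ⟨W, hW⟩ := exists_sup_convolution hr hV Q lam
  obtain ⟨B, hBs, hBq⟩ := hq
  have hns : ∀ ξ : WithLp 2 (H × H), ‖ξ‖ ^ 2 = ‖ξ.fst‖ ^ 2 + ‖ξ.snd‖ ^ 2 := fun ξ =>
    WithLp.prod_norm_sq_eq_of_L2 ξ
  have hin : ∀ ξ ζ : WithLp 2 (H × H), ⟪ξ, ζ⟫ = ⟪ξ.fst, ζ.fst⟫ + ⟪ξ.snd, ζ.snd⟫ := fun ξ ζ =>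
    WithLp.prod_inner_apply ξ ζ
  set Uh : H → ℝ := fun ξ => U (Z ξ) - ⟪P, Z ξ - z₀⟫ - lam / 2 * ‖Z ξ - z₀ - ξ‖ ^ 2 with hUh
  set Vh : H → ℝ := fun ξ => V (W ξ) - ⟪Q, W ξ - w₀⟫ - lam / 2 * ‖W ξ - w₀ - ξ‖ ^ 2 with hVh
  set g : WithLp 2 (H × H) → ℝ := fun ξ =>
    (Uh ξ.fst + lam / 2 * ‖ξ.fst‖ ^ 2) + (Vh ξ.snd + lam / 2 * ‖ξ.snd‖ ^ 2) with hg
  set sg : WithLp 2 (H × H) → WithLp 2 (H × H) := fun ξ =>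
    WithLp.toLp 2 (lam • (Z ξ.fst - z₀), lam • (W ξ.snd - w₀)) with hsgd
  have hexp : ∀ a b : H, ‖a - b‖ ^ 2 = ‖a‖ ^ 2 - 2 * ⟪a, b⟫ + ‖b‖ ^ 2 := fun a b =>
    norm_sub_sq_real a b
  have hsg : ∀ ξ y, g ξ + ⟪sg ξ, y - ξ⟫ ≤ g y := by
    intro ξ y
    have h1 := (hZ y.fst).2 (Z ξ.fst) (hZ ξ.fst).1
    have h2 := (hW y.snd).2 (W ξ.snd) (hW ξ.snd).1
    simp only [hg, hsgd, hUh, hVh, hin, WithLp.toLp_fst, WithLp.toLp_snd, WithLp.sub_fst,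
      WithLp.sub_snd, real_inner_smul_left, inner_sub_right]
    rw [hexp (Z ξ.fst - z₀) y.fst] at h1
    rw [hexp (W ξ.snd - w₀) y.snd] at h2
    rw [hexp (Z ξ.fst - z₀) ξ.fst, hexp (W ξ.snd - w₀) ξ.snd]
    simp only [inner_sub_right] at h1 h2
    linarith
  have hRn : ∀ ξ, ‖sg ξ‖ ^ 2 = (lam * ‖Z ξ.fst - z₀‖) ^ 2 + (lam * ‖W ξ.snd - w₀‖) ^ 2 := by
    intro ξ
    rw [hns]
    simp only [hsgd, WithLp.toLp_fst, WithLp.toLp_snd, norm_smul, Real.norm_eq_abs,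
      abs_of_pos hlam]
  have hR : ∀ ξ, ‖sg ξ‖ ≤ 2 * (lam * r) := by
    intro ξ
    refine abs_le_of_sq_le_sq' ?_ (by positivity) |>.2
    rw [hRn, mul_pow lam ‖_‖, mul_pow lam ‖_‖]
    have h1 : ‖Z ξ.fst - z₀‖ ^ 2 ≤ r ^ 2 := by gcongr; exact (hZ _).1
    have h2 : ‖W ξ.snd - w₀‖ ^ 2 ≤ r ^ 2 := by gcongr; exact (hW _).1
    nlinarith [sq_nonneg lam, sq_nonneg (lam * r)]
  set B' : WithLp 2 (H × H) →L[ℝ] WithLp 2 (H × H) :=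
    B + lam • ContinuousLinearMap.id ℝ _ with hB'
  have hB'in : ∀ v, ⟪B' v, v⟫ = q v + lam * ‖v‖ ^ 2 := by
    intro v
    simp only [hB', add_apply, smul_apply, ContinuousLinearMap.id_apply, inner_add_left,
      real_inner_smul_left, real_inner_self_eq_norm_sq, hBq]
  have hB's : ∀ v w, ⟪B' v, w⟫ = ⟪B' w, v⟫ := by
    intro v w
    simp only [hB', add_apply, smul_apply, ContinuousLinearMap.id_apply, inner_add_left,
      real_inner_smul_left, hBs v w, real_inner_comm v w]
  have hgmax : ∀ ξ, ‖ξ‖ ≤ (1 : ℝ) → g ξ ≤ g 0 + 1 / 2 * ⟪B' ξ, ξ⟫ := by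
    intro ξ _
    have h1 := (hZ 0).2 z₀ (by simp [hr.le])
    have h2 := (hW 0).2 w₀ (by simp [hr.le])
    have h3 := hmax (Z ξ.fst) (W ξ.snd) (hZ _).1 (hW _).1 ξ
    rw [hB'in, hns]
    simp only [hg, hUh, hVh, WithLp.zero_fst, WithLp.zero_snd, norm_zero]
    simp only [sub_self, inner_zero_right, sub_zero, norm_zero] at h1 h2 ⊢
    linarith
  set η' := min (min (η / 4) (lam * η / 2)) (min (lam * r) (η / (4 * (lam + 1)))) with hη'
  have hη'0 : 0 < η' := by positivity
  have hη1 : η' ≤ η / 4 := (min_le_left _ _).trans (min_le_left _ _)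
  have hη2 : η' ≤ lam * η / 2 := (min_le_left _ _).trans (min_le_right _ _)
  have hη3 : η' ≤ lam * r := (min_le_right _ _).trans (min_le_left _ _)
  have hη4 : η' ≤ η / (4 * (lam + 1)) := (min_le_right _ _).trans (min_le_right _ _)
  obtain ⟨ξ, X, hξ, hsgξ, hX0, hXB, hXe⟩ :=
    exists_second_order_expansion hR hsg B' hB's one_pos hgmax hη'0
  have hZξ : lam * ‖Z ξ.fst - z₀‖ < η' := by
    refine lt_of_le_of_lt ?_ hsgξ
    refine abs_le_of_sq_le_sq' ?_ (norm_nonneg _) |>.2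
    rw [hRn]; nlinarith [sq_nonneg (lam * ‖W ξ.snd - w₀‖)]
  have hWξ : lam * ‖W ξ.snd - w₀‖ < η' := by
    refine lt_of_le_of_lt ?_ hsgξ
    refine abs_le_of_sq_le_sq' ?_ (norm_nonneg _) |>.2
    rw [hRn]; nlinarith [sq_nonneg (lam * ‖Z ξ.fst - z₀‖)]
  have hξ1 : ‖ξ.fst‖ < η' := by
    refine lt_of_le_of_lt ?_ hξ
    refine abs_le_of_sq_le_sq' ?_ (norm_nonneg _) |>.2
    rw [hns]; nlinarith [sq_nonneg (‖ξ.snd‖)]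
  have hξ2 : ‖ξ.snd‖ < η' := by
    refine lt_of_le_of_lt ?_ hξ
    refine abs_le_of_sq_le_sq' ?_ (norm_nonneg _) |>.2
    rw [hns]; nlinarith [sq_nonneg (‖ξ.fst‖)]
  let i₁ : H →L[ℝ] WithLp 2 (H × H) :=
    (WithLp.prodContinuousLinearEquiv 2 ℝ H H).symm.toContinuousLinearMap ∘L
      ContinuousLinearMap.inl ℝ H H
  let i₂ : H →L[ℝ] WithLp 2 (H × H) :=
    (WithLp.prodContinuousLinearEquiv 2 ℝ H H).symm.toContinuousLinearMap ∘L
      ContinuousLinearMap.inr ℝ H H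
  have hi₁ : ∀ v, i₁ v = WithLp.toLp 2 (v, 0) := fun v => rfl
  have hi₂ : ∀ v, i₂ v = WithLp.toLp 2 (0, v) := fun v => rfl
  have hXq := isQuadForm_of_operator X
  have hn1 : ∀ v, ‖i₁ v‖ ^ 2 = ‖v‖ ^ 2 := fun v => by rw [hns]; simp [hi₁]
  have hn2 : ∀ v, ‖i₂ v‖ ^ 2 = ‖v‖ ^ 2 := fun v => by rw [hns]; simp [hi₂]
  have ht1 : Tendsto i₁ (nhds 0) (nhds 0) := by simpa using i₁.continuous.tendsto 0
  have ht2 : Tendsto i₂ (nhds 0) (nhds 0) := by simpa using i₂.continuous.tendsto 0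
  have hsep : ∀ v₁ v₂, ⟪X (WithLp.toLp 2 (v₁, v₂)), WithLp.toLp 2 (v₁, v₂)⟫ =
      ⟪X (i₁ v₁), i₁ v₁⟫ + ⟪X (i₂ v₂), i₂ v₂⟫ := by
    set Qf : WithLp 2 (H × H) → ℝ := fun v =>
      ⟪X v, v⟫ - (⟪X (i₁ v.fst), i₁ v.fst⟫ + ⟪X (i₂ v.snd), i₂ v.snd⟫) with hQf
    have hQt : ∀ (t : ℝ) v, Qf (t • v) = t ^ 2 * Qf v := by
      intro t v
      simp only [hQf, map_smul, real_inner_smul_left, real_inner_smul_right, WithLp.smul_fst,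
        WithLp.smul_snd]
      ring
    have hf1 : Tendsto (fun v : WithLp 2 (H × H) => i₁ v.fst) (nhds 0) (nhds 0) := by
      have : Continuous (fun v : WithLp 2 (H × H) => i₁ v.fst) := by fun_prop
      simpa using this.tendsto 0
    have hf2 : Tendsto (fun v : WithLp 2 (H × H) => i₂ v.snd) (nhds 0) (nhds 0) := by
      have : Continuous (fun v : WithLp 2 (H × H) => i₂ v.snd) := by fun_prop
      simpa using this.tendsto 0
    have hev : ∀ ε > 0, ∀ᶠ v in nhds (0 : WithLp 2 (H × H)), |Qf v| ≤ ε * ‖v‖ ^ 2 := by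
      intro ε hε
      have h0 := hXe (ε / 4) (by positivity)
      filter_upwards [h0, hf1.eventually h0, hf2.eventually h0] with v h0 h1 h2
      rw [hn1] at h1
      rw [hn2] at h2
      rw [hns] at h0 ⊢
      have e1 : g (ξ + i₁ v.fst) = (Uh (ξ.fst + v.fst) + lam / 2 * ‖ξ.fst + v.fst‖ ^ 2) +
        (Vh ξ.snd + lam / 2 * ‖ξ.snd‖ ^ 2) := by simp [hg, hi₁]
      have e2 : g (ξ + i₂ v.snd) = (Uh ξ.fst + lam / 2 * ‖ξ.fst‖ ^ 2) +
        (Vh (ξ.snd + v.snd) + lam / 2 * ‖ξ.snd + v.snd‖ ^ 2) := by simp [hg, hi₂]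
      have e3 : g (ξ + v) = (Uh (ξ.fst + v.fst) + lam / 2 * ‖ξ.fst + v.fst‖ ^ 2) +
        (Vh (ξ.snd + v.snd) + lam / 2 * ‖ξ.snd + v.snd‖ ^ 2) := by simp [hg]
      have e4 : ⟪sg ξ, v⟫ = ⟪sg ξ, i₁ v.fst⟫ + ⟪sg ξ, i₂ v.snd⟫ := by
        rw [hin, hin, hin]; simp [hi₁, hi₂]
      have e5 : g ξ = (Uh ξ.fst + lam / 2 * ‖ξ.fst‖ ^ 2) +
        (Vh ξ.snd + lam / 2 * ‖ξ.snd‖ ^ 2) := rfl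
      rw [e1] at h1
      rw [e2] at h2
      rw [e3] at h0
      rw [abs_le] at *
      simp only [hQf]
      constructor <;> linarith [h0.1, h0.2, h1.1, h1.2, h2.1, h2.2]
    have hge := nonneg_of_sq_lower_bound hQt (fun ε hε => by
      filter_upwards [hev ε hε] with v hv
      exact (abs_le.mp hv).1)
    have hle := nonneg_of_sq_lower_bound (Q := fun v => -Qf v) (fun t v => by rw [hQt]; ring)
      (fun ε hε => by
        filter_upwards [hev ε hε] with v hv
        have := (abs_le.mp hv).2
        linarith)
    intro v₁ v₂
    have h1 := hge (WithLp.toLp 2 (v₁, v₂))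
    have h2 := hle (WithLp.toLp 2 (v₁, v₂))
    simp only [hQf, WithLp.toLp_fst, WithLp.toLp_snd] at h1 h2
    linarith
  have hZlt : ‖Z ξ.fst - z₀‖ < r := by
    have := hZξ.trans_le hη3
    exact lt_of_mul_lt_mul_left this hlam.le
  have hWlt : ‖W ξ.snd - w₀‖ < r := by
    have := hWξ.trans_le hη3
    exact lt_of_mul_lt_mul_left this hlam.le
  have hsmall : ∀ a b c : H, lam * ‖a‖ < η' → ‖b‖ < η' → ‖c + lam • a - lam • b - c‖ < η := by
    intro a b c ha hb
    rw [show c + lam • a - lam • b - c = lam • a - lam • b by abel]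
    refine (norm_sub_le _ _).trans_lt ?_
    rw [norm_smul, norm_smul, Real.norm_eq_abs, abs_of_pos hlam]
    have h1 : lam * ‖b‖ ≤ lam * (η / (4 * (lam + 1))) := by
      gcongr; exact hb.le.trans hη4
    have h2 : lam * (η / (4 * (lam + 1))) ≤ η / 4 := by
      rw [mul_div_assoc', div_le_div_iff₀ (by positivity) (by positivity)]
      nlinarith
    linarith
  have hnear : ∀ (z z₁ : H), ‖z - z₁‖ < r → ∀ᶠ v in nhds (0 : H), ‖z + v - z₁‖ ≤ r := by
    intro z z₁ hz
    have : ContinuousAt (fun v : H => ‖z + v - z₁‖) 0 := by fun_prop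
    filter_upwards [this.eventually_lt_const (u := r) (by simpa using hz)] with v hv
    exact hv.le
  refine ⟨Z ξ.fst, W ξ.snd, P + lam • (Z ξ.fst - z₀) - lam • ξ.fst,
    Q + lam • (W ξ.snd - w₀) - lam • ξ.snd, fun v => ⟪X (i₁ v), i₁ v⟫ + (-lam) * ‖v‖ ^ 2,
    fun v => ⟪X (i₂ v), i₂ v⟫ + (-lam) * ‖v‖ ^ 2, ?_, ?_, hsmall _ _ _ hZξ hξ1,
    hsmall _ _ _ hWξ hξ2, (hXq.comp i₁).add (isQuadForm_norm_sq.const_mul _),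
    (hXq.comp i₂).add (isQuadForm_norm_sq.const_mul _), ?_, ?_, ?_, ?_, ?_⟩
  · refine lt_of_mul_lt_mul_left (a := lam) ?_ hlam.le
    nlinarith
  · refine lt_of_mul_lt_mul_left (a := lam) ?_ hlam.le
    nlinarith
  · intro ε hε
    filter_upwards [ht1.eventually (hXe ε hε), hnear _ _ hZlt] with v hv hv2
    have h1 := (hZ (ξ.fst + v)).2 (Z ξ.fst + v) hv2
    rw [hn1] at hv
    have e1 : g (ξ + i₁ v) = (Uh (ξ.fst + v) + lam / 2 * ‖ξ.fst + v‖ ^ 2) +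
        (Vh ξ.snd + lam / 2 * ‖ξ.snd‖ ^ 2) := by simp [hg, hi₁]
    have e2 : ⟪sg ξ, i₁ v⟫ = lam * ⟪Z ξ.fst - z₀, v⟫ := by
      rw [hin]; simp [hi₁, hsgd, real_inner_smul_left]
    have e5 : g ξ = (Uh ξ.fst + lam / 2 * ‖ξ.fst‖ ^ 2) +
        (Vh ξ.snd + lam / 2 * ‖ξ.snd‖ ^ 2) := rfl
    rw [e1, e2, e5, norm_add_sq_real] at hv
    have h2 := (abs_le.mp hv).2
    have e6 : Z ξ.fst + v - z₀ - (ξ.fst + v) = Z ξ.fst - z₀ - ξ.fst := by abel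
    have e7 : Z ξ.fst + v - z₀ = (Z ξ.fst - z₀) + v := by abel
    rw [e6, e7, inner_add_right] at h1
    have e8 : Uh ξ.fst = U (Z ξ.fst) - ⟪P, Z ξ.fst - z₀⟫ -
      lam / 2 * ‖Z ξ.fst - z₀ - ξ.fst‖ ^ 2 := rfl
    have e9 : Uh (ξ.fst + v) = U (Z (ξ.fst + v)) - ⟪P, Z (ξ.fst + v) - z₀⟫ -
      lam / 2 * ‖Z (ξ.fst + v) - z₀ - (ξ.fst + v)‖ ^ 2 := rfl
    rw [← e9] at h1
    simp only [inner_sub_left, inner_add_left, real_inner_smul_left] at h2 ⊢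
    linarith
  · intro ε hε
    filter_upwards [ht2.eventually (hXe ε hε), hnear _ _ hWlt] with v hv hv2
    have h1 := (hW (ξ.snd + v)).2 (W ξ.snd + v) hv2
    rw [hn2] at hv
    have e1 : g (ξ + i₂ v) = (Uh ξ.fst + lam / 2 * ‖ξ.fst‖ ^ 2) +
        (Vh (ξ.snd + v) + lam / 2 * ‖ξ.snd + v‖ ^ 2) := by simp [hg, hi₂]
    have e2 : ⟪sg ξ, i₂ v⟫ = lam * ⟪W ξ.snd - w₀, v⟫ := by
      rw [hin]; simp [hi₂, hsgd, real_inner_smul_left]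
    have e5 : g ξ = (Uh ξ.fst + lam / 2 * ‖ξ.fst‖ ^ 2) +
        (Vh ξ.snd + lam / 2 * ‖ξ.snd‖ ^ 2) := rfl
    rw [e1, e2, e5, norm_add_sq_real] at hv
    have h2 := (abs_le.mp hv).2
    have e6 : W ξ.snd + v - w₀ - (ξ.snd + v) = W ξ.snd - w₀ - ξ.snd := by abel
    have e7 : W ξ.snd + v - w₀ = (W ξ.snd - w₀) + v := by abel
    rw [e6, e7, inner_add_right] at h1
    have e8 : Vh ξ.snd = V (W ξ.snd) - ⟪Q, W ξ.snd - w₀⟫ -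
      lam / 2 * ‖W ξ.snd - w₀ - ξ.snd‖ ^ 2 := rfl
    have e9 : Vh (ξ.snd + v) = V (W (ξ.snd + v)) - ⟪Q, W (ξ.snd + v) - w₀⟫ -
      lam / 2 * ‖W (ξ.snd + v) - w₀ - (ξ.snd + v)‖ ^ 2 := rfl
    rw [← e9] at h1
    simp only [inner_sub_left, inner_add_left, real_inner_smul_left] at h2 ⊢
    linarith
  · intro v
    have := hX0 (i₁ v)
    linarith
  · intro v
    have := hX0 (i₂ v)
    linarith
  · intro v₁ v₂
    have h1 := hXB (WithLp.toLp 2 (v₁, v₂))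
    rw [hsep, hB'in, hns] at h1
    simp only [WithLp.toLp_fst, WithLp.toLp_snd] at h1
    have h2 : η' * (‖v₁‖ ^ 2 + ‖v₂‖ ^ 2) ≤ η * (‖v₁‖ ^ 2 + ‖v₂‖ ^ 2) := by
      gcongr; linarith
    linarith

end TheoremOnSums

/-- The matrix of a quadratic form, by polarization. -/
def polarMat (q : EucSp N → ℝ) : MatN N := fun i j =>
  (q (EuclideanSpace.single i 1 + EuclideanSpace.single j 1) - q (EuclideanSpace.single i 1) -
    q (EuclideanSpace.single j 1)) / 2

theorem polarMat_isSymm (q : EucSp N → ℝ) : (polarMat q).IsSymm := by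
  ext i j
  simp only [polarMat, Matrix.transpose_apply]
  rw [add_comm]; ring

theorem polarMat_eq_inner {q : EucSp N → ℝ} {B : EucSp N →L[ℝ] EucSp N}
    (hB : ∀ v w, ⟪B v, w⟫ = ⟪B w, v⟫) (hq : ∀ v, q v = ⟪B v, v⟫) (i j : Fin N) :
    polarMat q i j = ⟪B (EuclideanSpace.single i 1), EuclideanSpace.single j 1⟫ := by
  simp only [polarMat, hq, map_add, inner_add_left, inner_add_right]
  rw [hB (EuclideanSpace.single j 1) (EuclideanSpace.single i 1)]; ring

theorem polarMat_dotProduct {q : EucSp N → ℝ} (hq : IsQuadForm q) (v : EucSp N) :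
    dotProduct (v : Fin N → ℝ) ((polarMat q).mulVec v) = q v := by
  obtain ⟨B, hB, hBq⟩ := hq
  rw [hBq]
  have hv : v = ∑ i, v i • (EuclideanSpace.single i (1 : ℝ) : EucSp N) := by
    ext j
    simp [Finset.sum_apply, Pi.single_apply]
  conv_rhs => rw [hv]
  simp only [dotProduct, Matrix.mulVec, map_sum, map_smul, sum_inner, inner_sum,
    real_inner_smul_left, real_inner_smul_right, polarMat_eq_inner hB hBq]
  refine Finset.sum_congr rfl fun i _ => ?_
  rw [Finset.mul_sum]
  refine Finset.sum_congr rfl fun j _ => ?_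
  rw [hB]; ring

theorem polarMat_add (p q : EucSp N → ℝ) :
    polarMat (fun v => p v + q v) = polarMat p + polarMat q := by
  ext i j; simp only [polarMat, Matrix.add_apply]; ring

theorem polarMat_const_mul (c : ℝ) (q : EucSp N → ℝ) :
    polarMat (fun v => c * q v) = c • polarMat q := by
  ext i j; simp only [polarMat, Matrix.smul_apply, smul_eq_mul]; ring

theorem polarMat_norm_sq : polarMat (fun v : EucSp N => ‖v‖ ^ 2) = 1 := by
  ext i j
  simp only [polarMat, norm_add_sq_real, Matrix.one_apply, EuclideanSpace.inner_single_left]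
  simp only [PiLp.norm_single, norm_one, PiLp.single_apply]
  split_ifs <;> simp

theorem polarMat_posSemidef {q : EucSp N → ℝ} (hq : IsQuadForm q) (h0 : ∀ v, 0 ≤ q v) :
    (polarMat q).PosSemidef := by
  refine Matrix.PosSemidef.of_dotProduct_mulVec_nonneg ?_ fun x => ?_
  · exact (polarMat_isSymm q)
  · have := h0 (WithLp.toLp 2 x)
    rw [← polarMat_dotProduct hq] at this
    simpa using this

theorem contDiff_quadratic_test (c b d : ℝ) (p x₀ : EucSp N) (t₀ : ℝ)
    {q : EucSp N → ℝ} (hq : IsQuadForm q) :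
    ContDiff ℝ 2 (fun z : EucSp N × ℝ => c + ⟪p, z.1 - x₀⟫ + 1 / 2 * q (z.1 - x₀) +
      (b * (z.2 - t₀) + d * (z.2 - t₀) ^ 2)) := by
  obtain ⟨B, hB, hBq⟩ := hq
  simp only [hBq]
  have h1 : ContDiff ℝ 2 (fun z : EucSp N × ℝ => z.1 - x₀) := by fun_prop
  have h2 : ContDiff ℝ 2 (fun z : EucSp N × ℝ => B (z.1 - x₀)) := by fun_prop
  have h3 : ContDiff ℝ 2 (fun z : EucSp N × ℝ => ⟪p, z.1 - x₀⟫) := contDiff_const.inner ℝ h1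
  have h4 : ContDiff ℝ 2 (fun z : EucSp N × ℝ => ⟪B (z.1 - x₀), z.1 - x₀⟫) := h2.inner ℝ h1
  fun_prop

theorem hasFDerivAt_quadratic (c : ℝ) (p x₀ : EucSp N) {B : EucSp N →L[ℝ] EucSp N}
    (hB : ∀ v w, ⟪B v, w⟫ = ⟪B w, v⟫) (x : EucSp N) :
    HasFDerivAt (fun x => c + ⟪p, x - x₀⟫ + 1 / 2 * ⟪B (x - x₀), x - x₀⟫)
      (innerSL ℝ (p + B (x - x₀))) x := by
  have h0 : HasFDerivAt (fun x : EucSp N => x - x₀) (ContinuousLinearMap.id ℝ _) x :=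
    (hasFDerivAt_id x).sub_const x₀
  have h1 : HasFDerivAt (fun x : EucSp N => B (x - x₀)) (B ∘L ContinuousLinearMap.id ℝ _) x :=
    B.hasFDerivAt.comp x h0
  have h2 := ((hasFDerivAt_const p x).inner ℝ h0)
  have h3 := h1.inner ℝ h0
  have h4 := (h2.const_add c).add (h3.const_mul (1 / 2))
  refine h4.congr_fderiv ?_
  ext v
  simp [fderivInnerCLM_apply]
  rw [hB v (x - x₀), ← inner_sub_left, ← map_sub]
  ring

theorem gradient_quadratic (c : ℝ) (p x₀ : EucSp N) {q : EucSp N → ℝ} (hq : IsQuadForm q) :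
    gradient (fun x => c + ⟪p, x - x₀⟫ + 1 / 2 * q (x - x₀)) x₀ = p := by
  obtain ⟨B, hB, hBq⟩ := hq
  simp only [hBq]
  have := hasFDerivAt_quadratic c p x₀ hB x₀
  rw [sub_self, map_zero, add_zero] at this
  exact HasGradientAt.gradient (hasGradientAt_iff_hasFDerivAt.mpr
    (this.congr_fderiv rfl))

theorem hessMat_quadratic (c : ℝ) (p x₀ : EucSp N) {q : EucSp N → ℝ} (hq : IsQuadForm q) :
    hessMat (fun x => c + ⟪p, x - x₀⟫ + 1 / 2 * q (x - x₀)) x₀ = polarMat q := by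
  obtain ⟨B, hB, hBq⟩ := hq
  have hf : fderiv ℝ (fun x => c + ⟪p, x - x₀⟫ + 1 / 2 * q (x - x₀)) =
      fun x => innerSL ℝ (p + B (x - x₀)) := by
    funext x
    simp only [hBq]
    exact (hasFDerivAt_quadratic c p x₀ hB x).fderiv
  have hd : HasFDerivAt (fun x => innerSL ℝ (p + B (x - x₀))) ((innerSL ℝ) ∘L B) x₀ := by
    have h0 : HasFDerivAt (fun x : EucSp N => x - x₀) (ContinuousLinearMap.id ℝ _) x₀ :=
      (hasFDerivAt_id x₀).sub_const x₀
    have h1 : HasFDerivAt (fun x : EucSp N => B (x - x₀)) B x₀ :=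
      (B.hasFDerivAt (x := x₀ - x₀)).comp x₀ (f := fun x => x - x₀) h0
    exact ((innerSL ℝ).hasFDerivAt).comp x₀ (h1.const_add p)
  ext i j
  rw [hessMat, iteratedFDeriv_two_apply, hf, hd.fderiv, polarMat_eq_inner hB hBq]
  rfl

theorem deriv_quadratic_time (k b d t₀ : ℝ) :
    deriv (fun s : ℝ => k + (b * (s - t₀) + d * (s - t₀) ^ 2)) t₀ = b := by
  have h0 : HasDerivAt (fun s : ℝ => s - t₀) 1 t₀ := (hasDerivAt_id t₀).sub_const t₀
  have := ((h0.const_mul b).add ((h0.pow 2).const_mul d)).const_add k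
  simpa using this.deriv

theorem continuousAt_of_continuousOn_Ico {u : EucSp N → ℝ → ℝ} {T : ℝ}
    (hc : ContinuousOn (fun p : EucSp N × ℝ => u p.1 p.2) (univ ×ˢ Ico 0 T)) (x : EucSp N) {t : ℝ}
    (ht : t ∈ Ioo 0 T) : ContinuousAt (fun p : EucSp N × ℝ => u p.1 p.2) (x, t) := by
  refine hc.continuousAt ?_
  refine prod_mem_nhds univ_mem ?_
  exact Filter.mem_of_superset (Ioo_mem_nhds ht.1 ht.2) Ioo_subset_Ico_self

theorem uscEnv_eq {u : EucSp N → ℝ → ℝ} {x : EucSp N} {t : ℝ}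
    (hc : ContinuousAt (fun p : EucSp N × ℝ => u p.1 p.2) (x, t)) : uscEnv u x t = u x t :=
  Tendsto.limsup_eq hc

theorem lscEnv_eq {u : EucSp N → ℝ → ℝ} {x : EucSp N} {t : ℝ}
    (hc : ContinuousAt (fun p : EucSp N × ℝ => u p.1 p.2) (x, t)) : lscEnv u x t = u x t :=
  Tendsto.liminf_eq hc

theorem eventually_snd_mem_Ioo {T : ℝ} (x : EucSp N) {t : ℝ} (ht : t ∈ Ioo 0 T) :
    ∀ᶠ z : EucSp N × ℝ in nhds (x, t), z.2 ∈ Ioo 0 T :=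
  continuous_snd.continuousAt.eventually_mem (Ioo_mem_nhds ht.1 ht.2)

section Jets

variable {T α : ℝ} {F : EucSp N → EucSp N → MatN N → ℝ} {h : EucSp N → ℝ → EucSp N}
  {f u : EucSp N → ℝ → ℝ}

theorem IsSubSol.jet_le (hu : IsSubSol univ T F h α f u)
    (hc : ContinuousOn (fun p : EucSp N × ℝ => u p.1 p.2) (univ ×ˢ Ico 0 T)) {x : EucSp N} {t : ℝ}
    (ht : t ∈ Ioo 0 T) {p : EucSp N} (hp : p ≠ 0) {q : EucSp N → ℝ} (hq : IsQuadForm q) {b d : ℝ}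
    (hj : ∀ᶠ z : EucSp N × ℝ in nhds (x, t), u z.1 z.2 ≤ u x t + ⟪p, z.1 - x⟫ +
      1 / 2 * q (z.1 - x) + (b * (z.2 - t) + d * (z.2 - t) ^ 2)) :
    b - F x p (polarMat q) - gradTerm h α x t p ≤ f x t := by
  have hq0 : q 0 = 0 := by simpa using hq.map_smul 0 0
  have h1 := (hu x (mem_univ _) t ht).1 (fun y s => u x t + ⟪p, y - x⟫ +
      1 / 2 * q (y - x) + (b * (s - t) + d * (s - t) ^ 2))
    (contDiff_quadratic_test _ _ _ _ _ _ hq) (by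
      filter_upwards [hj, eventually_snd_mem_Ioo x ht] with z hz hz2
      rw [uscEnv_eq (continuousAt_of_continuousOn_Ico hc z.1 hz2)]
      exact hz) (by
      rw [uscEnv_eq (continuousAt_of_continuousOn_Ico hc x ht)]
      simp [hq0])
  have hg : gradient (fun y => u x t + ⟪p, y - x⟫ +
      1 / 2 * q (y - x) + (b * (t - t) + d * (t - t) ^ 2)) x = p := by
    simpa using gradient_quadratic (u x t) p x hq
  have hH : hessMat (fun y => u x t + ⟪p, y - x⟫ +
      1 / 2 * q (y - x) + (b * (t - t) + d * (t - t) ^ 2)) x = polarMat q := by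
    simpa using hessMat_quadratic (u x t) p x hq
  rw [hg, hH, deriv_quadratic_time] at h1
  exact h1 hp

theorem IsSuperSol.le_jet (hu : IsSuperSol univ T F h α f u)
    (hc : ContinuousOn (fun p : EucSp N × ℝ => u p.1 p.2) (univ ×ˢ Ico 0 T)) {x : EucSp N} {t : ℝ}
    (ht : t ∈ Ioo 0 T) {p : EucSp N} (hp : p ≠ 0) {q : EucSp N → ℝ} (hq : IsQuadForm q) {b d : ℝ}
    (hj : ∀ᶠ z : EucSp N × ℝ in nhds (x, t), u x t + ⟪p, z.1 - x⟫ +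
      1 / 2 * q (z.1 - x) + (b * (z.2 - t) + d * (z.2 - t) ^ 2) ≤ u z.1 z.2) :
    f x t ≤ b - F x p (polarMat q) - gradTerm h α x t p := by
  have hq0 : q 0 = 0 := by simpa using hq.map_smul 0 0
  have h1 := (hu x (mem_univ _) t ht).1 (fun y s => u x t + ⟪p, y - x⟫ +
      1 / 2 * q (y - x) + (b * (s - t) + d * (s - t) ^ 2))
    (contDiff_quadratic_test _ _ _ _ _ _ hq) (by
      filter_upwards [hj, eventually_snd_mem_Ioo x ht] with z hz hz2
      rw [lscEnv_eq (continuousAt_of_continuousOn_Ico hc z.1 hz2)]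
      exact hz) (by
      rw [lscEnv_eq (continuousAt_of_continuousOn_Ico hc x ht)]
      simp [hq0])
  have hg : gradient (fun y => u x t + ⟪p, y - x⟫ +
      1 / 2 * q (y - x) + (b * (t - t) + d * (t - t) ^ 2)) x = p := by
    simpa using gradient_quadratic (u x t) p x hq
  have hH : hessMat (fun y => u x t + ⟪p, y - x⟫ +
      1 / 2 * q (y - x) + (b * (t - t) + d * (t - t) ^ 2)) x = polarMat q := by
    simpa using hessMat_quadratic (u x t) p x hq
  rw [hg, hH, deriv_quadratic_time] at h1
  exact h1 hp

theorem deriv_quadratic_time_zero (b d t₀ : ℝ) :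
    deriv (fun s : ℝ => b * (s - t₀) + d * (s - t₀) ^ 2) t₀ = b := by
  simpa using deriv_quadratic_time 0 b d t₀

theorem IsSubSol.le_of_flat (hu : IsSubSol univ T F h α f u)
    (hc : ContinuousOn (fun p : EucSp N × ℝ => u p.1 p.2) (univ ×ˢ Ico 0 T)) {x : EucSp N} {t δ : ℝ}
    (hδ : 0 < δ) (ht : Ioo (t - δ) (t + δ) ⊆ Ioo 0 T) {b d : ℝ}
    (hle : ∀ᶠ y in nhds x, (∀ s ∈ Ioo (t - δ) (t + δ),
        u y s ≤ u x t + (b * (s - t) + d * (s - t) ^ 2)) ∧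
      ∃ s ∈ Ioo (t - δ) (t + δ), u y s = u x t + (b * (s - t) + d * (s - t) ^ 2)) :
    b ≤ f x t := by
  have htt : t ∈ Ioo (t - δ) (t + δ) := ⟨by linarith, by linarith⟩
  have heq : ∀ y, ∀ s ∈ Ioo (t - δ) (t + δ), uscEnv u y s = u y s := fun y s hs =>
    uscEnv_eq (continuousAt_of_continuousOn_Ico hc y (ht hs))
  have hsup : ∀ᶠ y in nhds x, sSup ((fun s => uscEnv u y s - (b * (s - t) + d * (s - t) ^ 2)) ''
      Ioo (t - δ) (t + δ)) = u x t := by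
    filter_upwards [hle] with y hy
    refine IsGreatest.csSup_eq ⟨?_, ?_⟩
    · obtain ⟨s, hs, hse⟩ := hy.2
      exact ⟨s, hs, by dsimp only; rw [heq y s hs, hse]; ring⟩
    · rintro _ ⟨s, hs, rfl⟩
      dsimp only
      rw [heq y s hs]
      linarith [hy.1 s hs]
  have h1 := (hu x (mem_univ _) t (ht htt)).2 δ hδ (fun s => b * (s - t) + d * (s - t) ^ 2)
    (by fun_prop) (by simp) (fun s hs => by
      rw [heq x s hs, heq x t htt]
      linarith [hle.self_of_nhds.1 s hs]) (by
      filter_upwards [hsup] with y hy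
      rw [hy, hsup.self_of_nhds])
  rwa [deriv_quadratic_time_zero] at h1

theorem IsSuperSol.le_of_flat (hu : IsSuperSol univ T F h α f u)
    (hc : ContinuousOn (fun p : EucSp N × ℝ => u p.1 p.2) (univ ×ˢ Ico 0 T)) {x : EucSp N} {t δ : ℝ}
    (hδ : 0 < δ) (ht : Ioo (t - δ) (t + δ) ⊆ Ioo 0 T) {b d : ℝ}
    (hle : ∀ᶠ y in nhds x, (∀ s ∈ Ioo (t - δ) (t + δ),
        u x t + (b * (s - t) + d * (s - t) ^ 2) ≤ u y s) ∧
      ∃ s ∈ Ioo (t - δ) (t + δ), u y s = u x t + (b * (s - t) + d * (s - t) ^ 2)) :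
    f x t ≤ b := by
  have htt : t ∈ Ioo (t - δ) (t + δ) := ⟨by linarith, by linarith⟩
  have heq : ∀ y, ∀ s ∈ Ioo (t - δ) (t + δ), lscEnv u y s = u y s := fun y s hs =>
    lscEnv_eq (continuousAt_of_continuousOn_Ico hc y (ht hs))
  have hsup : ∀ᶠ y in nhds x, sInf ((fun s => lscEnv u y s - (b * (s - t) + d * (s - t) ^ 2)) ''
      Ioo (t - δ) (t + δ)) = u x t := by
    filter_upwards [hle] with y hy
    refine IsLeast.csInf_eq ⟨?_, ?_⟩
    · obtain ⟨s, hs, hse⟩ := hy.2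
      exact ⟨s, hs, by dsimp only; rw [heq y s hs, hse]; ring⟩
    · rintro _ ⟨s, hs, rfl⟩
      dsimp only
      rw [heq y s hs]
      linarith [hy.1 s hs]
  have h1 := (hu x (mem_univ _) t (ht htt)).2 δ hδ (fun s => b * (s - t) + d * (s - t) ^ 2)
    (by fun_prop) (by simp) (fun s hs => by
      rw [heq x s hs, heq x t htt]
      linarith [hle.self_of_nhds.1 s hs]) (by
      filter_upwards [hsup] with y hy
      rw [hy, hsup.self_of_nhds])
  rwa [deriv_quadratic_time_zero] at h1

end Jets

theorem IsQuadForm.apply_add_smul {E : Type*} [NormedAddCommGroup E] [InnerProductSpace ℝ E]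
    {q : E → ℝ} (hq : IsQuadForm q) (k : ℝ) (v d : E) :
    q (v + k • d) = q v + k * (q (v + d) - q v - q d) + k ^ 2 * q d := by
  obtain ⟨B, hB, hBq⟩ := hq
  simp only [hBq, map_add, _root_.map_smul, inner_add_left, inner_add_right, real_inner_smul_left,
    real_inner_smul_right]
  rw [hB v d]; ring

theorem IsQuadForm.map_zero {E : Type*} [NormedAddCommGroup E] [InnerProductSpace ℝ E]
    {q : E → ℝ} (hq : IsQuadForm q) : q 0 = 0 := by
  simpa using hq.map_smul 0 0

theorem IsQuadForm.map_neg {E : Type*} [NormedAddCommGroup E] [InnerProductSpace ℝ E]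
    {q : E → ℝ} (hq : IsQuadForm q) (v : E) : q (-v) = q v := by
  simpa using hq.map_smul (-1) v

open scoped MatrixOrder Matrix.Norms.L2Operator in
theorem le_trace_polarMat {q : EucSp N → ℝ} (hq : IsQuadForm q) (h0 : ∀ v, 0 ≤ q v)
    {e : EucSp N} (he : ‖e‖ = 1) : q e ≤ (polarMat q).trace := by
  obtain ⟨B, hB⟩ := CStarAlgebra.nonneg_iff_eq_star_mul_self.mp (polarMat_posSemidef hq h0).nonneg
  rw [Matrix.star_eq_conjTranspose] at hB
  rw [← polarMat_dotProduct hq, hB]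
  have h1 : ∀ i, (B.mulVec (e : Fin N → ℝ) i) ^ 2 ≤ ∑ j, B i j ^ 2 := by
    intro i
    have h2 := Finset.sum_mul_sq_le_sq_mul_sq Finset.univ (fun j => B i j) (fun j => e j)
    have h3 : ∑ j, e j ^ 2 = 1 := by
      have := EuclideanSpace.real_norm_sq_eq e
      rw [he] at this; linarith
    rw [h3, mul_one] at h2
    exact h2
  have h4 : dotProduct (e : Fin N → ℝ) ((B.conjTranspose * B).mulVec e) =
      ∑ i, (B.mulVec (e : Fin N → ℝ) i) ^ 2 := by
    rw [← Matrix.mulVec_mulVec, Matrix.dotProduct_mulVec, Matrix.vecMul_conjTranspose]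
    simp [dotProduct, sq]
  rw [h4]
  refine (Finset.sum_le_sum fun i _ => h1 i).trans (le_of_eq ?_)
  rw [Finset.sum_comm]
  simp [Matrix.trace, Matrix.mul_apply, sq]

theorem frobNorm_polarMat_le {q : EucSp N → ℝ} {K : ℝ} (hK : ∀ v, |q v| ≤ K * ‖v‖ ^ 2)
    (hK0 : 0 ≤ K) : frobNorm (polarMat q) ≤ 3 * N * K := by
  have hij : ∀ i j, polarMat q i j ^ 2 ≤ (3 * K) ^ 2 := by
    intro i j
    have h1 := hK (EuclideanSpace.single i (1 : ℝ) + EuclideanSpace.single j 1)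
    have h2 := hK (EuclideanSpace.single i (1 : ℝ))
    have h3 := hK (EuclideanSpace.single j (1 : ℝ))
    have h4 : ‖(EuclideanSpace.single i (1 : ℝ) + EuclideanSpace.single j 1 : EucSp N)‖ ^ 2
        ≤ 2 ^ 2 := by
      gcongr
      refine (norm_add_le _ _).trans ?_
      simp; norm_num
    have h5 := h1.trans (mul_le_mul_of_nonneg_left h4 hK0)
    simp only [PiLp.norm_single, norm_one, one_pow, mul_one] at h2 h3
    refine sq_le_sq' ?_ ?_ <;> simp only [polarMat] <;>
      linarith [(abs_le.mp h5).1, (abs_le.mp h5).2, (abs_le.mp h2).1, (abs_le.mp h2).2,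
        (abs_le.mp h3).1, (abs_le.mp h3).2]
  refine Real.sqrt_le_iff.mpr ⟨by positivity, ?_⟩
  calc ∑ i, ∑ j, polarMat q i j ^ 2 ≤ ∑ _i : Fin N, ∑ _j : Fin N, (3 * K) ^ 2 :=
        Finset.sum_le_sum fun i _ => Finset.sum_le_sum fun j _ => hij i j
    _ = (3 * N * K) ^ 2 := by simp; ring

theorem fromBlocks_polarMat_dotProduct {p q : EucSp N → ℝ} (hp : IsQuadForm p)
    (hq : IsQuadForm q) (x : Fin N ⊕ Fin N → ℝ) :
    dotProduct x ((Matrix.fromBlocks (polarMat p) 0 0 (polarMat q)).mulVec x) =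
      p (WithLp.toLp 2 (x ∘ Sum.inl)) + q (WithLp.toLp 2 (x ∘ Sum.inr)) := by
  rw [← polarMat_dotProduct hp, ← polarMat_dotProduct hq, Matrix.fromBlocks_mulVec]
  simp [dotProduct, Fintype.sum_sum_type]

section

variable {α : ℝ} {F : EucSp N → EucSp N → MatN N → ℝ}

/-- Scale invariant form of (H3). -/
theorem H3.scaled (hF1 : H1 univ F α) (hF3 : H3 univ F) :
    ∃ C : ℝ, 0 ≤ C ∧ ∀ X Y : MatN N, X.IsSymm → Y.IsSymm → ∀ ζ : ℝ, 0 < ζ →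
      (Matrix.fromBlocks X 0 0 Y +
        ζ • (1 : Matrix (Fin N ⊕ Fin N) (Fin N ⊕ Fin N) ℝ)).PosSemidef →
      ((4 * ζ) • Matrix.fromBlocks (1 : MatN N) (-1) (-1) (1 : MatN N) -
        Matrix.fromBlocks X 0 0 Y).PosSemidef →
      ∀ x y, x ≠ y →
        F x (ζ • (x - y)) X - F y (ζ • (x - y)) (-Y) ≤ C * (ζ * ‖x - y‖ ^ 2) ^ (α + 1) := by
  obtain ⟨ω, -, -, hω⟩ := hF3
  refine ⟨|ω 1|, abs_nonneg _, fun X Y hX hY ζ hζ h1 h2 x y hxy => ?_⟩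
  have hr : 0 < ‖x - y‖ := norm_pos_iff.mpr (sub_ne_zero.mpr hxy)
  set m := ζ * ‖x - y‖ ^ 2 with hm
  have hm0 : 0 < m := by positivity
  set μ := m⁻¹ with hμ
  have hμ0 : 0 < μ := inv_pos.mpr hm0
  have e1 : Matrix.fromBlocks (μ • X) 0 0 (μ • Y) = μ • Matrix.fromBlocks X 0 0 Y := by
    rw [Matrix.fromBlocks_smul, smul_zero]
  have h3 := hω (μ • X) (μ • Y) (hX.smul μ) (hY.smul μ) (μ * ζ) (by positivity)
    (by rw [e1, mul_smul, ← smul_add]; exact h1.smul hμ0.le)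
    (by rw [e1, show 4 * (μ * ζ) = μ * (4 * ζ) by ring, mul_smul, ← smul_sub]
        exact h2.smul hμ0.le) x (mem_univ _) y (mem_univ _) hxy
  have hp : ζ • (x - y) ≠ 0 := smul_ne_zero hζ.ne' (sub_ne_zero.mpr hxy)
  rw [← smul_neg, mul_smul, hF1 x (mem_univ _) _ hp X hX μ hμ0.ne' μ hμ0.le,
    hF1 y (mem_univ _) _ hp (-Y) hY.neg μ hμ0.ne' μ hμ0.le, mul_assoc μ ζ, ← hm,
    inv_mul_cancel₀ hm0.ne', abs_of_pos hμ0, ← Real.rpow_add_one hμ0.ne', ← mul_sub] at h3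
  have h4 : μ ^ (α + 1) * m ^ (α + 1) = 1 := by
    rw [← Real.mul_rpow hμ0.le hm0.le, inv_mul_cancel₀ hm0.ne', Real.one_rpow]
  have h5 : 0 < m ^ (α + 1) := Real.rpow_pos_of_pos hm0 _
  calc _ = (μ ^ (α + 1) * (F x (ζ • (x - y)) X - F y (ζ • (x - y)) (-Y))) * m ^ (α + 1) := by
        rw [mul_right_comm, h4, one_mul]
    _ ≤ |ω 1| * m ^ (α + 1) := by gcongr; exact h3.trans (le_abs_self _)

theorem H3.quad (hF1 : H1 univ F α) (hF3 : H3 univ F) :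
    ∃ C : ℝ, 0 ≤ C ∧ ∀ Λ : ℝ, 0 < Λ → ∀ p q : EucSp N → ℝ, IsQuadForm p → IsQuadForm q →
      ∀ ζ : ℝ, 0 < ζ → (∀ v, -(Λ * ζ * ‖v‖ ^ 2) ≤ p v) → (∀ v, -(Λ * ζ * ‖v‖ ^ 2) ≤ q v) →
      (∀ v w, p v + q w ≤ 4 * (Λ * ζ) * ‖v - w‖ ^ 2) → ∀ x y, x ≠ y →
        F x (ζ • (x - y)) (polarMat p) - F y (ζ • (x - y)) (-polarMat q) ≤
          C * Λ * (ζ * ‖x - y‖ ^ 2) ^ (α + 1) := by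
  obtain ⟨C, hC, hC3⟩ := H3.scaled hF1 hF3
  refine ⟨C, hC, fun Λ hΛ p q hp hq ζ hζ h1 h2 h3 x y hxy => ?_⟩
  have hnorm : ∀ x : Fin N ⊕ Fin N → ℝ, dotProduct x x =
      ‖(WithLp.toLp 2 (x ∘ Sum.inl) : EucSp N)‖ ^ 2 +
        ‖(WithLp.toLp 2 (x ∘ Sum.inr) : EucSp N)‖ ^ 2 := by
    intro x
    rw [EuclideanSpace.real_norm_sq_eq, EuclideanSpace.real_norm_sq_eq]
    simp [dotProduct, Fintype.sum_sum_type, sq]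
  have hsy : (Matrix.fromBlocks (polarMat p) 0 0 (polarMat q)).IsSymm := by
    rw [Matrix.IsSymm, Matrix.fromBlocks_transpose, polarMat_isSymm p, polarMat_isSymm q]
    simp
  have h4 := hC3 (polarMat p) (polarMat q) (polarMat_isSymm p) (polarMat_isSymm q) (Λ * ζ)
    (by positivity) (by
      refine Matrix.PosSemidef.of_dotProduct_mulVec_nonneg ?_ fun v => ?_
      · exact hsy.add (Matrix.isSymm_one.smul _)
      · rw [star_trivial, Matrix.add_mulVec, dotProduct_add, fromBlocks_polarMat_dotProduct hp hq,
          Matrix.smul_mulVec, Matrix.one_mulVec, dotProduct_smul, hnorm, smul_eq_mul]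
        linarith [h1 (WithLp.toLp 2 (v ∘ Sum.inl)), h2 (WithLp.toLp 2 (v ∘ Sum.inr))]) (by
      refine Matrix.PosSemidef.of_dotProduct_mulVec_nonneg ?_ fun v => ?_
      · refine Matrix.IsSymm.sub (Matrix.IsSymm.smul ?_ _) hsy
        rw [Matrix.IsSymm, Matrix.fromBlocks_transpose]
        simp
      · rw [star_trivial, Matrix.sub_mulVec, dotProduct_sub, fromBlocks_polarMat_dotProduct hp hq,
          Matrix.smul_mulVec, dotProduct_smul, smul_eq_mul]
        have h5 := h3 (WithLp.toLp 2 (v ∘ Sum.inl)) (WithLp.toLp 2 (v ∘ Sum.inr))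
        have h6 : dotProduct v ((Matrix.fromBlocks (1 : MatN N) (-1) (-1) 1).mulVec v) =
            ‖(WithLp.toLp 2 (v ∘ Sum.inl) - WithLp.toLp 2 (v ∘ Sum.inr) : EucSp N)‖ ^ 2 := by
          rw [EuclideanSpace.real_norm_sq_eq, Matrix.fromBlocks_mulVec]
          simp only [Matrix.neg_mulVec, Matrix.one_mulVec, dotProduct, Fintype.sum_sum_type,
            Sum.elim_inl, Sum.elim_inr, Pi.add_apply, Pi.neg_apply, Function.comp_apply,
            PiLp.sub_apply]
          rw [← Finset.sum_add_distrib]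
          refine Finset.sum_congr rfl fun i _ => ?_
          ring
        rw [h6]
        linarith) x y hxy
  have hp0 : ζ • (x - y) ≠ 0 := smul_ne_zero hζ.ne' (sub_ne_zero.mpr hxy)
  have e2 := hF1 x (mem_univ _) _ hp0 (polarMat p) (polarMat_isSymm p) Λ hΛ.ne' 1 zero_le_one
  have e3 := hF1 y (mem_univ _) _ hp0 (-polarMat q) (polarMat_isSymm q).neg Λ hΛ.ne' 1 zero_le_one
  rw [one_smul, mul_one, abs_of_pos hΛ] at e2 e3
  rw [mul_smul, e2, e3, ← mul_sub, mul_assoc Λ ζ, Real.mul_rpow hΛ.le (by positivity),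
    Real.rpow_add_one hΛ.ne'] at h4
  have h7 : 0 < Λ ^ α := Real.rpow_pos_of_pos hΛ _
  refine le_of_mul_le_mul_left ?_ h7
  linarith

end

section

variable {α a A : ℝ} {F : EucSp N → EucSp N → MatN N → ℝ}

theorem IsQuadForm.sum_bound_of_doubled {E : Type*} [NormedAddCommGroup E]
    [InnerProductSpace ℝ E] {q q' : E → ℝ} (hq : IsQuadForm q) (hq' : IsQuadForm q') {K b : ℝ}
    (h1 : ∀ v, -(K * ‖v‖ ^ 2) ≤ q v) (h1' : ∀ v, -(K * ‖v‖ ^ 2) ≤ q' v)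
    (h2 : ∀ v w, q v + q' w ≤ b * ‖v - w‖ ^ 2) (v w : E) :
    (1 / 2 * q v + -1 / 2 * q' v) + q' w ≤ (4 * b + 6 * K) * ‖v - w‖ ^ 2 := by
  obtain ⟨d, rfl⟩ : ∃ d, v = w + d := ⟨v - w, by abel⟩
  have e1 := hq.apply_add_smul 4 w d
  have e2 := h2 (w + (4 : ℝ) • d) w
  have e3 := hq.apply_add_smul (-2) w d
  have e4 := hq'.apply_add_smul (-2) w d
  have e5 := h2 (w + (-2 : ℝ) • d) (w + (-2 : ℝ) • d)
  rw [sub_self, norm_zero] at e5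
  rw [add_sub_cancel_left, norm_smul, Real.norm_eq_abs, show |(4 : ℝ)| = 4 by norm_num] at e2
  rw [add_sub_cancel_left]
  have e6 := h1 d
  have e7 := h1' d
  linarith

theorem H2.shift_le (hF2 : H2 univ F α a A) (x : EucSp N) {p : EucSp N} (hp : p ≠ 0)
    {X : MatN N} (hX : X.IsSymm) {c : ℝ} (hc : 0 ≤ c) :
    F x p (X + c • (1 : MatN N)) - F x p X ≤ A * ‖p‖ ^ α * (c * N) := by
  have := (hF2.2.2 x (mem_univ _) p hp X (c • (1 : MatN N)) hX (Matrix.isSymm_one.smul c)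
    (Matrix.PosSemidef.one.smul hc)).2
  simpa using this

theorem H6.le_quad {C : ℝ} (hF6 : ∀ x : EucSp N, ∀ p : EucSp N, p ≠ 0 → ∀ q : EucSp N,
      ‖q‖ < ‖p‖ / 2 → ∀ X : MatN N, X.IsSymm →
      |F x (p + q) X - F x p X| ≤ C * ‖p‖ ^ (α - 1) * ‖q‖ * frobNorm X) (hC : 0 < C)
    (x : EucSp N) {p p' : EucSp N} (hp : p ≠ 0) {ν : ℝ} (hν : ν ≤ 1 / 4)
    (hp' : ‖p' - p‖ ≤ ν * ‖p‖) {q : EucSp N → ℝ} {K : ℝ} (hK : 0 ≤ K)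
    (hq : ∀ v, |q v| ≤ K * ‖v‖ ^ 2) :
    |F x p' (polarMat q) - F x p (polarMat q)| ≤ ‖p‖ ^ α * (3 * N * C * K * ν) := by
  have hp0 : 0 < ‖p‖ := norm_pos_iff.mpr hp
  have h1 := hF6 x p hp (p' - p) (by nlinarith) (polarMat q) (polarMat_isSymm q)
  rw [add_sub_cancel] at h1
  have h2 : ‖p‖ ^ (α - 1) * ‖p‖ = ‖p‖ ^ α := by
    rw [← Real.rpow_add_one hp0.ne', sub_add_cancel]
  have h3 : 0 < ‖p‖ ^ (α - 1) := Real.rpow_pos_of_pos hp0 _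
  calc _ ≤ C * ‖p‖ ^ (α - 1) * ‖p' - p‖ * frobNorm (polarMat q) := h1
    _ ≤ C * ‖p‖ ^ (α - 1) * (ν * ‖p‖) * (3 * N * K) := by
      gcongr
      · exact Real.sqrt_nonneg _
      · exact mul_nonneg (by positivity) ((norm_nonneg _).trans hp')
      · exact frobNorm_polarMat_le hq hK
    _ = (‖p‖ ^ (α - 1) * ‖p‖) * (3 * N * C * K * ν) := by ring
    _ = _ := by rw [h2]

set_option maxHeartbeats 1000000 in
theorem operator_gap (hF1 : H1 univ F α) (hF2 : H2 univ F α a A) (hF3 : H3 univ F)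
    (hF6 : H6 F α) {K : ℝ} (hK : 4 ≤ K) :
    ∃ C : ℝ, 0 < C ∧ ∀ x y : EucSp N, x ≠ y → ∀ ζ : ℝ, 0 < ζ → ∀ ν : ℝ, 0 ≤ ν → ν ≤ 1 / 4 →
      ∀ pX pY : EucSp N, ‖pX - ζ • (x - y)‖ ≤ ν * ‖ζ • (x - y)‖ →
      ‖pY - ζ • (x - y)‖ ≤ ν * ‖ζ • (x - y)‖ →
      ∀ qX qY : EucSp N → ℝ, IsQuadForm qX → IsQuadForm qY →
      (∀ v, -(K * ζ * ‖v‖ ^ 2) ≤ qX v) → (∀ v, -(K * ζ * ‖v‖ ^ 2) ≤ qY v) →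
      (∀ v w, qX v + qY w ≤ 3 * ζ * ‖v - w‖ ^ 2 + ν * ζ * (‖v‖ ^ 2 + ‖w‖ ^ 2)) →
      ∀ e : EucSp N, ‖e‖ = 1 → ∀ κ : ℝ, 0 ≤ κ → qX e + qY e ≤ -(2 * κ * ζ) →
      F x pX (polarMat qX) - F y pY (-polarMat qY) ≤
        ‖ζ • (x - y)‖ ^ α * ζ * (-(a * κ) + C * ν + C * ‖x - y‖ ^ (α + 2)) := by
  obtain ⟨C6, hC6, hF6⟩ := hF6
  obtain ⟨C3, hC3, hF3⟩ := H3.quad hF1 hF3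
  have hA : 0 < A := hF2.1.trans_le hF2.2.1
  have ha := hF2.1
  refine ⟨C3 * (18 + 6 * K) + 2 * A * N + 6 * N * C6 * K + 1, by positivity, ?_⟩
  intro x y hxy ζ hζ ν hν0 hν pX pY hpX hpY qX qY hqX hqY hX hY hXY e he κ hκ hgap
  set w := x - y with hw
  have hw0 : w ≠ 0 := sub_ne_zero.mpr hxy
  have hr : 0 < ‖w‖ := norm_pos_iff.mpr hw0
  set p := ζ • w with hp
  have hp0 : p ≠ 0 := smul_ne_zero hζ.ne' hw0
  have hpn : ‖p‖ = ζ * ‖w‖ := by rw [hp, norm_smul, Real.norm_of_nonneg hζ.le]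
  have hm : 0 < ‖p‖ := norm_pos_iff.mpr hp0
  have hma : 0 < ‖p‖ ^ α := Real.rpow_pos_of_pos hm _
  have hKζ : 0 ≤ K * ζ := by positivity
  -- pointwise bounds on the quadratic forms
  have bX : ∀ v, |qX v| ≤ K * ζ * ‖v‖ ^ 2 := by
    intro v
    have h1 := hXY v 0
    rw [hqY.map_zero, sub_zero, norm_zero] at h1
    refine abs_le.mpr ⟨hX v, ?_⟩
    nlinarith [mul_nonneg hζ.le (sq_nonneg ‖v‖)]
  have bY : ∀ v, |qY v| ≤ K * ζ * ‖v‖ ^ 2 := by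
    intro v
    have h1 := hXY 0 v
    rw [hqX.map_zero, zero_sub, norm_neg, norm_zero] at h1
    refine abs_le.mpr ⟨hY v, ?_⟩
    nlinarith [mul_nonneg hζ.le (sq_nonneg ‖v‖)]
  -- shifted forms
  set qX1 : EucSp N → ℝ := fun v => qX v + -(ν * ζ) * ‖v‖ ^ 2 with hqX1
  set qY1 : EucSp N → ℝ := fun v => qY v + -(ν * ζ) * ‖v‖ ^ 2 with hqY1
  have iX1 : IsQuadForm qX1 := hqX.add (isQuadForm_norm_sq.const_mul _)
  have iY1 : IsQuadForm qY1 := hqY.add (isQuadForm_norm_sq.const_mul _)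
  have hνζ : 0 ≤ ν * ζ := by positivity
  have lX1 : ∀ v, -((K + 1) * ζ * ‖v‖ ^ 2) ≤ qX1 v := by
    intro v; have := hX v
    simp only [hqX1]; nlinarith [mul_nonneg hζ.le (sq_nonneg ‖v‖)]
  have lY1 : ∀ v, -((K + 1) * ζ * ‖v‖ ^ 2) ≤ qY1 v := by
    intro v; have := hY v
    simp only [hqY1]; nlinarith [mul_nonneg hζ.le (sq_nonneg ‖v‖)]
  have hXY1 : ∀ v w, qX1 v + qY1 w ≤ 3 * ζ * ‖v - w‖ ^ 2 := by
    intro v w; have := hXY v w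
    simp only [hqX1, hqY1]; linarith
  set qM : EucSp N → ℝ := fun v => -1 / 2 * (qX1 v + qY1 v) with hqM
  have iM : IsQuadForm qM := (iX1.add iY1).const_mul _
  have hM0 : ∀ v, 0 ≤ qM v := by
    intro v; have := hXY1 v v
    rw [sub_self, norm_zero] at this
    simp only [hqM]; linarith
  have hMe : κ * ζ ≤ qM e := by
    simp only [hqM, hqX1, hqY1, he]; linarith
  set qX2 : EucSp N → ℝ := fun v => qX1 v + qM v with hqX2
  have iX2 : IsQuadForm qX2 := iX1.add iM
  have eX2 : polarMat qX2 = polarMat qX1 + polarMat qM := polarMat_add _ _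
  have eX : polarMat qX = polarMat qX1 + (ν * ζ) • (1 : MatN N) := by
    rw [hqX1, polarMat_add, polarMat_const_mul, polarMat_norm_sq]; simp
  have eY : -polarMat qY1 = -polarMat qY + (ν * ζ) • (1 : MatN N) := by
    rw [hqY1, polarMat_add, polarMat_const_mul, polarMat_norm_sq, neg_add, neg_smul, neg_neg]
  have eY' : -polarMat qY = polarMat (fun v => -1 * qY v) := by
    rw [polarMat_const_mul]; simp
  have t1 := (abs_le.mp (H6.le_quad hF6 hC6 x hp0 hν hpX hKζ bX)).2
  have t6 := (abs_le.mp (H6.le_quad hF6 hC6 y hp0 hν hpY hKζ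
    (q := fun v => -1 * qY v) fun v => by rw [neg_one_mul, abs_neg]; exact bY v)).1
  rw [← eY'] at t6
  have t2 := H2.shift_le hF2 x hp0 (polarMat_isSymm qX1) hνζ
  rw [← eX] at t2
  have t5 := H2.shift_le hF2 y hp0 (polarMat_isSymm qY).neg hνζ
  rw [← eY] at t5
  have t3 := (hF2.2.2 x (mem_univ _) p hp0 (polarMat qX1) (polarMat qM) (polarMat_isSymm _)
    (polarMat_isSymm _) (polarMat_posSemidef iM hM0)).1
  rw [← eX2] at t3
  have t3' : a * ‖p‖ ^ α * (κ * ζ) ≤ a * ‖p‖ ^ α * (polarMat qM).trace := by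
    gcongr
    exact hMe.trans (le_trace_polarMat iM hM0 he)
  have t4 := hF3 (18 + 6 * K) (by positivity) qX2 qY1 iX2 iY1 ζ hζ
    (by
      intro v
      have h1 := lX1 v
      have h2 := hM0 v
      simp only [hqX2]
      nlinarith [mul_nonneg hKζ (sq_nonneg ‖v‖), mul_nonneg hζ.le (sq_nonneg ‖v‖)])
    (by
      intro v
      have h1 := lY1 v
      nlinarith [mul_nonneg hKζ (sq_nonneg ‖v‖), mul_nonneg hζ.le (sq_nonneg ‖v‖)])
    (by
      intro v w
      have h1 := iX1.sum_bound_of_doubled iY1 lX1 lY1 hXY1 v w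
      simp only [hqX2, hqM]
      nlinarith [mul_nonneg hKζ (sq_nonneg ‖v - w‖), mul_nonneg hζ.le (sq_nonneg ‖v - w‖)])
    x y hxy
  have hpow : (ζ * ‖w‖ ^ 2) ^ (α + 1) = ‖p‖ ^ α * ζ * ‖w‖ ^ (α + 2) := by
    rw [show ζ * ‖w‖ ^ 2 = ‖p‖ * ‖w‖ by rw [hpn]; ring, Real.mul_rpow hm.le hr.le,
      Real.rpow_add_one hm.ne', show α + 2 = (α + 1) + 1 by ring,
      Real.rpow_add_one hr.ne' (α + 1), hpn]
    ring
  rw [hpow] at t4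
  have hR : 0 ≤ ‖p‖ ^ α * ζ * ‖w‖ ^ (α + 2) := by positivity
  have hV : 0 ≤ ‖p‖ ^ α * ζ * ν := by positivity
  have hR2 : 0 ≤ (2 * A * N + 6 * N * C6 * K + 1) * (‖p‖ ^ α * ζ * ‖w‖ ^ (α + 2)) := by
    positivity
  have hV2 : 0 ≤ (C3 * (18 + 6 * K) + 1) * (‖p‖ ^ α * ζ * ν) := by positivity
  linarith

end

theorem eventually_one_add_rpow_le {m c : ℝ} (hc : m * (m - 1) / 2 < c) :
    ∀ᶠ z in nhds (0 : ℝ), (1 + z) ^ m ≤ 1 + m * z + c * z ^ 2 := by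
  set g : ℝ → ℝ := fun z => 1 + m * z + c * z ^ 2 - (1 + z) ^ m with hg
  have hpos : ∀ᶠ z in nhds (0 : ℝ), 0 < 1 + z := by
    filter_upwards [lt_mem_nhds (show (-1 : ℝ) < 0 by norm_num)] with z hz
    linarith
  have hd : ∀ z, 0 < 1 + z → HasDerivAt g (m + 2 * c * z - m * (1 + z) ^ (m - 1)) z := by
    intro z hz
    have h1 : HasDerivAt (fun z : ℝ => 1 + z) 1 z := (hasDerivAt_id z).const_add 1
    have h2 := h1.rpow_const (p := m) (Or.inl hz.ne')
    have h3 := ((((hasDerivAt_id z).const_mul m).const_add 1).add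
      (((hasDerivAt_id z).pow 2).const_mul c)).sub h2
    refine h3.congr_deriv ?_
    simp; ring
  have hde : deriv g =ᶠ[nhds 0] fun z => m + 2 * c * z - m * (1 + z) ^ (m - 1) := by
    filter_upwards [hpos] with z hz using (hd z hz).deriv
  have hdd : deriv (deriv g) 0 = 2 * c - m * (m - 1) := by
    rw [hde.deriv_eq]
    have h1 : HasDerivAt (fun z : ℝ => 1 + z) 1 0 := (hasDerivAt_id (0 : ℝ)).const_add 1
    have h2 := h1.rpow_const (p := m - 1) (Or.inl (by norm_num))
    have h3 := (((hasDerivAt_id (0 : ℝ)).const_mul (2 * c)).const_add m).sub (h2.const_mul m)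
    refine HasDerivAt.deriv (h3.congr_deriv ?_)
    simp
  have hmin := isLocalMin_of_deriv_deriv_pos (f := g) (x₀ := 0) (by rw [hdd]; linarith)
    (by rw [(hd 0 (by norm_num)).deriv]; simp) (hd 0 (by norm_num)).continuousAt
  filter_upwards [hmin] with z hz
  simp only [hg] at hz
  norm_num at hz
  linarith

section

variable {E : Type*} [NormedAddCommGroup E] [InnerProductSpace ℝ E]

theorem norm_add_rpow_eq {e d : E} (he : e ≠ 0) (k : ℝ)
    (h : 0 ≤ 1 + (2 * ⟪e, d⟫ + ‖d‖ ^ 2) / ‖e‖ ^ 2) :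
    ‖e + d‖ ^ k = ‖e‖ ^ k * (1 + (2 * ⟪e, d⟫ + ‖d‖ ^ 2) / ‖e‖ ^ 2) ^ (k / 2) := by
  have hr : 0 < ‖e‖ := norm_pos_iff.mpr he
  have h1 : ‖e + d‖ ^ 2 = ‖e‖ ^ 2 * (1 + (2 * ⟪e, d⟫ + ‖d‖ ^ 2) / ‖e‖ ^ 2) := by
    rw [norm_add_sq_real]; field_simp; ring
  have h2 : ∀ b : ℝ, 0 ≤ b → b ^ k = (b ^ 2) ^ (k / 2) := by
    intro b hb
    rw [← Real.rpow_natCast, ← Real.rpow_mul hb]; congr 1; push_cast; ring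
  rw [h2 _ (norm_nonneg _), h1, Real.mul_rpow (by positivity) h, ← h2 _ hr.le]

theorem eventually_norm_add_rpow_le {e : E} (he : e ≠ 0) {k c : ℝ}
    (hc : k / 2 * (k / 2 - 1) / 2 < c) :
    ∀ᶠ d in nhds (0 : E), ‖e + d‖ ^ k ≤ ‖e‖ ^ k * (1 +
      k / 2 * ((2 * ⟪e, d⟫ + ‖d‖ ^ 2) / ‖e‖ ^ 2) + c * ((2 * ⟪e, d⟫ + ‖d‖ ^ 2) / ‖e‖ ^ 2) ^ 2) := by
  have hr : 0 < ‖e‖ := norm_pos_iff.mpr he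
  have ht : Tendsto (fun d : E => (2 * ⟪e, d⟫ + ‖d‖ ^ 2) / ‖e‖ ^ 2) (nhds 0) (nhds 0) := by
    have : Continuous (fun d : E => (2 * ⟪e, d⟫ + ‖d‖ ^ 2) / ‖e‖ ^ 2) := by fun_prop
    simpa using this.tendsto 0
  filter_upwards [ht.eventually (eventually_one_add_rpow_le hc),
    ht.eventually (lt_mem_nhds (show (-1 : ℝ) < 0 by norm_num))] with d h1 h2
  rw [norm_add_rpow_eq he k (by linarith)]
  gcongr

theorem eventually_norm_add_rpow_le_of_lt_one {e : E} (he : e ≠ 0) {γ : ℝ} (h0 : 0 < γ)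
    (h1 : γ < 1) :
    ∀ᶠ d in nhds (0 : E), ‖e + d‖ ^ γ ≤ ‖e‖ ^ γ + γ * ‖e‖ ^ (γ - 2) * (⟪e, d⟫ +
      1 / 2 * ((1 + (1 - γ) / 4) * ‖d‖ ^ 2 - (1 + (1 - γ) / 2) * (⟪e, d⟫ / ‖e‖) ^ 2)) := by
  have hr : 0 < ‖e‖ := norm_pos_iff.mpr he
  have hsm : ∀ᶠ d in nhds (0 : E), ‖d‖ ≤ (1 - γ) / 16 * ‖e‖ := by
    have : Tendsto (fun d : E => ‖d‖) (nhds 0) (nhds 0) := by simpa using continuous_norm.tendsto (0 : E)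
    exact this.eventually (ge_mem_nhds (by have : 0 < 1 - γ := by linarith
                                           positivity))
  have hlt : γ / 2 * (γ / 2 - 1) / 2 < -(γ / 8 * (1 + 3 * ((1 - γ) / 4))) := by nlinarith
  filter_upwards [eventually_norm_add_rpow_le he hlt, hsm] with d hd hs
  refine hd.trans ?_
  have hpow : ‖e‖ ^ γ = ‖e‖ ^ (γ - 2) * ‖e‖ ^ 2 := by
    rw [← Real.rpow_natCast ‖e‖ 2, ← Real.rpow_add hr]; congr 1; push_cast; ring
  have hp : 0 < ‖e‖ ^ (γ - 2) := Real.rpow_pos_of_pos hr _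
  set s := ⟪e, d⟫ / ‖e‖ with hsdef
  have hse : ⟪e, d⟫ = ‖e‖ * s := by rw [hsdef]; field_simp
  set z := ‖d‖ ^ 2 / ‖e‖ with hz
  have hde : ‖d‖ ^ 2 = ‖e‖ * z := by rw [hz]; field_simp
  have hz0 : 0 ≤ z := by positivity
  have hsd : |s| ≤ ‖d‖ := by
    rw [hsdef, abs_div, abs_norm, div_le_iff₀ hr, mul_comm]
    exact abs_real_inner_le_norm e d
  have hzd : z ≤ (1 - γ) / 16 * ‖d‖ := by
    rw [hz, div_le_iff₀ hr]; nlinarith [norm_nonneg d]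
  have e1 : (2 * ⟪e, d⟫ + ‖d‖ ^ 2) / ‖e‖ ^ 2 = (2 * s + z) / ‖e‖ := by
    rw [hse, hde]; field_simp
  have key : -(γ / 8 * (1 + 3 * ((1 - γ) / 4))) * (2 * s + z) ^ 2 ≤
      γ / 2 * ((1 - γ) / 4 * ‖d‖ ^ 2 - (1 + (1 - γ) / 2) * s ^ 2) := by
    have h2 : |s * z| ≤ (1 - γ) / 16 * ‖d‖ ^ 2 := by
      rw [abs_mul, abs_of_nonneg hz0]
      nlinarith [abs_nonneg s, norm_nonneg d]
    have h3 := (abs_le.mp h2).1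
    have h4 : -(1 / 4 * (1 + 3 * ((1 - γ) / 4)) * (2 * s + z) ^ 2) ≤
        ((1 - γ) / 4 * ‖d‖ ^ 2 - (1 + (1 - γ) / 2) * s ^ 2) := by
      have h5 : 4 * s ^ 2 + 4 * (s * z) ≤ (2 * s + z) ^ 2 := by nlinarith
      have h6 : 0 ≤ 1 - γ := by linarith
      have h7 := mul_nonneg h6 (sq_nonneg ‖d‖)
      have h8 := mul_nonneg h6 (sq_nonneg s)
      have h9 : (1 / 4 * (1 + 3 * ((1 - γ) / 4))) * (4 * s ^ 2 + 4 * (s * z)) ≤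
        (1 / 4 * (1 + 3 * ((1 - γ) / 4))) * (2 * s + z) ^ 2 := by gcongr
      have h10 : -(2 * ((1 - γ) / 16 * ‖d‖ ^ 2)) ≤ (1 + 3 * ((1 - γ) / 4)) * (s * z) := by
        have : (1 + 3 * ((1 - γ) / 4)) ≤ 2 := by linarith
        nlinarith
      linarith
    nlinarith
  rw [e1, hpow, div_pow]
  have e2 : ‖e‖ ^ (γ - 2) * ‖e‖ ^ 2 * (1 + γ / 2 * ((2 * s + z) / ‖e‖) +
      -(γ / 8 * (1 + 3 * ((1 - γ) / 4))) * ((2 * s + z) ^ 2 / ‖e‖ ^ 2)) =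
      ‖e‖ ^ (γ - 2) * (‖e‖ ^ 2 + γ / 2 * (2 * (‖e‖ * s) + ‖e‖ * z) +
      -(γ / 8 * (1 + 3 * ((1 - γ) / 4))) * (2 * s + z) ^ 2) := by
    field_simp
  rw [e2, ← hse, ← hde]
  nlinarith

theorem eventually_norm_add_rpow_le_of_two_lt {e : E} (he : e ≠ 0) {k : ℝ} (hk : 2 < k) :
    ∀ᶠ d in nhds (0 : E), ‖e + d‖ ^ k ≤ ‖e‖ ^ k + k * ‖e‖ ^ (k - 2) * (⟪e, d⟫ +
      1 / 2 * ((1 + 18 * k) * ‖d‖ ^ 2)) := by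
  have hr : 0 < ‖e‖ := norm_pos_iff.mpr he
  have hsm : ∀ᶠ d in nhds (0 : E), ‖d‖ ≤ ‖e‖ := by
    have : Tendsto (fun d : E => ‖d‖) (nhds 0) (nhds 0) := by simpa using continuous_norm.tendsto (0 : E)
    exact this.eventually (ge_mem_nhds hr)
  have hlt : k / 2 * (k / 2 - 1) / 2 < k ^ 2 := by nlinarith
  filter_upwards [eventually_norm_add_rpow_le he hlt, hsm] with d hd hs
  refine hd.trans ?_
  have hpow : ‖e‖ ^ k = ‖e‖ ^ (k - 2) * ‖e‖ ^ 2 := by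
    rw [← Real.rpow_natCast ‖e‖ 2, ← Real.rpow_add hr]; congr 1; push_cast; ring
  have hp : 0 < ‖e‖ ^ (k - 2) := Real.rpow_pos_of_pos hr _
  have hsd := abs_le.mp (abs_real_inner_le_norm e d)
  have h1 : (2 * ⟪e, d⟫ + ‖d‖ ^ 2) ^ 2 ≤ (3 * (‖e‖ * ‖d‖)) ^ 2 := by
    refine sq_le_sq' ?_ ?_ <;> nlinarith [norm_nonneg d]
  rw [hpow]
  have e2 : ‖e‖ ^ (k - 2) * ‖e‖ ^ 2 * (1 + k / 2 * ((2 * ⟪e, d⟫ + ‖d‖ ^ 2) / ‖e‖ ^ 2) +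
      k ^ 2 * ((2 * ⟪e, d⟫ + ‖d‖ ^ 2) / ‖e‖ ^ 2) ^ 2) =
      ‖e‖ ^ (k - 2) * (‖e‖ ^ 2 + k / 2 * (2 * ⟪e, d⟫ + ‖d‖ ^ 2) +
      k ^ 2 * ((2 * ⟪e, d⟫ + ‖d‖ ^ 2) ^ 2 / ‖e‖ ^ 2)) := by
    field_simp
  rw [e2]
  have h2 : (2 * ⟪e, d⟫ + ‖d‖ ^ 2) ^ 2 / ‖e‖ ^ 2 ≤ 9 * ‖d‖ ^ 2 := by
    rw [div_le_iff₀ (by positivity)]; linarith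
  have h3 : k ^ 2 * ((2 * ⟪e, d⟫ + ‖d‖ ^ 2) ^ 2 / ‖e‖ ^ 2) ≤ k ^ 2 * (9 * ‖d‖ ^ 2) := by gcongr
  have h4 : ‖e‖ ^ (k - 2) * (k ^ 2 * ((2 * ⟪e, d⟫ + ‖d‖ ^ 2) ^ 2 / ‖e‖ ^ 2)) ≤
    ‖e‖ ^ (k - 2) * (k ^ 2 * (9 * ‖d‖ ^ 2)) := by gcongr
  linarith

end

section

variable {E : Type*} [NormedAddCommGroup E] [InnerProductSpace ℝ E]

theorem quad_comparison {e d d' : E} (he : ‖e‖ = 1) {τ : ℝ} (h0 : 0 ≤ τ) (h1 : τ ≤ 1 / 4) :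
    (1 + τ) * ‖d‖ ^ 2 - (1 + 2 * τ) * ⟪e, d⟫ ^ 2 ≤
      3 * ‖d'‖ ^ 2 - (3 + τ / 2) * ⟪e, d'⟫ ^ 2 + 5 / 2 * ‖d - d'‖ ^ 2 := by
  obtain ⟨w, rfl⟩ : ∃ w, d = d' + w := ⟨d - d', by abel⟩
  have key : ∀ k : ℝ, 0 ≤ (‖d'‖ ^ 2 + 2 * (k * ⟪d', w⟫) + k ^ 2 * ‖w‖ ^ 2) -
      (⟪e, d'⟫ + k * ⟪e, w⟫) ^ 2 := by
    intro k
    have h := abs_real_inner_le_norm e (d' + k • w)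
    rw [he, one_mul] at h
    have h2 := sq_le_sq' (abs_le.mp h).1 (abs_le.mp h).2
    rw [norm_add_sq_real, inner_add_right, real_inner_smul_right, real_inner_smul_right,
      norm_smul, mul_pow, Real.norm_eq_abs, sq_abs] at h2
    linarith
  have hw := abs_real_inner_le_norm e w
  rw [he, one_mul] at hw
  have hw2 := sq_le_sq' (abs_le.mp hw).1 (abs_le.mp hw).2
  have hd := key 0
  have k1 := key (-5 / 7)
  rw [add_sub_cancel_left, norm_add_sq_real, inner_add_right]
  set s := ⟪e, d'⟫
  set t := ⟪e, w⟫
  set D := ‖d'‖ ^ 2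
  set W := ‖w‖ ^ 2
  set c := ⟪d', w⟫
  have k2 := mul_nonneg (by linarith : 0 ≤ (1 + τ) * (7 / 5)) k1
  have k3 : 0 ≤ (3 - (1 + τ) * (12 / 5)) * (D - s ^ 2) :=
    mul_nonneg (by linarith) (by linarith)
  have k4 : 0 ≤ (5 / 2 - (1 + τ) * (12 / 7)) * (W - t ^ 2) :=
    mul_nonneg (by linarith) (by linarith)
  have k5 := mul_nonneg h0 (sq_nonneg (s + 2 * t))
  have k6 := mul_nonneg (by linarith : 0 ≤ 5 / 2 - τ) (sq_nonneg t)
  linarith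

theorem HasUpperJet.unscale {g : E → ℝ → ℝ} {κ ν : ℝ} (hκ : 0 < κ) (hν : 0 < ν)
    {z P : WithLp 2 (E × ℝ)} {q : WithLp 2 (E × ℝ) → ℝ} (hq : IsQuadForm q)
    (hj : HasUpperJet (fun z : WithLp 2 (E × ℝ) => g z.fst (κ * z.snd)) z P q) :
    ∃ d : ℝ, ∀ᶠ y : E × ℝ in nhds (z.fst, κ * z.snd), g y.1 y.2 ≤ g z.fst (κ * z.snd) +
      ⟪P.fst, y.1 - z.fst⟫ + 1 / 2 * (q (WithLp.toLp 2 (y.1 - z.fst, 0)) +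
      ν * ‖y.1 - z.fst‖ ^ 2) + (P.snd / κ * (y.2 - κ * z.snd) + d * (y.2 - κ * z.snd) ^ 2) := by
  obtain ⟨B, hB, hBq⟩ := hq
  set c := ‖B‖ with hc
  have hc0 : 0 ≤ c := norm_nonneg _
  refine ⟨(1 / 2 * (4 * c ^ 2 / ν + c) + ν / 8) / κ ^ 2, ?_⟩
  have ht : Tendsto (fun y : E × ℝ => (WithLp.toLp 2 (y.1 - z.fst, (y.2 - κ * z.snd) / κ) :
      WithLp 2 (E × ℝ))) (nhds (z.fst, κ * z.snd)) (nhds 0) := by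
    have h1 : Continuous (fun y : E × ℝ => (WithLp.toLp 2 (y.1 - z.fst, (y.2 - κ * z.snd) / κ) :
      WithLp 2 (E × ℝ))) := by fun_prop
    have h2 := h1.tendsto (z.fst, κ * z.snd)
    simp only [sub_self, zero_div] at h2
    exact h2
  filter_upwards [ht.eventually (hj (ν / 8) (by positivity))] with y hy
  set a := y.1 - z.fst with ha
  set τ := (y.2 - κ * z.snd) / κ with hτ
  have hyτ : y.2 - κ * z.snd = κ * τ := by rw [hτ]; field_simp
  have e1 : (z + WithLp.toLp 2 (a, τ)).fst = y.1 := by simp [ha]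
  have e2 : κ * (z + WithLp.toLp 2 (a, τ)).snd = y.2 := by
    simp only [WithLp.add_snd, WithLp.toLp_snd, mul_add]; linarith
  have e3 : ‖(WithLp.toLp 2 (a, τ) : WithLp 2 (E × ℝ))‖ ^ 2 = ‖a‖ ^ 2 + τ ^ 2 := by
    rw [WithLp.prod_norm_sq_eq_of_L2]; simp
  have e4 : ⟪P, (WithLp.toLp 2 (a, τ) : WithLp 2 (E × ℝ))⟫ = ⟪P.fst, a⟫ + P.snd * τ := by
    rw [WithLp.prod_inner_apply]; simp [mul_comm]
  rw [e1, e2, e3, e4] at hy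
  have hsplit : (WithLp.toLp 2 (a, τ) : WithLp 2 (E × ℝ)) =
      WithLp.toLp 2 (a, 0) + WithLp.toLp 2 (0, τ) := by
    rw [← WithLp.toLp_add]; simp
  have n1 : ‖(WithLp.toLp 2 (a, 0) : WithLp 2 (E × ℝ))‖ = ‖a‖ := by simp
  have n2 : ‖(WithLp.toLp 2 (0, τ) : WithLp 2 (E × ℝ))‖ = |τ| := by simp
  have hq1 : q (WithLp.toLp 2 (a, τ)) ≤ q (WithLp.toLp 2 (a, 0)) + 2 * (c * ‖a‖ * |τ|) +
      c * |τ| * |τ| := by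
    rw [hsplit]
    simp only [hBq, map_add, inner_add_left, inner_add_right]
    rw [hB (WithLp.toLp 2 (0, τ)) (WithLp.toLp 2 (a, 0))]
    have f1 := real_inner_le_norm (B (WithLp.toLp 2 (a, 0))) (WithLp.toLp 2 (0, τ))
    have f2 := real_inner_le_norm (B (WithLp.toLp 2 (0, τ))) (WithLp.toLp 2 (0, τ))
    have g1 := B.le_opNorm (WithLp.toLp 2 (a, 0))
    have g2 := B.le_opNorm (WithLp.toLp 2 (0, τ))
    rw [n1] at g1
    rw [n2] at f1 f2 g2
    have g1' := mul_le_mul_of_nonneg_right g1 (abs_nonneg τ)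
    have g2' := mul_le_mul_of_nonneg_right g2 (abs_nonneg τ)
    linarith
  have hq2 : 2 * (c * ‖a‖ * |τ|) ≤ ν / 4 * ‖a‖ ^ 2 + 4 * c ^ 2 / ν * |τ| ^ 2 := by
    have := sq_nonneg (ν * ‖a‖ - 4 * c * |τ|)
    have h3 : ν / 4 * ‖a‖ ^ 2 + 4 * c ^ 2 / ν * |τ| ^ 2 - 2 * (c * ‖a‖ * |τ|) =
      (ν * ‖a‖ - 4 * c * |τ|) ^ 2 / (4 * ν) := by field_simp; ring
    have h4 : 0 ≤ (ν * ‖a‖ - 4 * c * |τ|) ^ 2 / (4 * ν) := by positivity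
    linarith
  have hτ2 : |τ| ^ 2 = τ ^ 2 := sq_abs τ
  rw [hyτ]
  have e5 : P.snd / κ * (κ * τ) = P.snd * τ := by field_simp
  have e6 : (1 / 2 * (4 * c ^ 2 / ν + c) + ν / 8) / κ ^ 2 * (κ * τ) ^ 2 =
      (1 / 2 * (4 * c ^ 2 / ν + c) + ν / 8) * τ ^ 2 := by field_simp
  rw [e5, e6]
  rw [hτ2] at hq2
  have h7 : c * |τ| * |τ| = c * τ ^ 2 := by rw [mul_assoc, ← sq, hτ2]
  rw [h7] at hq1
  have h8 : 0 ≤ ν * ‖a‖ ^ 2 := by positivity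
  linarith

/-- Inequality between the second order parts arising in the doubling of variables. -/
theorem doubled_penalty_le {e : E} (he : ‖e‖ = 1) {τ ζ δ ε K : ℝ} (hτ0 : 0 ≤ τ)
    (hτ1 : τ ≤ 1 / 4) (hζ : 0 < ζ) (hδ0 : 0 ≤ δ) (hδ : 4 * δ ≤ ζ) (hε : 0 < ε) (hK : 0 ≤ K)
    (hKε : K * ε ≤ 1) {κ : ℝ} (hκ : κ ^ 2 = ε * ζ) (a₁ a₂ b₁ b₂ : E) (t₁ t₂ s₁ s₂ : ℝ) :
    ζ * ((1 + τ) * ‖a₁ - a₂‖ ^ 2 - (1 + 2 * τ) * ⟪e, a₁ - a₂⟫ ^ 2) + 2 * δ * ‖a₁‖ ^ 2 +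
      1 / ε * (κ * t₁ - κ * t₂) ^ 2 + 2 * K * (κ * t₁) ^ 2 ≤
    ζ * (3 * ‖b₁ - b₂‖ ^ 2 - (3 + τ / 2) * ⟪e, b₁ - b₂⟫ ^ 2) + 4 * δ * ‖b₁‖ ^ 2 +
      2 * ζ * (s₁ - s₂) ^ 2 + 4 * K * ε * ζ * s₁ ^ 2 +
      16 * ζ * (‖a₁ - b₁‖ ^ 2 + (t₁ - s₁) ^ 2 + (‖a₂ - b₂‖ ^ 2 + (t₂ - s₂) ^ 2)) := by
  have h1 := quad_comparison (d := a₁ - a₂) (d' := b₁ - b₂) he hτ0 hτ1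
  have sq_add_le : ∀ v w : E, ‖v + w‖ ^ 2 ≤ 2 * ‖v‖ ^ 2 + 2 * ‖w‖ ^ 2 := by
    intro v w
    have := parallelogram_law_with_norm ℝ v w
    nlinarith [norm_nonneg (v - w)]
  have h2 : ‖a₁ - a₂ - (b₁ - b₂)‖ ^ 2 ≤ 2 * ‖a₁ - b₁‖ ^ 2 + 2 * ‖a₂ - b₂‖ ^ 2 := by
    have := sq_add_le (a₁ - b₁) (-(a₂ - b₂))
    rw [norm_neg] at this
    convert this using 3
    abel
  have h3 : ‖a₁‖ ^ 2 ≤ 2 * ‖b₁‖ ^ 2 + 2 * ‖a₁ - b₁‖ ^ 2 := by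
    have := sq_add_le b₁ (a₁ - b₁)
    rwa [add_sub_cancel] at this
  have h4 : (t₁ - t₂) ^ 2 ≤ 2 * (s₁ - s₂) ^ 2 + 4 * (t₁ - s₁) ^ 2 + 4 * (t₂ - s₂) ^ 2 := by
    nlinarith [sq_nonneg ((s₁ - s₂) - ((t₁ - s₁) - (t₂ - s₂))),
      sq_nonneg ((t₁ - s₁) + (t₂ - s₂))]
  have h5 : t₁ ^ 2 ≤ 2 * s₁ ^ 2 + 2 * (t₁ - s₁) ^ 2 := by
    nlinarith [sq_nonneg (s₁ - (t₁ - s₁))]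
  have e1 : 1 / ε * (κ * t₁ - κ * t₂) ^ 2 = ζ * (t₁ - t₂) ^ 2 := by
    rw [← mul_sub, mul_pow, hκ]; field_simp
  have e2 : 2 * K * (κ * t₁) ^ 2 = 2 * (K * ε) * ζ * t₁ ^ 2 := by
    rw [mul_pow, hκ]; ring
  rw [e1, e2]
  have m1 := mul_le_mul_of_nonneg_left h1 hζ.le
  have m2 := mul_le_mul_of_nonneg_left h2 hζ.le
  have m3 := mul_le_mul_of_nonneg_left h3 hδ0
  have m4 := mul_le_mul_of_nonneg_left h4 hζ.le
  have hKε0 : 0 ≤ K * ε * ζ := by positivity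
  have m5 := mul_le_mul_of_nonneg_left h5 hKε0
  have m6 := mul_le_mul_of_nonneg_right hδ (sq_nonneg ‖a₁ - b₁‖)
  have m7 := mul_le_mul_of_nonneg_right (mul_le_mul_of_nonneg_right hKε hζ.le)
    (sq_nonneg (t₁ - s₁))
  have n1 := mul_nonneg hζ.le (sq_nonneg ‖a₁ - b₁‖)
  have n2 := mul_nonneg hζ.le (sq_nonneg ‖a₂ - b₂‖)
  have n3 := mul_nonneg hζ.le (sq_nonneg (t₁ - s₁))
  have n4 := mul_nonneg hζ.le (sq_nonneg (t₂ - s₂))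
  linarith

end

section

variable {E : Type*} [NormedAddCommGroup E] [InnerProductSpace ℝ E]
  [FiniteDimensional ℝ E]

theorem isQuadForm_doubled_penalty (e : E) (c₁ c₂ c₃ c₄ c₅ : ℝ) :
    IsQuadForm fun ξ : WithLp 2 (WithLp 2 (E × ℝ) × WithLp 2 (E × ℝ)) =>
      c₁ * (3 * ‖ξ.fst.fst - ξ.snd.fst‖ ^ 2 - c₂ * ⟪e, ξ.fst.fst - ξ.snd.fst⟫ ^ 2) +
        c₃ * ‖ξ.fst.fst‖ ^ 2 + c₄ * (ξ.fst.snd - ξ.snd.snd) ^ 2 + c₅ * ξ.fst.snd ^ 2 := by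
  let H := WithLp 2 (E × ℝ)
  let A : WithLp 2 (H × H) →L[ℝ] H := WithLp.fstL 2 ℝ H H
  let B : WithLp 2 (H × H) →L[ℝ] H := WithLp.sndL 2 ℝ H H
  let X : H →L[ℝ] E := WithLp.fstL 2 ℝ E ℝ
  let S : H →L[ℝ] ℝ := WithLp.sndL 2 ℝ E ℝ
  have h1 := (isQuadForm_norm_sq (E := E)).comp (X.comp A - X.comp B)
  have h2 := isQuadForm_sq ((innerSL ℝ e).comp (X.comp A - X.comp B))
  have h3 := (isQuadForm_norm_sq (E := E)).comp (X.comp A)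
  have h4 := isQuadForm_sq (S.comp A - S.comp B)
  have h5 := isQuadForm_sq (S.comp A)
  have h6 := ((((h1.const_mul 3).add (h2.const_mul (-c₂))).const_mul c₁).add
    (h3.const_mul c₃)).add (h4.const_mul c₄) |>.add (h5.const_mul c₅)
  refine (congrArg IsQuadForm ?_).mp h6
  funext ξ
  have e1 : (X.comp A - X.comp B) ξ = ξ.fst.fst - ξ.snd.fst := rfl
  have e2 : (X.comp A) ξ = ξ.fst.fst := rfl
  have e3 : (S.comp A - S.comp B) ξ = ξ.fst.snd - ξ.snd.snd := rfl
  have e4 : (S.comp A) ξ = ξ.fst.snd := rfl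
  simp only [ContinuousLinearMap.comp_apply (innerSL ℝ e), e1, e2, e3, e4, innerSL_apply_apply]
  ring

end

theorem exists_parabolic_jets {g k : EucSp N → ℝ → ℝ} {x₀ y₀ : EucSp N} {t₀ s₀ : ℝ}
    (hg : ∀ᶠ z in nhds (x₀, t₀), ContinuousAt (fun p : EucSp N × ℝ => g p.1 p.2) z)
    (hk : ∀ᶠ z in nhds (y₀, s₀), ContinuousAt (fun p : EucSp N × ℝ => k p.1 p.2) z)
    {e : EucSp N} (he : ‖e‖ = 1) {τ ζ δ ε K : ℝ} (hτ0 : 0 ≤ τ) (hτ1 : τ ≤ 1 / 4) (hζ : 0 < ζ)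
    (hδ0 : 0 ≤ δ) (hδ : 4 * δ ≤ ζ) (hε : 0 < ε) (hK : 0 ≤ K) (hKε : K * ε ≤ 1)
    {pg pk : EucSp N} {b c : ℝ}
    (hmax : ∀ᶠ z : (EucSp N × ℝ) × (EucSp N × ℝ) in nhds ((x₀, t₀), (y₀, s₀)),
      g z.1.1 z.1.2 + k z.2.1 z.2.2 ≤ g x₀ t₀ + k y₀ s₀ + ⟪pg, z.1.1 - x₀⟫ + ⟪pk, z.2.1 - y₀⟫ +
        b * (z.1.2 - t₀) + c * (z.2.2 - s₀) + 1 / 2 *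
        (ζ * ((1 + τ) * ‖(z.1.1 - x₀) - (z.2.1 - y₀)‖ ^ 2 -
          (1 + 2 * τ) * ⟪e, (z.1.1 - x₀) - (z.2.1 - y₀)⟫ ^ 2) + 2 * δ * ‖z.1.1 - x₀‖ ^ 2 +
          1 / ε * ((z.1.2 - t₀) - (z.2.2 - s₀)) ^ 2 + 2 * K * (z.1.2 - t₀) ^ 2))
    {η : ℝ} (hη : 0 < η) :
    ∃ (x : EucSp N) (t : ℝ) (y : EucSp N) (s : ℝ) (P Q : EucSp N) (b' c' : ℝ)
      (qX qY : EucSp N → ℝ), ‖x - x₀‖ < η ∧ |t - t₀| < η ∧ ‖y - y₀‖ < η ∧ |s - s₀| < η ∧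
      ‖P - pg‖ < η ∧ ‖Q - pk‖ < η ∧ |b' - b| < η ∧ |c' - c| < η ∧ IsQuadForm qX ∧ IsQuadForm qY ∧
      (∀ v, -(16 * ζ * ‖v‖ ^ 2) ≤ qX v) ∧ (∀ v, -(16 * ζ * ‖v‖ ^ 2) ≤ qY v) ∧
      (∀ v w, qX v + qY w ≤ ζ * (3 * ‖v - w‖ ^ 2 - (3 + τ / 2) * ⟪e, v - w⟫ ^ 2) +
        4 * δ * ‖v‖ ^ 2 + η * (‖v‖ ^ 2 + ‖w‖ ^ 2)) ∧
      (∃ d, ∀ᶠ z : EucSp N × ℝ in nhds (x, t), g z.1 z.2 ≤ g x t + ⟪P, z.1 - x⟫ +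
        1 / 2 * qX (z.1 - x) + (b' * (z.2 - t) + d * (z.2 - t) ^ 2)) ∧
      (∃ d, ∀ᶠ z : EucSp N × ℝ in nhds (y, s), k z.1 z.2 ≤ k y s + ⟪Q, z.1 - y⟫ +
        1 / 2 * qY (z.1 - y) + (c' * (z.2 - s) + d * (z.2 - s) ^ 2)) := by
  set κ := Real.sqrt (ε * ζ) with hκd
  have hκ : 0 < κ := Real.sqrt_pos.mpr (by positivity)
  have hκ2 : κ ^ 2 = ε * ζ := Real.sq_sqrt (by positivity)
  let z₀ : WithLp 2 (EucSp N × ℝ) := WithLp.toLp 2 (x₀, t₀ / κ)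
  let w₀ : WithLp 2 (EucSp N × ℝ) := WithLp.toLp 2 (y₀, s₀ / κ)
  let D : WithLp 2 (EucSp N × ℝ) → EucSp N × ℝ := fun z => (z.fst, κ * z.snd)
  have hD : Continuous D := by fun_prop
  have hDz : D z₀ = (x₀, t₀) := by exact Prod.ext rfl (mul_div_cancel₀ t₀ hκ.ne')
  have hDw : D w₀ = (y₀, s₀) := by exact Prod.ext rfl (mul_div_cancel₀ s₀ hκ.ne')
  have hfst : ∀ z : WithLp 2 (EucSp N × ℝ), ‖z.fst‖ ≤ ‖z‖ := fun z => by
    have := WithLp.prod_norm_sq_eq_of_L2 z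
    exact le_of_sq_le_sq (by nlinarith [sq_nonneg ‖z.snd‖]) (norm_nonneg _)
  have hsnd : ∀ z : WithLp 2 (EucSp N × ℝ), |z.snd| ≤ ‖z‖ := fun z => by
    have := WithLp.prod_norm_sq_eq_of_L2 z
    rw [Real.norm_eq_abs] at this
    exact le_of_sq_le_sq (by nlinarith [sq_nonneg ‖z.fst‖]) (norm_nonneg _)
  have e1 : ∀ᶠ ξ : WithLp 2 (EucSp N × ℝ) × WithLp 2 (EucSp N × ℝ) in nhds (z₀, w₀), ContinuousAt (fun p : EucSp N × ℝ => g p.1 p.2) (D ξ.1) :=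
    (hD.comp continuous_fst).continuousAt.eventually (by simpa [hDz] using hg)
  have e2 : ∀ᶠ ξ : WithLp 2 (EucSp N × ℝ) × WithLp 2 (EucSp N × ℝ) in nhds (z₀, w₀), ContinuousAt (fun p : EucSp N × ℝ => k p.1 p.2) (D ξ.2) :=
    (hD.comp continuous_snd).continuousAt.eventually (by simpa [hDw] using hk)
  have hDD : Tendsto (fun ξ : WithLp 2 (EucSp N × ℝ) × WithLp 2 (EucSp N × ℝ) => (D ξ.1, D ξ.2)) (nhds (z₀, w₀))
      (nhds ((x₀, t₀), (y₀, s₀))) := by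
    rw [← hDz, ← hDw]
    exact ((hD.comp continuous_fst).prodMk (hD.comp continuous_snd)).continuousAt
  have e3 := hDD.eventually hmax
  obtain ⟨r, hr, hball⟩ := Metric.nhds_basis_closedBall.eventually_iff.mp (e1.and (e2.and e3))
  have hin : ∀ z w : WithLp 2 (EucSp N × ℝ), ‖z - z₀‖ ≤ r → ‖w - w₀‖ ≤ r → (z, w) ∈ closedBall (z₀, w₀) r := by
    intro z w hz hw
    rw [mem_closedBall, Prod.dist_eq, dist_eq_norm, dist_eq_norm]
    exact max_le hz hw
  have hU : ContinuousOn (fun z : WithLp 2 (EucSp N × ℝ) => g z.fst (κ * z.snd)) (closedBall z₀ r) := by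
    intro z hz
    have h1 := (hball (hin z w₀ (by rwa [← dist_eq_norm]) (by simpa using hr.le))).1
    exact (ContinuousAt.comp (f := D) h1 hD.continuousAt).continuousWithinAt
  have hV : ContinuousOn (fun z : WithLp 2 (EucSp N × ℝ) => k z.fst (κ * z.snd)) (closedBall w₀ r) := by
    intro z hz
    have h1 := (hball (hin z₀ z (by simpa using hr.le) (by rwa [← dist_eq_norm]))).2.1
    exact (ContinuousAt.comp (f := D) h1 hD.continuousAt).continuousWithinAt
  set η' := min (η / 2) (min (κ * η) (η / κ)) with hη'
  have hη'0 : 0 < η' := by positivity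
  have hη1 : η' ≤ η / 2 := min_le_left _ _
  have hη2 : η' ≤ κ * η := (min_le_right _ _).trans (min_le_left _ _)
  have hη3 : η' ≤ η / κ := (min_le_right _ _).trans (min_le_right _ _)
  obtain ⟨z, w, P, Q, qU, qV, hz, hw, hP, hQ, iU, iV, jU, jV, lU, lV, hUV⟩ :=
    exists_doubled_jets (z₀ := z₀) (w₀ := w₀) (P := WithLp.toLp 2 (pg, κ * b))
      (Q := WithLp.toLp 2 (pk, κ * c)) hr (show 0 < 16 * ζ by positivity) hU hV
      (isQuadForm_doubled_penalty e ζ (3 + τ / 2) (4 * δ) (2 * ζ) (4 * K * ε * ζ)) (by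
        intro z w hz hw ξ
        have h1 := (hball (hin z w hz hw)).2.2
        have h2 := doubled_penalty_le he hτ0 hτ1 hζ hδ0 hδ hε hK hKε hκ2 (z - z₀).fst (w - w₀).fst
          ξ.fst.fst ξ.snd.fst (z - z₀).snd (w - w₀).snd ξ.fst.snd ξ.snd.snd
        have n1 : ‖z - z₀ - ξ.fst‖ ^ 2 = ‖(z - z₀).fst - ξ.fst.fst‖ ^ 2 +
            ((z - z₀).snd - ξ.fst.snd) ^ 2 := by
          rw [WithLp.prod_norm_sq_eq_of_L2]; simp
        have n2 : ‖w - w₀ - ξ.snd‖ ^ 2 = ‖(w - w₀).fst - ξ.snd.fst‖ ^ 2 +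
            ((w - w₀).snd - ξ.snd.snd) ^ 2 := by
          rw [WithLp.prod_norm_sq_eq_of_L2]; simp
        have i1 : ⟪(WithLp.toLp 2 (pg, κ * b) : WithLp 2 (EucSp N × ℝ)), z - z₀⟫ = ⟪pg, (z - z₀).fst⟫ +
            b * (κ * (z - z₀).snd) := by
          rw [WithLp.prod_inner_apply]; simp; ring
        have i2 : ⟪(WithLp.toLp 2 (pk, κ * c) : WithLp 2 (EucSp N × ℝ)), w - w₀⟫ = ⟪pk, (w - w₀).fst⟫ +
            c * (κ * (w - w₀).snd) := by
          rw [WithLp.prod_inner_apply]; simp; ring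
        have f1 : κ * z.snd - t₀ = κ * (z - z₀).snd := by
          simp only [z₀, WithLp.sub_snd, WithLp.toLp_snd, mul_sub]; field_simp
        have f2 : κ * w.snd - s₀ = κ * (w - w₀).snd := by
          simp only [w₀, WithLp.sub_snd, WithLp.toLp_snd, mul_sub]; field_simp
        have f3 : z.fst - x₀ = (z - z₀).fst := by simp [z₀]
        have f4 : w.fst - y₀ = (w - w₀).fst := by simp [w₀]
        have g1 : g z₀.fst (κ * z₀.snd) = g x₀ t₀ := by
          have := congrArg (fun p : EucSp N × ℝ => g p.1 p.2) hDz; exact this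
        have g2 : k w₀.fst (κ * w₀.snd) = k y₀ s₀ := by
          have := congrArg (fun p : EucSp N × ℝ => k p.1 p.2) hDw; exact this
        simp only [D] at h1
        rw [f1, f2, f3, f4] at h1
        rw [n1, n2, i1, i2, g1, g2]
        linarith) hη'0
  obtain ⟨dU, hdU⟩ := jU.unscale (g := g) hκ (half_pos hη) iU
  obtain ⟨dV, hdV⟩ := jV.unscale (g := k) hκ (half_pos hη) iV
  let ι : EucSp N →L[ℝ] WithLp 2 (EucSp N × ℝ) :=
    (WithLp.prodContinuousLinearEquiv 2 ℝ (EucSp N) ℝ).symm.toContinuousLinearMap ∘L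
      ContinuousLinearMap.inl ℝ (EucSp N) ℝ
  have hι : ∀ v, ι v = WithLp.toLp 2 (v, 0) := fun v => rfl
  have nι : ∀ v : EucSp N, ‖(WithLp.toLp 2 (v, (0 : ℝ)) : WithLp 2 (EucSp N × ℝ))‖ = ‖v‖ := fun v => by simp
  have htime : ∀ (a a₀ : WithLp 2 (EucSp N × ℝ)) (t : ℝ), κ * a₀.snd = t → ‖a - a₀‖ < η' → |κ * a.snd - t| < η := by
    intro a a₀ t h1 h2
    rw [← h1, ← mul_sub, abs_mul, abs_of_pos hκ]
    have h3 := (hsnd (a - a₀)).trans_lt (h2.trans_le hη3)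
    rw [lt_div_iff₀ hκ] at h3
    simpa [mul_comm] using h3
  have hslope : ∀ (a : WithLp 2 (EucSp N × ℝ)) (p : EucSp N) (t : ℝ), ‖a - WithLp.toLp 2 (p, κ * t)‖ < η' →
      |a.snd / κ - t| < η := by
    intro a p t h2
    have h3 := (hsnd _).trans_lt (h2.trans_le hη2)
    have h4 : a.snd / κ - t = (a.snd - κ * t) / κ := by field_simp
    rw [h4, abs_div, abs_of_pos hκ, div_lt_iff₀ hκ, mul_comm η]
    simpa using h3
  have hlt : η' < η := by linarith
  refine ⟨z.fst, κ * z.snd, w.fst, κ * w.snd, P.fst, Q.fst, P.snd / κ, Q.snd / κ,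
    fun v => qU (WithLp.toLp 2 (v, 0)) + η / 2 * ‖v‖ ^ 2,
    fun v => qV (WithLp.toLp 2 (v, 0)) + η / 2 * ‖v‖ ^ 2,
    (by simpa [z₀] using (hfst (z - z₀)).trans_lt (hz.trans hlt)),
    htime z z₀ t₀ (congrArg Prod.snd hDz) hz,
    (by simpa [w₀] using (hfst (w - w₀)).trans_lt (hw.trans hlt)),
    htime w w₀ s₀ (congrArg Prod.snd hDw) hw,
    (by simpa using (hfst _).trans_lt (hP.trans hlt)),
    (by simpa using (hfst _).trans_lt (hQ.trans hlt)),
    hslope P pg b hP, hslope Q pk c hQ,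
    (iU.comp ι).add (isQuadForm_norm_sq.const_mul _),
    (iV.comp ι).add (isQuadForm_norm_sq.const_mul _), ?_, ?_, ?_, ⟨dU, hdU⟩, ⟨dV, hdV⟩⟩
  · intro v
    have := lU (WithLp.toLp 2 (v, 0))
    rw [nι] at this
    have h2 : 0 ≤ η / 2 * ‖v‖ ^ 2 := by positivity
    linarith
  · intro v
    have := lV (WithLp.toLp 2 (v, 0))
    rw [nι] at this
    have h2 : 0 ≤ η / 2 * ‖v‖ ^ 2 := by positivity
    linarith
  · intro v w
    have := hUV (WithLp.toLp 2 (v, 0)) (WithLp.toLp 2 (w, 0))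
    rw [nι, nι] at this
    simp only [WithLp.toLp_fst, WithLp.toLp_snd, sub_self] at this
    have h2 : η' * (‖v‖ ^ 2 + ‖w‖ ^ 2) ≤ η / 2 * (‖v‖ ^ 2 + ‖w‖ ^ 2) := by gcongr
    linarith

section Gap

variable {T α : ℝ} {F : EucSp N → EucSp N → MatN N → ℝ} {h : EucSp N → ℝ → EucSp N}
  {f u : EucSp N → ℝ → ℝ}

theorem sq_posPart_add_le (a h : ℝ) :
    max (a + h) 0 ^ 2 ≤ max a 0 ^ 2 + 2 * max a 0 * h + h ^ 2 := by
  rcases le_total a 0 with ha | ha <;> rcases le_total (a + h) 0 with hb | hb <;>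
    simp only [max_eq_right, max_eq_left, ha, hb] <;> nlinarith

theorem doubled_increment_le {x₀ y₀ : EucSp N} (hxy : x₀ ≠ y₀) {γ : ℝ} (h0 : 0 < γ) (h1 : γ < 1)
    {L : ℝ} (hL : 0 < L) (δ : ℝ) {ε K : ℝ} (hK : 0 ≤ K) (t₀ s₀ t₁ : ℝ)
    (hmax : ∀ᶠ z : (EucSp N × ℝ) × (EucSp N × ℝ) in nhds ((x₀, t₀), (y₀, s₀)),
      u z.1.1 z.1.2 - u z.2.1 z.2.2 - L * ‖z.1.1 - z.2.1‖ ^ γ - δ * ‖z.1.1‖ ^ 2 -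
        (z.1.2 - z.2.2) ^ 2 / (2 * ε) - K * max (z.1.2 - t₁) 0 ^ 2 ≤
      u x₀ t₀ - u y₀ s₀ - L * ‖x₀ - y₀‖ ^ γ - δ * ‖x₀‖ ^ 2 -
        (t₀ - s₀) ^ 2 / (2 * ε) - K * max (t₀ - t₁) 0 ^ 2) :
    ∀ᶠ z : (EucSp N × ℝ) × (EucSp N × ℝ) in nhds ((x₀, t₀), (y₀, s₀)),
      u z.1.1 z.1.2 + -u z.2.1 z.2.2 ≤ u x₀ t₀ + -u y₀ s₀ +
        ⟪(L * (γ * ‖x₀ - y₀‖ ^ (γ - 2))) • (x₀ - y₀) + (2 * δ) • x₀, z.1.1 - x₀⟫ +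
        ⟪-((L * (γ * ‖x₀ - y₀‖ ^ (γ - 2))) • (x₀ - y₀)), z.2.1 - y₀⟫ +
        ((t₀ - s₀) / ε + 2 * K * max (t₀ - t₁) 0) * (z.1.2 - t₀) +
        (-((t₀ - s₀) / ε)) * (z.2.2 - s₀) + 1 / 2 *
        (L * (γ * ‖x₀ - y₀‖ ^ (γ - 2)) * ((1 + (1 - γ) / 4) * ‖(z.1.1 - x₀) - (z.2.1 - y₀)‖ ^ 2 -
          (1 + 2 * ((1 - γ) / 4)) * ⟪‖x₀ - y₀‖⁻¹ • (x₀ - y₀), (z.1.1 - x₀) - (z.2.1 - y₀)⟫ ^ 2) +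
          2 * δ * ‖z.1.1 - x₀‖ ^ 2 +
          1 / ε * ((z.1.2 - t₀) - (z.2.2 - s₀)) ^ 2 + 2 * K * (z.1.2 - t₀) ^ 2) := by
  have he := sub_ne_zero.mpr hxy
  have hd : Tendsto (fun z : (EucSp N × ℝ) × (EucSp N × ℝ) => (z.1.1 - x₀) - (z.2.1 - y₀))
      (nhds ((x₀, t₀), (y₀, s₀))) (nhds 0) := by
    have : Continuous fun z : (EucSp N × ℝ) × (EucSp N × ℝ) => (z.1.1 - x₀) - (z.2.1 - y₀) := by
      fun_prop
    simpa using this.tendsto ((x₀, t₀), (y₀, s₀))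
  filter_upwards [hmax, hd.eventually (eventually_norm_add_rpow_le_of_lt_one he h0 h1)]
    with z hz hn
  obtain ⟨⟨x, t⟩, y, s⟩ := z
  simp only at hz hn ⊢
  rw [show x₀ - y₀ + (x - x₀ - (y - y₀)) = x - y by abel] at hn
  have hL' := mul_le_mul_of_nonneg_left hn hL.le
  have hx : ‖x‖ ^ 2 = ‖x₀‖ ^ 2 + 2 * ⟪x₀, x - x₀⟫ + ‖x - x₀‖ ^ 2 := by
    rw [← norm_add_sq_real, add_sub_cancel]
  have hk := mul_le_mul_of_nonneg_left (sq_posPart_add_le (t₀ - t₁) (t - t₀)) hK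
  rw [show t₀ - t₁ + (t - t₀) = t - t₁ by ring] at hk
  have ht : (t - s) ^ 2 / (2 * ε) = (t₀ - s₀) ^ 2 / (2 * ε) +
      (t₀ - s₀) / ε * ((t - t₀) - (s - s₀)) + 1 / 2 * (1 / ε * ((t - t₀) - (s - s₀)) ^ 2) := by
    rw [show t - s = (t₀ - s₀) + ((t - t₀) - (s - s₀)) by ring, mul_comm 2 ε, ← div_div]
    by_cases hε : ε = 0
    · simp [hε]
    · field_simp; ring
  simp only [inner_add_left, inner_neg_left, real_inner_smul_left] at hL' ⊢
  rw [div_eq_inv_mul _ ‖x₀ - y₀‖] at hL'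
  rw [inner_sub_right (x₀ - y₀) (x - x₀) (y - y₀)] at hL' ⊢
  rw [hx, ht] at hz
  linarith

theorem gradTerm_abs_le (hα : -1 < α) {x : EucSp N} {t Ch : ℝ} (hb : ‖h x t‖ ≤ Ch) (p : EucSp N) :
    |gradTerm h α x t p| ≤ Ch * ‖p‖ ^ (1 + α) := by
  have h1 := abs_real_inner_le_norm (h x t) p
  unfold gradTerm
  rw [abs_mul, abs_of_nonneg (Real.rpow_nonneg (norm_nonneg p) _)]
  rcases eq_or_ne p 0 with hp | hp
  · simp only [hp, inner_zero_right, abs_zero, zero_mul, norm_zero]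
    rw [Real.zero_rpow (by linarith)]; simp
  · have : 0 < ‖p‖ := norm_pos_iff.mpr hp
    rw [Real.rpow_add this, Real.rpow_one, ← mul_assoc]
    gcongr
    exact h1.trans (by gcongr)

theorem exists_jets_at_doubled_max (hsub : IsSubSol univ T F h α f u)
    (hsup : IsSuperSol univ T F h α f u)
    (hc : ContinuousOn (fun p : EucSp N × ℝ => u p.1 p.2) (univ ×ˢ Ico 0 T))
    {Mf : ℝ} (hfb : ∀ x : EucSp N, ∀ t ∈ Ioo (0 : ℝ) T, |f x t| ≤ Mf)
    {x₀ y₀ : EucSp N} (hxy : x₀ ≠ y₀) {γ : ℝ} (h0 : 0 < γ) (h1 : γ < 1)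
    {L : ℝ} (hL : 0 < L) {δ ε K : ℝ} {ζ : ℝ} (hζ : ζ = L * (γ * ‖x₀ - y₀‖ ^ (γ - 2)))
    (hδ0 : 0 ≤ δ) (hδ : 4 * δ ≤ ζ) (hε : 0 < ε) (hK : 0 ≤ K)
    (hKε : K * ε ≤ 1) {t₀ s₀ t₁ : ℝ} (ht₀ : t₀ ∈ Ioo 0 T) (hs₀ : s₀ ∈ Ioo 0 T)
    (hmax : ∀ᶠ z : (EucSp N × ℝ) × (EucSp N × ℝ) in nhds ((x₀, t₀), (y₀, s₀)),
      u z.1.1 z.1.2 - u z.2.1 z.2.2 - L * ‖z.1.1 - z.2.1‖ ^ γ - δ * ‖z.1.1‖ ^ 2 -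
        (z.1.2 - z.2.2) ^ 2 / (2 * ε) - K * max (z.1.2 - t₁) 0 ^ 2 ≤
      u x₀ t₀ - u y₀ s₀ - L * ‖x₀ - y₀‖ ^ γ - δ * ‖x₀‖ ^ 2 -
        (t₀ - s₀) ^ 2 / (2 * ε) - K * max (t₀ - t₁) 0 ^ 2) {η : ℝ} (hη : 0 < η) :
    ∃ (x : EucSp N) (t : ℝ) (y : EucSp N) (s : ℝ) (P Q : EucSp N) (qX qY : EucSp N → ℝ),
      ‖x - x₀‖ < η ∧ ‖y - y₀‖ < η ∧ t ∈ Ioo 0 T ∧ s ∈ Ioo 0 T ∧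
      ‖P - (ζ • (x₀ - y₀) + (2 * δ) • x₀)‖ < η ∧ ‖Q - ζ • (x₀ - y₀)‖ < η ∧
      IsQuadForm qX ∧ IsQuadForm qY ∧
      (∀ v, -(16 * ζ * ‖v‖ ^ 2) ≤ qX v) ∧ (∀ v, -(16 * ζ * ‖v‖ ^ 2) ≤ qY v) ∧
      (∀ v w, qX v + qY w ≤ ζ * (3 * ‖v - w‖ ^ 2 -
        (3 + (1 - γ) / 4 / 2) * ⟪‖x₀ - y₀‖⁻¹ • (x₀ - y₀), v - w⟫ ^ 2) +
        4 * δ * ‖v‖ ^ 2 + η * (‖v‖ ^ 2 + ‖w‖ ^ 2)) ∧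
      (P ≠ 0 → Q ≠ 0 → -(2 * η) ≤ F x P (polarMat qX) - F y Q (-polarMat qY) +
        |gradTerm h α x t P| + |gradTerm h α y s Q| + 2 * Mf) := by
  have hr : 0 < ‖x₀ - y₀‖ := norm_pos_iff.mpr (sub_ne_zero.mpr hxy)
  have hζ0 : 0 < ζ := by rw [hζ]; positivity
  have he : ‖‖x₀ - y₀‖⁻¹ • (x₀ - y₀)‖ = 1 := by
    rw [norm_smul, norm_inv, norm_norm, inv_mul_cancel₀ hr.ne']
  have hmax' := doubled_increment_le hxy h0 h1 hL δ hK t₀ s₀ t₁ hmax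
  rw [← hζ] at hmax'
  obtain ⟨m, hm0, hm⟩ : ∃ m > 0, ∀ t : ℝ, (|t - t₀| < m → t ∈ Ioo 0 T) ∧
      (|t - s₀| < m → t ∈ Ioo 0 T) := by
    refine ⟨min (min t₀ (T - t₀)) (min s₀ (T - s₀)), ?_, fun t => ⟨fun hh => ?_, fun hh => ?_⟩⟩
    · exact lt_min (lt_min ht₀.1 (by linarith [ht₀.2])) (lt_min hs₀.1 (by linarith [hs₀.2]))
    all_goals
      simp only [lt_min_iff, abs_lt] at hh
      constructor <;> linarith [hh.1.1.1, hh.1.1.2, hh.1.2.1, hh.1.2.2, hh.2.1.1, hh.2.1.2,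
        hh.2.2.1, hh.2.2.2]
  have hη' : 0 < min η m := lt_min hη hm0
  obtain ⟨x, t, y, s, P, Q, b', c', qX, qY, hx, ht, hy, hs, hP, hQ, hb, hc', hqX, hqY, hX, hY, hXY,
    ⟨dX, hjX⟩, dY, hjY⟩ := exists_parabolic_jets (k := fun y s => -u y s)
    ((eventually_snd_mem_Ioo x₀ ht₀).mono fun z hz => continuousAt_of_continuousOn_Ico hc z.1 hz)
    ((eventually_snd_mem_Ioo y₀ hs₀).mono fun z hz =>
      (continuousAt_of_continuousOn_Ico hc z.1 hz).neg)
    he (τ := (1 - γ) / 4) (by linarith) (by linarith) hζ0 hδ0 hδ hε hK hKε hmax' hη'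
  have hl := min_le_left η m
  have hr' := min_le_right η m
  have htT := (hm t).1 (by linarith)
  have hsT := (hm s).2 (by linarith)
  refine ⟨x, t, y, s, P, -Q, qX, qY, by linarith, by linarith, htT, hsT, by linarith, ?_, hqX, hqY,
    hX, hY, fun v w => (hXY v w).trans (by gcongr), fun hP0 hQ0 => ?_⟩
  · rw [← norm_neg, neg_sub, sub_neg_eq_add, add_comm]
    rw [sub_neg_eq_add] at hQ
    linarith
  · have i1 := hsub.jet_le hc htT hP0 hqX hjX
    have i2 := hsup.le_jet hc hsT hQ0 (hqY.const_mul (-1)) (b := -c') (d := -dY) (by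
      filter_upwards [hjY] with z hz
      rw [inner_neg_left]
      linarith)
    rw [polarMat_const_mul, neg_one_smul] at i2
    have f1 := abs_le.mp (hfb x t htT)
    have f2 := abs_le.mp (hfb y s hsT)
    have g1 := abs_le.mp (le_refl |gradTerm h α x t P|)
    have g2 := abs_le.mp (le_refl |gradTerm h α y s (-Q)|)
    have b1 := abs_lt.mp hb
    have b2 := abs_lt.mp hc'
    have : 0 ≤ 2 * K * max (t₀ - t₁) 0 := by positivity
    linarith [f1.1, f1.2, f2.1, f2.2, g1.1, g1.2, g2.1, g2.2, b1.1, b1.2, b2.1, b2.2]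

end Gap

theorem two_rpow_neg_abs_mul_le {r d : ℝ} (hr : 0 < r) (h1 : r / 2 ≤ d) (h2 : d ≤ 2 * r) (α : ℝ) :
    (2 : ℝ) ^ (-|α|) * r ^ α ≤ d ^ α := by
  rcases le_total 0 α with h | h
  · rw [abs_of_nonneg h, Real.rpow_neg (by norm_num), ← div_eq_inv_mul,
      ← Real.div_rpow hr.le (by norm_num)]
    exact Real.rpow_le_rpow (by positivity) h1 h
  · rw [abs_of_nonpos h, neg_neg, ← Real.mul_rpow (by norm_num) hr.le]
    exact Real.rpow_le_rpow_of_nonpos (by linarith) h2 h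

theorem rpow_slope_ge {α L γ r d n : ℝ} (hα : -1 < α) (hL0 : 0 < L) (h0 : 0 < γ) (h1 : γ < 1)
    (hr0 : 0 < r) (hr1 : r ≤ 1) (hd1 : r / 2 ≤ d) (hd2 : d ≤ 2 * r)
    (hn : n = L * (γ * r ^ (γ - 2)) * d) :
    (2 : ℝ) ^ (-|α|) * (L * γ) ^ (1 + α) ≤ n ^ α * (L * (γ * r ^ (γ - 2))) := by
  have hd0 : 0 < d := by linarith
  have hζ0 : 0 < L * (γ * r ^ (γ - 2)) := by positivity
  have e1 : n ^ α * (L * (γ * r ^ (γ - 2))) = (L * (γ * r ^ (γ - 2))) ^ (1 + α) * d ^ α := by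
    rw [hn, Real.mul_rpow hζ0.le hd0.le, add_comm 1 α, Real.rpow_add_one hζ0.ne']; ring
  have e2 : (L * (γ * r ^ (γ - 2))) ^ (1 + α) =
      (L * γ) ^ (1 + α) * r ^ ((γ - 2) * (1 + α)) := by
    rw [← mul_assoc, Real.mul_rpow (by positivity) (by positivity), ← Real.rpow_mul hr0.le]
  have e3 : 1 ≤ r ^ ((γ - 2) * (1 + α)) * r ^ α := by
    rw [← Real.rpow_add hr0]
    exact Real.one_le_rpow_of_pos_of_le_one_of_nonpos hr0 hr1 (by nlinarith)
  have e4 := two_rpow_neg_abs_mul_le hr0 hd1 hd2 α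
  rw [e1, e2]
  calc (2 : ℝ) ^ (-|α|) * (L * γ) ^ (1 + α)
      ≤ (2 : ℝ) ^ (-|α|) * (L * γ) ^ (1 + α) * (r ^ ((γ - 2) * (1 + α)) * r ^ α) :=
        le_mul_of_one_le_right (by positivity) e3
    _ = (L * γ) ^ (1 + α) * r ^ ((γ - 2) * (1 + α)) * ((2 : ℝ) ^ (-|α|) * r ^ α) := by ring
    _ ≤ _ := by gcongr

section Gap

variable {T α a A : ℝ} {F : EucSp N → EucSp N → MatN N → ℝ} {h : EucSp N → ℝ → EucSp N}
  {f u : EucSp N → ℝ → ℝ}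

theorem exists_no_doubled_max (hα : -1 < α) (hF1 : H1 univ F α) (hF2 : H2 univ F α a A)
    (hF3 : H3 univ F) (hF6 : H6 F α)
    {Ch : ℝ} (hCh : ∀ x : EucSp N, ∀ t ∈ Ioo (0 : ℝ) T, ‖h x t‖ ≤ Ch)
    {Mf : ℝ} (hfb : ∀ x : EucSp N, ∀ t ∈ Ioo (0 : ℝ) T, |f x t| ≤ Mf)
    (hsub : IsSubSol univ T F h α f u) (hsup : IsSuperSol univ T F h α f u)
    (hc : ContinuousOn (fun p : EucSp N × ℝ => u p.1 p.2) (univ ×ˢ Ico 0 T))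
    {γ : ℝ} (h0 : 0 < γ) (h1 : γ < 1) :
    ∃ L₀ > 0, ∃ r₀ > 0, ∃ ν > 0, ∀ L, L₀ ≤ L → ∀ x₀ y₀ : EucSp N, x₀ ≠ y₀ → ‖x₀ - y₀‖ ≤ r₀ →
      ∀ δ ε K t₀ s₀ t₁ : ℝ, 0 ≤ δ → δ ≤ ν → 2 * δ * ‖x₀‖ ≤ ν → 0 < ε → 0 ≤ K → K * ε ≤ 1 →
      t₀ ∈ Ioo 0 T → s₀ ∈ Ioo 0 T →
      ¬ ∀ᶠ z : (EucSp N × ℝ) × (EucSp N × ℝ) in nhds ((x₀, t₀), (y₀, s₀)),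
        u z.1.1 z.1.2 - u z.2.1 z.2.2 - L * ‖z.1.1 - z.2.1‖ ^ γ - δ * ‖z.1.1‖ ^ 2 -
          (z.1.2 - z.2.2) ^ 2 / (2 * ε) - K * max (z.1.2 - t₁) 0 ^ 2 ≤
        u x₀ t₀ - u y₀ s₀ - L * ‖x₀ - y₀‖ ^ γ - δ * ‖x₀‖ ^ 2 -
          (t₀ - s₀) ^ 2 / (2 * ε) - K * max (t₀ - t₁) 0 ^ 2 := by
  obtain ⟨C, hC, hgap⟩ := operator_gap hF1 hF2 hF3 hF6 (K := 16) (by norm_num)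
  have ha : 0 < a := hF2.1
  set κ := (1 - γ) / 8 with hκ
  have hκ0 : 0 < κ := by rw [hκ]; linarith
  have haκ : 0 < a * κ := by positivity
  set ν := min ((1 - γ) / 4) (a * κ / (4 * C)) with hν
  have hν0 : 0 < ν := lt_min (by linarith) (by positivity)
  have hν1 : ν ≤ (1 - γ) / 4 := min_le_left _ _
  have hν2 : C * ν ≤ a * κ / 4 := by
    have := min_le_right ((1 - γ) / 4) (a * κ / (4 * C))
    rw [le_div_iff₀ (by positivity)] at this
    linarith
  obtain ⟨r₁, hr₁, hr⟩ : ∃ r₁ > 0, ∀ d : ℝ, 0 ≤ d → d < r₁ →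
      C * d ^ (α + 2) + 2 * (|Ch| * 2 ^ (1 + α)) * d ≤ a * κ / 4 := by
    have hcont : ContinuousAt
        (fun d : ℝ => C * d ^ (α + 2) + 2 * (|Ch| * 2 ^ (1 + α)) * d) 0 := by
      refine ContinuousAt.add (ContinuousAt.mul continuousAt_const ?_) (by fun_prop)
      exact Real.continuousAt_rpow_const _ _ (Or.inr (by linarith))
    have hz : (fun d : ℝ => C * d ^ (α + 2) + 2 * (|Ch| * 2 ^ (1 + α)) * d) 0 < a * κ / 4 := by
      simp only [mul_zero, add_zero]
      rw [Real.zero_rpow (by linarith), mul_zero]; positivity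
    obtain ⟨r₁, hr₁, hh⟩ := Metric.eventually_nhds_iff.mp (hcont.eventually (gt_mem_nhds hz))
    refine ⟨r₁, hr₁, fun d hd hd1 => (hh ?_).le⟩
    rwa [Real.dist_eq, sub_zero, abs_of_nonneg hd]
  obtain ⟨L₁, hL₁⟩ : ∃ L₁, ∀ L ≥ L₁, (2 * Mf + 2) / (2 ^ (-|α|) * (a * κ / 2)) < L ^ (1 + α) := by
    exact eventually_atTop.mp
      ((tendsto_rpow_atTop (show 0 < 1 + α by linarith)).eventually_gt_atTop _)
  refine ⟨max (1 / γ) (L₁ / γ), lt_max_of_lt_left (by positivity), min 1 (r₁ / 3), by positivity,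
    ν / 8, by positivity, ?_⟩
  intro L hL x₀ y₀ hxy hr₀ δ ε K t₀ s₀ t₁ hδ0 hδ hδx hε hK hKε ht₀ hs₀ hmax
  have hLγ : 1 ≤ L * γ := by
    have := (le_max_left _ _).trans hL
    rwa [div_le_iff₀ h0] at this
  have hLγ1 : L₁ ≤ L * γ := by
    have := (le_max_right _ _).trans hL
    rwa [div_le_iff₀ h0] at this
  have hL0 : 0 < L := by
    by_contra hneg
    nlinarith
  set r := ‖x₀ - y₀‖ with hrd
  have hr0 : 0 < r := norm_pos_iff.mpr (sub_ne_zero.mpr hxy)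
  have hr1 : r ≤ 1 := hr₀.trans (min_le_left _ _)
  have hr2 : r ≤ r₁ / 3 := hr₀.trans (min_le_right _ _)
  set ζ := L * (γ * r ^ (γ - 2)) with hζ
  have hζ0 : 0 < ζ := by positivity
  have hζr : 1 ≤ ζ * r := by
    have : r ^ (γ - 2) * r = r ^ (γ - 1) := by
      rw [← Real.rpow_add_one hr0.ne']; congr 1; ring
    have h2 : 1 ≤ r ^ (γ - 1) := Real.one_le_rpow_of_pos_of_le_one_of_nonpos hr0 hr1 (by linarith)
    calc 1 ≤ (L * γ) * r ^ (γ - 1) := by nlinarith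
      _ = ζ * r := by rw [hζ, ← this]; ring
  have hζ1 : 1 ≤ ζ := by nlinarith
  set η := min 1 (min (r / 4) (ν / (4 * (1 + 2 * ζ)))) with hη
  have hη0 : 0 < η := by positivity
  have hη1 : η ≤ 1 := min_le_left _ _
  have hη2 : η ≤ r / 4 := (min_le_right _ _).trans (min_le_left _ _)
  have hη3 : η * (1 + 2 * ζ) ≤ ν / 4 := by
    have := (min_le_right 1 _).trans (min_le_right (r / 4) (ν / (4 * (1 + 2 * ζ))))
    rw [← hη, le_div_iff₀ (by positivity)] at this
    linarith
  have hη4 : η ≤ ν / 4 := by nlinarith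
  obtain ⟨x, t, y, s, P, Q, qX, qY, hx, hy, ht, hs, hP, hQ, hqX, hqY, hX, hY, hXY, hfin⟩ :=
    exists_jets_at_doubled_max hsub hsup hc hfb hxy h0 h1 hL0 hζ hδ0 (by linarith) hε hK hKε ht₀
      hs₀ hmax hη0
  have hd : ‖(x - y) - (x₀ - y₀)‖ ≤ 2 * η := by
    rw [show (x - y) - (x₀ - y₀) = (x - x₀) - (y - y₀) by abel]
    exact (norm_sub_le _ _).trans (by linarith)
  have hd1 : r / 2 ≤ ‖x - y‖ := by
    have := norm_sub_norm_le (x₀ - y₀) (x - y)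
    rw [norm_sub_rev (x₀ - y₀), ← hrd] at this
    linarith
  have hd2 : ‖x - y‖ ≤ 2 * r := by
    have := norm_sub_norm_le (x - y) (x₀ - y₀)
    linarith
  have hd0 : 0 < ‖x - y‖ := by linarith
  have hxy' : x ≠ y := sub_ne_zero.mp (norm_pos_iff.mp hd0)
  set p := ζ • (x - y) with hp
  have hpn : ‖p‖ = ζ * ‖x - y‖ := by rw [hp, norm_smul, Real.norm_of_nonneg hζ0.le]
  have hp1 : 1 / 2 ≤ ‖p‖ := by
    rw [hpn]
    linarith [mul_le_mul_of_nonneg_left hd1 hζ0.le]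
  have hp0 : 0 < ‖p‖ := by linarith
  have hpp : ‖ζ • (x₀ - y₀) - p‖ ≤ 2 * ζ * η := by
    rw [hp, ← smul_sub, norm_smul, Real.norm_of_nonneg hζ0.le, norm_sub_rev]
    linarith [mul_le_mul_of_nonneg_left hd hζ0.le]
  have hνp : ν / 2 ≤ ν * ‖p‖ := by linarith [mul_le_mul_of_nonneg_left hp1 hν0.le]
  have hPp : ‖P - p‖ ≤ ν * ‖p‖ := by
    have e1 : P - p = (P - (ζ • (x₀ - y₀) + (2 * δ) • x₀)) + (ζ • (x₀ - y₀) - p) +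
      (2 * δ) • x₀ := by abel
    have e2 : ‖(2 * δ) • x₀‖ = 2 * δ * ‖x₀‖ := by
      rw [norm_smul, Real.norm_of_nonneg (by positivity)]
    have := norm_add₃_le (a := P - (ζ • (x₀ - y₀) + (2 * δ) • x₀)) (b := ζ • (x₀ - y₀) - p)
      (c := (2 * δ) • x₀)
    rw [e1]
    linarith
  have hQp : ‖Q - p‖ ≤ ν * ‖p‖ := by
    have e1 : Q - p = (Q - ζ • (x₀ - y₀)) + (ζ • (x₀ - y₀) - p) := by abel
    have := norm_add_le (Q - ζ • (x₀ - y₀)) (ζ • (x₀ - y₀) - p)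
    rw [e1]
    linarith
  have hν4 : ν ≤ 1 / 4 := by linarith
  have hsize : ∀ R : EucSp N, ‖R - p‖ ≤ ν * ‖p‖ → R ≠ 0 ∧ ‖R‖ ≤ 2 * ‖p‖ := by
    intro R hR
    have i1 := norm_sub_norm_le R p
    have i2 := norm_sub_norm_le p R
    rw [norm_sub_rev] at i2
    have i3 := mul_le_mul_of_nonneg_right hν4 hp0.le
    exact ⟨norm_pos_iff.mp (by linarith), by linarith⟩
  have he : ‖r⁻¹ • (x₀ - y₀)‖ = 1 := by
    rw [norm_smul, norm_inv, Real.norm_of_nonneg hr0.le, inv_mul_cancel₀ hr0.ne']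
  have hνζ : ν ≤ ν * ζ := le_mul_of_one_le_right hν0.le hζ1
  have hg := hgap x y hxy' ζ hζ0 ν hν0.le hν4 P Q hPp hQp qX qY hqX hqY hX hY (fun v w => by
      refine (hXY v w).trans ?_
      have i1 : 0 ≤ ζ * ((3 + (1 - γ) / 4 / 2) * ⟪r⁻¹ • (x₀ - y₀), v - w⟫ ^ 2) := by
        have : 0 < 3 + (1 - γ) / 4 / 2 := by linarith
        positivity
      have i2 := mul_le_mul_of_nonneg_right (show 4 * δ + η ≤ ν * ζ by linarith) (sq_nonneg ‖v‖)
      have i3 := mul_le_mul_of_nonneg_right (show η ≤ ν * ζ by linarith) (sq_nonneg ‖w‖)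
      linarith) _ he κ hκ0.le (by
      have := hXY (r⁻¹ • (x₀ - y₀)) (-(r⁻¹ • (x₀ - y₀)))
      rw [hqY.map_neg, sub_neg_eq_add, norm_neg, ← two_smul ℝ (r⁻¹ • (x₀ - y₀)),
        real_inner_smul_right, real_inner_self_eq_norm_sq, norm_smul, he] at this
      norm_num at this
      have i2 : 4 * δ + 2 * η ≤ (1 - γ) / 4 * ζ := by
        linarith [mul_le_mul_of_nonneg_right hν1 hζ0.le]
      rw [hκ]
      linarith)
  have hfin' := hfin (hsize P hPp).1 (hsize Q hQp).1
  have hpow : ‖p‖ ^ (1 + α) = ‖p‖ ^ α * ζ * ‖x - y‖ := by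
    rw [add_comm, Real.rpow_add_one hp0.ne', hpn]; ring
  have hgt : ∀ (z : EucSp N) (τ : ℝ) (R : EucSp N), τ ∈ Ioo 0 T → ‖R‖ ≤ 2 * ‖p‖ →
      |gradTerm h α z τ R| ≤ |Ch| * 2 ^ (1 + α) * (‖p‖ ^ α * ζ * ‖x - y‖) := by
    intro z τ R hτ hR
    refine (gradTerm_abs_le hα ((hCh z τ hτ).trans (le_abs_self Ch)) R).trans ?_
    rw [← hpow, mul_assoc, ← Real.mul_rpow (by norm_num) hp0.le]
    gcongr
    linarith
  have hg1 := hgt x t P ht (hsize P hPp).2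
  have hg2 := hgt y s Q hs (hsize Q hQp).2
  have hrr := hr ‖x - y‖ hd0.le (by linarith)
  have hbig : (2 : ℝ) ^ (-|α|) * (L * γ) ^ (1 + α) ≤ ‖p‖ ^ α * ζ :=
    rpow_slope_ge hα hL0 h0 h1 hr0 hr1 hd1 hd2 hpn
  have hlast := hL₁ (L * γ) hLγ1
  rw [div_lt_iff₀ (by positivity)] at hlast
  have hX0 : 0 < ‖p‖ ^ α * ζ := by positivity
  have k1 := mul_le_mul_of_nonneg_left hrr hX0.le
  have k2 := mul_le_mul_of_nonneg_left hν2 hX0.le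
  have k3 := mul_le_mul_of_nonneg_right hbig haκ.le
  linarith

end Gap

theorem exists_time_modulus {u : EucSp N → ℝ → ℝ} {T R S : ℝ} (hS : S < T)
    (hc : ContinuousOn (fun p : EucSp N × ℝ => u p.1 p.2) (univ ×ˢ Ico 0 T)) {θ : ℝ} (hθ : 0 < θ) :
    ∃ ρ > 0, ∀ x : EucSp N, ‖x‖ ≤ R → ∀ t ∈ Icc 0 S, ∀ s ∈ Icc 0 S, |t - s| < ρ →
      |u x t - u x s| < θ := by
  have hK : IsCompact (closedBall (0 : EucSp N) R ×ˢ Icc (0 : ℝ) S) :=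
    (isCompact_closedBall 0 R).prod isCompact_Icc
  have hu := hK.uniformContinuousOn_of_continuous
    (hc.mono (prod_mono (subset_univ _) fun t ht => ⟨ht.1, ht.2.trans_lt hS⟩))
  obtain ⟨ρ, hρ, hh⟩ := Metric.uniformContinuousOn_iff.mp hu θ hθ
  refine ⟨ρ, hρ, fun x hx t ht s hs hts => ?_⟩
  have := hh (x, t) ⟨by simpa using hx, ht⟩ (x, s) ⟨by simpa using hx, hs⟩ (by
    rw [Prod.dist_eq]; simpa [Real.dist_eq] using hts)
  simpa [Real.dist_eq] using this

set_option maxHeartbeats 1000000 in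
theorem exists_doubled_max {u : EucSp N → ℝ → ℝ} {T M c γ : ℝ} (h0 : 0 < γ)
    (hc : ContinuousOn (fun p : EucSp N × ℝ => u p.1 p.2) (univ ×ˢ Ico 0 T)) (hM0 : 0 ≤ M)
    (hM : ∀ x : EucSp N, ∀ t ∈ Ico (0 : ℝ) T, |u x t| ≤ M)
    (hinit : ∀ x y : EucSp N, u x 0 - u y 0 ≤ c * ‖x - y‖ ^ γ)
    {L r₀ ν : ℝ} (hr₀ : 0 < r₀) (hν : 0 < ν) (hL0 : 0 < L) (hLc : c ≤ L)
    (hLr : 2 * M + 1 ≤ L * r₀ ^ γ)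
    {t₁ : ℝ} (ht₁ : t₁ ∈ Ioo 0 T) {x₁ y₁ : EucSp N}
    (hgt : L * ‖x₁ - y₁‖ ^ γ < u x₁ t₁ - u y₁ t₁) :
    ∃ x₀ y₀ : EucSp N, x₀ ≠ y₀ ∧ ‖x₀ - y₀‖ ≤ r₀ ∧
      ∃ δ ε K t₀ s₀ : ℝ, 0 ≤ δ ∧ δ ≤ ν ∧ 2 * δ * ‖x₀‖ ≤ ν ∧ 0 < ε ∧ 0 ≤ K ∧ K * ε ≤ 1 ∧
      t₀ ∈ Ioo 0 T ∧ s₀ ∈ Ioo 0 T ∧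
      ∀ᶠ z : (EucSp N × ℝ) × (EucSp N × ℝ) in nhds ((x₀, t₀), (y₀, s₀)),
        u z.1.1 z.1.2 - u z.2.1 z.2.2 - L * ‖z.1.1 - z.2.1‖ ^ γ - δ * ‖z.1.1‖ ^ 2 -
          (z.1.2 - z.2.2) ^ 2 / (2 * ε) - K * max (z.1.2 - t₁) 0 ^ 2 ≤
        u x₀ t₀ - u y₀ s₀ - L * ‖x₀ - y₀‖ ^ γ - δ * ‖x₀‖ ^ 2 -
          (t₀ - s₀) ^ 2 / (2 * ε) - K * max (t₀ - t₁) 0 ^ 2 := by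
  obtain ⟨θ, hθd⟩ : ∃ θ, θ = u x₁ t₁ - u y₁ t₁ - L * ‖x₁ - y₁‖ ^ γ := ⟨_, rfl⟩
  have hθ : 0 < θ := by linarith
  obtain ⟨T₂, hT₂, hT₂'⟩ := exists_between ht₁.2
  obtain ⟨T₃, hT₃, hT₃'⟩ := exists_between hT₂'
  have ht₁0 := ht₁.1
  set K := (2 * M + 1) / (T₂ - t₁) ^ 2 with hKd
  have hT21 : 0 < T₂ - t₁ := by linarith
  have hK0 : 0 < K := by positivity
  have hKT : K * (T₂ - t₁) ^ 2 = 2 * M + 1 := by rw [hKd]; field_simp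
  obtain ⟨δ, hδ0, hδν, hδx, hδν2⟩ : ∃ δ > 0, δ ≤ ν ∧ δ * ‖x₁‖ ^ 2 ≤ θ / 2 ∧
      8 * M * δ ≤ ν ^ 2 := by
    refine ⟨min ν (min (θ / (2 * (‖x₁‖ ^ 2 + 1))) (ν ^ 2 / (8 * M + 1))), by positivity,
      min_le_left _ _, ?_, ?_⟩
    · have := (min_le_right ν _).trans (min_le_left (θ / (2 * (‖x₁‖ ^ 2 + 1)))
        (ν ^ 2 / (8 * M + 1)))
      refine (mul_le_mul_of_nonneg_right this (sq_nonneg _)).trans ?_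
      rw [div_mul_eq_mul_div, div_le_div_iff₀ (by positivity) (by positivity)]
      nlinarith
    · have := (min_le_right ν _).trans (min_le_right (θ / (2 * (‖x₁‖ ^ 2 + 1)))
        (ν ^ 2 / (8 * M + 1)))
      rw [le_div_iff₀ (by positivity)] at this
      have h2 : 0 ≤ min ν (min (θ / (2 * (‖x₁‖ ^ 2 + 1))) (ν ^ 2 / (8 * M + 1))) := by positivity
      linarith
  set R := 2 * M / δ + 1 with hR
  have hR1 : 1 ≤ R := by rw [hR]; linarith [show 0 ≤ 2 * M / δ by positivity]
  have hRδ : 2 * M < δ * R := by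
    have : δ * R = 2 * M + δ := by rw [hR]; field_simp
    linarith
  obtain ⟨ρ, hρ, hmod⟩ := exists_time_modulus (R := R + r₀) hT₃' hc (show 0 < θ / 4 by linarith)
  obtain ⟨ε, hε, hKε, hερ⟩ : ∃ ε > 0, K * ε ≤ 1 ∧ 4 * M * ε < min ρ (T₃ - T₂) ^ 2 := by
    have hm : 0 < min ρ (T₃ - T₂) := lt_min hρ (by linarith)
    refine ⟨min (1 / K) (min ρ (T₃ - T₂) ^ 2 / (4 * M + 1)), by positivity, ?_, ?_⟩
    · have := min_le_left (1 / K) (min ρ (T₃ - T₂) ^ 2 / (4 * M + 1))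
      rwa [le_div_iff₀ hK0, mul_comm] at this
    · have h2 := min_le_right (1 / K) (min ρ (T₃ - T₂) ^ 2 / (4 * M + 1))
      rw [le_div_iff₀ (by positivity)] at h2
      have h3 : 0 < min (1 / K) (min ρ (T₃ - T₂) ^ 2 / (4 * M + 1)) := by positivity
      linarith
  set D := (closedBall (0 : EucSp N) (R + r₀ + 1) ×ˢ Icc (0 : ℝ) T₃) ×ˢ
    (closedBall (0 : EucSp N) (R + r₀ + 1) ×ˢ Icc (0 : ℝ) T₃) with hD
  have hDc : IsCompact D := ((isCompact_closedBall _ _).prod isCompact_Icc).prod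
    ((isCompact_closedBall _ _).prod isCompact_Icc)
  set Φ : (EucSp N × ℝ) × (EucSp N × ℝ) → ℝ := fun z =>
    u z.1.1 z.1.2 - u z.2.1 z.2.2 - L * ‖z.1.1 - z.2.1‖ ^ γ - δ * ‖z.1.1‖ ^ 2 -
          (z.1.2 - z.2.2) ^ 2 / (2 * ε) - K * max (z.1.2 - t₁) 0 ^ 2 with hΦ
  have hΦc : ContinuousOn Φ D := by
    have hu1 : ContinuousOn (fun z : (EucSp N × ℝ) × (EucSp N × ℝ) => u z.1.1 z.1.2) D :=
      hc.comp (f := fun z : (EucSp N × ℝ) × (EucSp N × ℝ) => z.1) continuous_fst.continuousOn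
        fun z hz => ⟨mem_univ _, hz.1.2.1, hz.1.2.2.trans_lt hT₃'⟩
    have hu2 : ContinuousOn (fun z : (EucSp N × ℝ) × (EucSp N × ℝ) => u z.2.1 z.2.2) D :=
      hc.comp (f := fun z : (EucSp N × ℝ) × (EucSp N × ℝ) => z.2) continuous_snd.continuousOn
        fun z hz => ⟨mem_univ _, hz.2.2.1, hz.2.2.2.trans_lt hT₃'⟩
    have hn : Continuous fun z : (EucSp N × ℝ) × (EucSp N × ℝ) => ‖z.1.1 - z.2.1‖ ^ γ :=
      (by fun_prop : Continuous fun z : (EucSp N × ℝ) × (EucSp N × ℝ) =>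
        ‖z.1.1 - z.2.1‖).rpow_const fun _ => Or.inr h0.le
    exact ((((hu1.sub hu2).sub (continuous_const.mul hn).continuousOn).sub (by fun_prop)).sub
      (by fun_prop)).sub (by fun_prop)
  have hval : θ / 2 ≤ Φ ((x₁, t₁), (y₁, t₁)) := by
    simp only [hΦ, sub_self, max_self]
    norm_num
    linarith
  have hb : ∀ x t, t ∈ Icc 0 T₃ → u x t ≤ M ∧ -M ≤ u x t := fun x t ht =>
    ⟨(abs_le.mp (hM x t ⟨ht.1, ht.2.trans_lt hT₃'⟩)).2,
      (abs_le.mp (hM x t ⟨ht.1, ht.2.trans_lt hT₃'⟩)).1⟩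
  have hpos : ∀ x t y s, t ∈ Icc 0 T₃ → s ∈ Icc 0 T₃ → 0 ≤ Φ ((x, t), (y, s)) →
      δ * ‖x‖ ^ 2 ≤ 2 * M ∧ ‖x‖ ≤ R ∧ ‖x - y‖ ≤ r₀ ∧ |t - s| < min ρ (T₃ - T₂) ∧ t < T₂ := by
    intro x t y s ht hs hp
    simp only [hΦ] at hp
    have b1 := (hb x t ht).1
    have b2 := (hb y s hs).2
    have n1 : 0 ≤ L * ‖x - y‖ ^ γ := by positivity
    have n2 : 0 ≤ δ * ‖x‖ ^ 2 := by positivity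
    have n3 : 0 ≤ (t - s) ^ 2 / (2 * ε) := by positivity
    have n4 : 0 ≤ K * max (t - t₁) 0 ^ 2 := by positivity
    refine ⟨by linarith, ?_, ?_, ?_, ?_⟩
    · by_contra hh
      push Not at hh
      have h3 : R ≤ ‖x‖ ^ 2 := hh.le.trans (le_self_pow₀ (hR1.trans hh.le) two_ne_zero)
      linarith [mul_le_mul_of_nonneg_left h3 hδ0.le]
    · by_contra hh
      push Not at hh
      have h3 : r₀ ^ γ ≤ ‖x - y‖ ^ γ := Real.rpow_le_rpow hr₀.le hh.le h0.le
      linarith [mul_le_mul_of_nonneg_left h3 hL0.le]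
    · have hm : 0 < min ρ (T₃ - T₂) := lt_min hρ (by linarith)
      have h3 : (t - s) ^ 2 / (2 * ε) ≤ 2 * M := by linarith
      rw [div_le_iff₀ (by positivity)] at h3
      exact abs_lt_of_sq_lt_sq (by linarith) hm.le
    · by_contra hh
      push Not at hh
      have : T₂ - t₁ ≤ max (t - t₁) 0 := (by linarith : T₂ - t₁ ≤ t - t₁).trans (le_max_left _ _)
      have := mul_le_mul_of_nonneg_left (pow_le_pow_left₀ hT21.le this 2) hK0.le
      linarith
  have hyR : ∀ x y : EucSp N, ‖x‖ ≤ R → ‖x - y‖ ≤ r₀ → ‖y‖ ≤ R + r₀ := fun x y h1 h2 => by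
    have := norm_sub_norm_le y x
    rw [norm_sub_rev] at this
    linarith
  have ht₁3 : t₁ ∈ Icc 0 T₃ := ⟨ht₁0.le, by linarith⟩
  obtain ⟨-, hx₁R, hxy₁, -, -⟩ := hpos x₁ t₁ y₁ t₁ ht₁3 ht₁3 (by linarith)
  have hmem : ((x₁, t₁), (y₁, t₁)) ∈ D := by
    refine ⟨⟨?_, ht₁3⟩, ?_, ht₁3⟩
    · rw [mem_closedBall_zero_iff]; linarith
    · rw [mem_closedBall_zero_iff]; linarith [hyR _ _ hx₁R hxy₁]
  obtain ⟨⟨⟨x₀, t₀⟩, y₀, s₀⟩, hzD, hzmax⟩ := hDc.exists_isMaxOn ⟨_, hmem⟩ hΦc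
  have hzval : θ / 2 ≤ Φ ((x₀, t₀), (y₀, s₀)) := hval.trans (hzmax hmem)
  have ht₀ : t₀ ∈ Icc 0 T₃ := hzD.1.2
  have hs₀ : s₀ ∈ Icc 0 T₃ := hzD.2.2
  obtain ⟨hδx₀, hx₀R, hxy₀, hts, ht₀2⟩ := hpos x₀ t₀ y₀ s₀ ht₀ hs₀ (by linarith)
  have hy₀R := hyR _ _ hx₀R hxy₀
  have hts1 := hts.trans_le (min_le_left _ _)
  have hts2 := abs_lt.mp (hts.trans_le (min_le_right _ _))
  have hval' : θ / 2 ≤ u x₀ t₀ - u y₀ s₀ - L * ‖x₀ - y₀‖ ^ γ := by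
    simp only [hΦ] at hzval
    have n2 : 0 ≤ δ * ‖x₀‖ ^ 2 := by positivity
    have n3 : 0 ≤ (t₀ - s₀) ^ 2 / (2 * ε) := by positivity
    have n4 : 0 ≤ K * max (t₀ - t₁) 0 ^ 2 := by positivity
    linarith
  have hinit' : u x₀ 0 - u y₀ 0 ≤ L * ‖x₀ - y₀‖ ^ γ :=
    (hinit x₀ y₀).trans (by gcongr)
  have ht₀0 : 0 < t₀ := by
    refine lt_of_le_of_ne ht₀.1 fun hz => ?_
    have := abs_lt.mp (hmod y₀ hy₀R t₀ ht₀ s₀ hs₀ hts1)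
    rw [← hz] at this hval'
    linarith [this.1, this.2]
  have hs₀0 : 0 < s₀ := by
    refine lt_of_le_of_ne hs₀.1 fun hz => ?_
    have := abs_lt.mp (hmod x₀ (by linarith) t₀ ht₀ s₀ hs₀ hts1)
    rw [← hz] at this hval'
    linarith [this.1, this.2]
  refine ⟨x₀, y₀, ?_, hxy₀, δ, ε, K, t₀, s₀, hδ0.le, hδν, ?_, hε, hK0.le, hKε,
    ⟨ht₀0, by linarith⟩, ⟨hs₀0, by linarith⟩, ?_⟩
  · rintro rfl
    have := abs_lt.mp (hmod x₀ hy₀R t₀ ht₀ s₀ hs₀ hts1)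
    have n1 : 0 ≤ L * ‖x₀ - x₀‖ ^ γ := by positivity
    linarith [this.1, this.2]
  · refine abs_le_of_sq_le_sq' ?_ hν.le |>.2
    have h3 := mul_le_mul_of_nonneg_left hδx₀ hδ0.le
    linarith
  · have hnb : D ∈ nhds ((x₀, t₀), (y₀, s₀)) := by
      refine prod_mem_nhds (prod_mem_nhds ?_ ?_) (prod_mem_nhds ?_ ?_)
      · exact closedBall_mem_nhds_of_mem (by rw [mem_ball_zero_iff]; linarith)
      · exact Icc_mem_nhds ht₀0 (by linarith)
      · exact closedBall_mem_nhds_of_mem (by rw [mem_ball_zero_iff]; linarith)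
      · exact Icc_mem_nhds hs₀0 (by linarith)
    filter_upwards [hnb] with z hz
    exact hzmax hz

section

variable {T α a A : ℝ} {F : EucSp N → EucSp N → MatN N → ℝ} {h : EucSp N → ℝ → EucSp N}
  {f u : EucSp N → ℝ → ℝ}

theorem exists_spatial_holder (hα : -1 < α) (hF1 : H1 univ F α) (hF2 : H2 univ F α a A)
    (hF3 : H3 univ F) (hF6 : H6 F α)
    {Ch : ℝ} (hCh : ∀ x : EucSp N, ∀ t ∈ Ioo (0 : ℝ) T, ‖h x t‖ ≤ Ch)
    {Mf : ℝ} (hfb : ∀ x : EucSp N, ∀ t ∈ Ioo (0 : ℝ) T, |f x t| ≤ Mf)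
    (hsub : IsSubSol univ T F h α f u) (hsup : IsSuperSol univ T F h α f u)
    (hc : ContinuousOn (fun p : EucSp N × ℝ => u p.1 p.2) (univ ×ˢ Ico 0 T))
    {γ : ℝ} (h0 : 0 < γ) (h1 : γ < 1) {M c : ℝ} (hM0 : 0 ≤ M)
    (hM : ∀ x : EucSp N, ∀ t ∈ Ico (0 : ℝ) T, |u x t| ≤ M)
    (hinit : ∀ x y : EucSp N, u x 0 - u y 0 ≤ c * ‖x - y‖ ^ γ) :
    ∃ L > 0, ∀ t ∈ Ioo 0 T, ∀ x y, u x t - u y t ≤ L * ‖x - y‖ ^ γ := by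
  obtain ⟨L₀, hL₀, r₀, hr₀, ν, hν, hno⟩ :=
    exists_no_doubled_max hα hF1 hF2 hF3 hF6 hCh hfb hsub hsup hc h0 h1
  refine ⟨max L₀ (max c ((2 * M + 1) / r₀ ^ γ)), lt_max_of_lt_left hL₀, fun t₁ ht₁ x₁ y₁ => ?_⟩
  by_contra hgt
  push Not at hgt
  have hLr := (le_max_right c _).trans (le_max_right L₀ (max c ((2 * M + 1) / r₀ ^ γ)))
  rw [div_le_iff₀ (by positivity)] at hLr
  obtain ⟨x₀, y₀, hxy, hr, δ, ε, K, t₀, s₀, q1, q2, q3, q4, q5, q6, q7, q8, hmax⟩ :=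
    exists_doubled_max h0 hc hM0 hM hinit hr₀ hν (lt_max_of_lt_left hL₀)
      ((le_max_left c _).trans (le_max_right _ _)) hLr ht₁ hgt
  exact hno _ (le_max_left _ _) x₀ y₀ hxy hr δ ε K t₀ s₀ t₁ q1 q2 q3 q4 q5 q6 q7 q8 hmax

end

/-- One-sided bounds on the time slope of smooth functions touching `v` from above, both where the
spatial gradient of the test function is nonzero and, along flat contact sets, where it is zero. -/
structure SlopeControl (T α C₀ Mf : ℝ) (v : EucSp N → ℝ → ℝ) : Prop where
  slope_le : ∀ x : EucSp N, ∀ t ∈ Ioo 0 T, ∀ p : EucSp N, p ≠ 0 → ∀ σ : ℝ, 0 ≤ σ → ∀ b c : ℝ,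
    (∀ᶠ z : EucSp N × ℝ in nhds (x, t), v z.1 z.2 ≤ v x t + ⟪p, z.1 - x⟫ +
      1 / 2 * (σ * ‖z.1 - x‖ ^ 2) + (b * (z.2 - t) + c * (z.2 - t) ^ 2)) →
    b ≤ C₀ * ‖p‖ ^ α * (σ + ‖p‖) + Mf
  flat_slope_le : ∀ (x : EucSp N) (t δ : ℝ), 0 < δ → Ioo (t - δ) (t + δ) ⊆ Ioo 0 T → ∀ b c : ℝ,
    (∀ᶠ y in nhds x, (∀ s ∈ Ioo (t - δ) (t + δ),
        v y s ≤ v x t + (b * (s - t) + c * (s - t) ^ 2)) ∧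
      ∃ s ∈ Ioo (t - δ) (t + δ), v y s = v x t + (b * (s - t) + c * (s - t) ^ 2)) → b ≤ Mf

section Control

variable {T α a A : ℝ} {F : EucSp N → EucSp N → MatN N → ℝ} {h : EucSp N → ℝ → EucSp N}
  {f u v : EucSp N → ℝ → ℝ}

theorem H1.map_zero (hF1 : H1 univ F α) (x : EucSp N) {p : EucSp N} (hp : p ≠ 0) :
    F x p 0 = 0 := by
  simpa using hF1 x (mem_univ _) p hp 0 Matrix.isSymm_zero 1 one_ne_zero 0 le_rfl

theorem polarMat_const_mul_norm_sq (c : ℝ) :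
    polarMat (fun v : EucSp N => c * ‖v‖ ^ 2) = c • (1 : MatN N) := by
  rw [polarMat_const_mul, polarMat_norm_sq]

theorem rpow_one_add_eq (hα : -1 < α) {r : ℝ} (hr : 0 ≤ r) : r ^ (1 + α) = r ^ α * r := by
  rcases hr.eq_or_lt with h | h
  · rw [← h, Real.zero_rpow (by linarith), mul_zero]
  · rw [add_comm, Real.rpow_add_one h.ne']

theorem IsSubSol.slopeControl (hα : -1 < α) (hF1 : H1 univ F α) (hF2 : H2 univ F α a A)
    {Ch : ℝ} (hCh : ∀ x : EucSp N, ∀ t ∈ Ioo (0 : ℝ) T, ‖h x t‖ ≤ Ch)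
    {Mf : ℝ} (hfb : ∀ x : EucSp N, ∀ t ∈ Ioo (0 : ℝ) T, |f x t| ≤ Mf)
    (hsub : IsSubSol univ T F h α f u)
    (hc : ContinuousOn (fun p : EucSp N × ℝ => u p.1 p.2) (univ ×ˢ Ico 0 T)) :
    SlopeControl T α (A * N + |Ch|) Mf u := by
  have hA : 0 < A := hF2.1.trans_le hF2.2.1
  refine ⟨fun x t ht p hp σ hσ b c hj => ?_, fun x t δ hδ hI b c hj => ?_⟩
  · have i1 := hsub.jet_le hc ht hp (isQuadForm_norm_sq.const_mul σ) hj
    have i2 := hF2.shift_le x hp Matrix.isSymm_zero hσ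
    rw [hF1.map_zero x hp, zero_add] at i2
    rw [polarMat_const_mul_norm_sq] at i1
    have i3 := (abs_le.mp ((gradTerm_abs_le hα ((hCh x t ht).trans (le_abs_self Ch)) p))).2
    rw [rpow_one_add_eq hα (norm_nonneg p)] at i3
    have i4 := (abs_le.mp (hfb x t ht)).2
    have n1 : 0 ≤ A * N * ‖p‖ ^ α * ‖p‖ := by positivity
    have n2 : 0 ≤ |Ch| * ‖p‖ ^ α * σ := by positivity
    linarith
  · have ht : t ∈ Ioo 0 T := hI ⟨by linarith, by linarith⟩
    exact (hsub.le_of_flat hc hδ hI hj).trans (abs_le.mp (hfb x t ht)).2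

theorem IsSuperSol.slopeControl_neg (hα : -1 < α) (hF1 : H1 univ F α) (hF2 : H2 univ F α a A)
    {Ch : ℝ} (hCh : ∀ x : EucSp N, ∀ t ∈ Ioo (0 : ℝ) T, ‖h x t‖ ≤ Ch)
    {Mf : ℝ} (hfb : ∀ x : EucSp N, ∀ t ∈ Ioo (0 : ℝ) T, |f x t| ≤ Mf)
    (hsup : IsSuperSol univ T F h α f u)
    (hc : ContinuousOn (fun p : EucSp N × ℝ => u p.1 p.2) (univ ×ˢ Ico 0 T)) :
    SlopeControl T α (A * N + |Ch|) Mf fun x t => -u x t := by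
  have hA : 0 < A := hF2.1.trans_le hF2.2.1
  refine ⟨fun x t ht p hp σ hσ b c hj => ?_, fun x t δ hδ hI b c hj => ?_⟩
  · have hp' := neg_ne_zero.mpr hp
    have i1 := hsup.le_jet hc ht hp' (isQuadForm_norm_sq.const_mul (-σ)) (b := -b) (d := -c) (by
      filter_upwards [hj] with z hz
      rw [inner_neg_left]
      linarith)
    have i2 := hF2.shift_le x hp' (X := (-σ) • (1 : MatN N)) (Matrix.isSymm_one.smul _) hσ
    rw [neg_smul, neg_add_cancel, hF1.map_zero x hp', norm_neg] at i2
    rw [polarMat_const_mul_norm_sq, neg_smul] at i1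
    have i3 := (abs_le.mp ((gradTerm_abs_le hα ((hCh x t ht).trans (le_abs_self Ch)) (-p)))).1
    rw [norm_neg, rpow_one_add_eq hα (norm_nonneg p)] at i3
    have i4 := (abs_le.mp (hfb x t ht)).1
    have n1 : 0 ≤ A * N * ‖p‖ ^ α * ‖p‖ := by positivity
    have n2 : 0 ≤ |Ch| * ‖p‖ ^ α * σ := by positivity
    linarith
  · have ht : t ∈ Ioo 0 T := hI ⟨by linarith, by linarith⟩
    have := hsup.le_of_flat hc hδ hI (b := -b) (d := -c) (by
      filter_upwards [hj] with y hy
      refine ⟨fun s hs => by linarith [hy.1 s hs], ?_⟩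
      obtain ⟨s, hs, hse⟩ := hy.2
      exact ⟨s, hs, by linarith⟩)
    linarith [(abs_le.mp (hfb x t ht)).1]

theorem SlopeControl.power_slope_le {C₀ Mf : ℝ} (hv : SlopeControl T α C₀ Mf v) (hα : -1 < α)
    {k B : ℝ} (hk : 2 < k) (hB : 0 < B) {x y : EucSp N} (hxy : x ≠ y) {t : ℝ}
    (ht : t ∈ Ioo 0 T) {b c : ℝ}
    (hj : ∀ᶠ z : EucSp N × ℝ in nhds (x, t), v z.1 z.2 ≤ v x t +
      B * (‖z.1 - y‖ ^ k - ‖x - y‖ ^ k) + (b * (z.2 - t) + c * (z.2 - t) ^ 2)) :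
    b ≤ C₀ * ((B * k) ^ (1 + α) * ((1 + 18 * k + ‖x - y‖) * ‖x - y‖ ^ ((k - 1) * (1 + α) - 1))) +
      Mf := by
  have he := sub_ne_zero.mpr hxy
  set r := ‖x - y‖ with hrd
  have hr : 0 < r := norm_pos_iff.mpr he
  set m := B * (k * r ^ (k - 2)) with hm
  have hm0 : 0 < m := by positivity
  have hd : Tendsto (fun z : EucSp N × ℝ => z.1 - x) (nhds (x, t)) (nhds 0) := by
    have : Continuous fun z : EucSp N × ℝ => z.1 - x := by fun_prop
    simpa using this.tendsto (x, t)
  have h1 := hv.slope_le x t ht (m • (x - y)) (smul_ne_zero hm0.ne' he) (m * (1 + 18 * k))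
    (by positivity) b c (by
      filter_upwards [hj, hd.eventually (eventually_norm_add_rpow_le_of_two_lt he hk)] with z hz hn
      rw [show x - y + (z.1 - x) = z.1 - y by abel] at hn
      have := mul_le_mul_of_nonneg_left hn hB.le
      rw [real_inner_smul_left]
      linarith)
  have hn : ‖m • (x - y)‖ = m * r := by rw [norm_smul, Real.norm_of_nonneg hm0.le]
  refine h1.trans (le_of_eq ?_)
  have hmr : m * r = B * k * r ^ (k - 1) := by
    rw [hm, show k - 1 = k - 2 + 1 by ring, Real.rpow_add_one hr.ne']; ring
  have e1 : (m * r) ^ (1 + α) = (B * k) ^ (1 + α) * r ^ ((k - 1) * (1 + α)) := by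
    rw [hmr, Real.mul_rpow (by positivity) (by positivity), ← Real.rpow_mul hr.le]
  rw [hn, Real.rpow_sub_one hr.ne']
  have e2 : (m * r) ^ α * (m * (1 + 18 * k) + m * r) =
      (m * r) ^ (1 + α) * (1 + 18 * k + r) / r := by
    rw [rpow_one_add_eq hα (by positivity)]; field_simp
  rw [mul_assoc, e2, e1]
  ring

end Control

theorem eq_of_abs_sub_le_rpow {E : Type*} [NormedAddCommGroup E] [NormedSpace ℝ E] {m : E → ℝ}
    {x₀ : E} {R C k : ℝ} (hk : 2 < k)
    (h : ∀ x ∈ ball x₀ R, ∀ y ∈ ball x₀ R, |m x - m y| ≤ C * ‖x - y‖ ^ k) :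
    ∀ x ∈ ball x₀ R, m x = m x₀ := by
  have hd : ∀ y ∈ ball x₀ R, HasFDerivAt m (0 : E →L[ℝ] ℝ) y := by
    intro y hy
    have hO : (fun x => m x - m y) =O[nhds y] fun x => ‖x - y‖ ^ 2 := by
      refine Asymptotics.IsBigO.of_bound |C| ?_
      filter_upwards [isOpen_ball.mem_nhds hy, ball_mem_nhds y one_pos] with x hx hx1
      rw [mem_ball_iff_norm] at hx1
      rw [Real.norm_eq_abs, Real.norm_of_nonneg (by positivity)]
      refine (h x hx y hy).trans ?_
      have h2 : ‖x - y‖ ^ k ≤ ‖x - y‖ ^ 2 := by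
        rw [← Real.rpow_two]
        rcases (norm_nonneg (x - y)).eq_or_lt with h0 | h0
        · rw [← h0, Real.zero_rpow (by linarith), Real.zero_rpow (by norm_num)]
        · exact Real.rpow_le_rpow_of_exponent_ge h0 hx1.le hk.le
      calc C * ‖x - y‖ ^ k ≤ |C| * ‖x - y‖ ^ k := by
            gcongr
            exact le_abs_self C
        _ ≤ _ := by gcongr
    have := hO.hasFDerivAt one_lt_two (𝕜 := ℝ)
    simpa using this.add_const (m y)
  intro x hx
  have hR : 0 < R := pos_of_mem_ball hx
  exact isOpen_ball.is_const_of_fderiv_eq_zero (convex_ball x₀ R).isPreconnected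
    (fun y hy => (hd y hy).differentiableAt.differentiableWithinAt)
    (fun y hy => (hd y hy).fderiv) hx (mem_ball_self hR)

section Singular

variable {T α C₀ Mf : ℝ} {v : EucSp N → ℝ → ℝ}

theorem eventually_maximizer_near {x₀ : EucSp N} {τ η η₁ B k : ℝ} (hk : 0 < k) (hη₁ : 0 < η₁) :
    ∀ᶠ y in nhds x₀, ∀ z ∈ (closedBall x₀ η ×ˢ Icc (τ - η) (τ + η)) \
        (ball x₀ η₁ ×ˢ Ioo (τ - η₁) (τ + η₁)),
      B * ‖z.1 - x₀‖ ^ k - (z.2 - τ) ^ 2 - (B + 1) * ‖z.1 - y‖ ^ k < -((B + 1) * ‖x₀ - y‖ ^ k) := by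
  have hK : IsCompact ((closedBall x₀ η ×ˢ Icc (τ - η) (τ + η)) \
        (ball x₀ η₁ ×ˢ Ioo (τ - η₁) (τ + η₁))) :=
    ((isCompact_closedBall _ _).prod isCompact_Icc).diff (isOpen_ball.prod isOpen_Ioo)
  refine hK.eventually_forall_of_forall_eventually fun z hz => ?_
  have c1 : Continuous fun w : EucSp N × EucSp N × ℝ => ‖w.2.1 - x₀‖ ^ k :=
    (by fun_prop : Continuous fun w : EucSp N × EucSp N × ℝ => ‖w.2.1 - x₀‖).rpow_const
      fun _ => Or.inr hk.le
  have c2 : Continuous fun w : EucSp N × EucSp N × ℝ => ‖w.2.1 - w.1‖ ^ k :=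
    (by fun_prop : Continuous fun w : EucSp N × EucSp N × ℝ => ‖w.2.1 - w.1‖).rpow_const
      fun _ => Or.inr hk.le
  have c3 : Continuous fun w : EucSp N × EucSp N × ℝ => ‖x₀ - w.1‖ ^ k :=
    (by fun_prop : Continuous fun w : EucSp N × EucSp N × ℝ => ‖x₀ - w.1‖).rpow_const
      fun _ => Or.inr hk.le
  have hc1 : Continuous fun w : EucSp N × EucSp N × ℝ =>
      B * ‖w.2.1 - x₀‖ ^ k - (w.2.2 - τ) ^ 2 - (B + 1) * ‖w.2.1 - w.1‖ ^ k := by fun_prop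
  have hc2 : Continuous fun w : EucSp N × EucSp N × ℝ => -((B + 1) * ‖x₀ - w.1‖ ^ k) := by fun_prop
  refine hc1.continuousAt.eventually_lt hc2.continuousAt ?_
  simp only [sub_self, norm_zero]
  rw [Real.zero_rpow hk.ne']
  have h1 : 0 ≤ ‖z.1 - x₀‖ ^ k := by positivity
  have h2 : 0 < ‖z.1 - x₀‖ ^ k + (z.2 - τ) ^ 2 := by
    by_contra hneg
    push Not at hneg
    have e1 : z.2 - τ = 0 := by
      have : (z.2 - τ) ^ 2 ≤ 0 := by linarith
      nlinarith
    have e2 : ‖z.1 - x₀‖ ^ k = 0 := by nlinarith [sq_nonneg (z.2 - τ)]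
    rw [Real.rpow_eq_zero (norm_nonneg _) hk.ne'] at e2
    refine hz.2 ⟨by rw [mem_ball_iff_norm, e2]; exact hη₁, ?_, ?_⟩ <;> linarith
  linarith

theorem SlopeControl.le_of_singular (hv : SlopeControl T α C₀ Mf v) (hα : -1 < α)
    (hc : ContinuousOn (fun p : EucSp N × ℝ => v p.1 p.2) (univ ×ˢ Ico 0 T))
    {k B : ℝ} (hk : 2 < k) (hkα : 0 < (k - 1) * (1 + α) - 1) (hB : 0 < B) {x₀ : EucSp N} {τ : ℝ}
    (hτ : τ ∈ Ioo 0 T) {κ₁ κ₂ : ℝ} (hκ₂ : 0 ≤ κ₂)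
    (hj : ∀ᶠ z : EucSp N × ℝ in nhds (x₀, τ), v z.1 z.2 ≤ v x₀ τ + B * ‖z.1 - x₀‖ ^ k +
      (κ₁ * (z.2 - τ) + κ₂ * (z.2 - τ) ^ 2)) : κ₁ ≤ Mf := by
  by_contra hlt
  push Not at hlt
  obtain ⟨m, hm1, hm2⟩ := exists_between hlt
  obtain ⟨η, hη, hbox⟩ : ∃ η > 0, ∀ x t, ‖x - x₀‖ ≤ η → |t - τ| ≤ η → t ∈ Ioo 0 T ∧
      v x t ≤ v x₀ τ + B * ‖x - x₀‖ ^ k + (κ₁ * (t - τ) + κ₂ * (t - τ) ^ 2) := by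
    obtain ⟨η, hη, hh⟩ := Metric.eventually_nhds_iff.mp (hj.and (eventually_snd_mem_Ioo x₀ hτ))
    refine ⟨η / 2, by positivity, fun x t hx ht => ?_⟩
    have := hh (y := (x, t)) (by
      rw [Prod.dist_eq, max_lt_iff, dist_eq_norm, Real.dist_eq]
      exact ⟨by simp only; linarith, by simp only; linarith⟩)
    exact ⟨this.2, this.1⟩
  obtain ⟨r₁, hr₁, hr⟩ : ∃ r₁ > 0, ∀ r : ℝ, 0 ≤ r → r < r₁ →
      C₀ * (((B + 1) * k) ^ (1 + α) * ((1 + 18 * k + r) * r ^ ((k - 1) * (1 + α) - 1))) +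
        Mf < m := by
    have hcont : ContinuousAt (fun r : ℝ => C₀ * (((B + 1) * k) ^ (1 + α) *
        ((1 + 18 * k + r) * r ^ ((k - 1) * (1 + α) - 1))) + Mf) 0 := by
      have : ContinuousAt (fun r : ℝ => r ^ ((k - 1) * (1 + α) - 1)) 0 :=
        Real.continuousAt_rpow_const _ _ (Or.inr hkα.le)
      fun_prop
    have hz : (fun r : ℝ => C₀ * (((B + 1) * k) ^ (1 + α) *
        ((1 + 18 * k + r) * r ^ ((k - 1) * (1 + α) - 1))) + Mf) 0 < m := by
      simp only [Real.zero_rpow hkα.ne']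
      linarith
    obtain ⟨r₁, hr₁, hh⟩ := Metric.eventually_nhds_iff.mp (hcont.eventually (gt_mem_nhds hz))
    refine ⟨r₁, hr₁, fun d hd hd1 => hh ?_⟩
    rwa [Real.dist_eq, sub_zero, abs_of_nonneg hd]
  set η₁ := min (η / 2) (min (r₁ / 2) ((κ₁ - m) / (2 * (κ₂ + 1)))) with hη₁d
  have hκm : 0 < κ₁ - m := by linarith
  have hη₁ : 0 < η₁ := by positivity
  have hη₁η : η₁ ≤ η / 2 := min_le_left _ _
  have hη₁r : η₁ ≤ r₁ / 2 := (min_le_right _ _).trans (min_le_left _ _)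
  have hη₁κ : η₁ * (2 * (κ₂ + 1)) ≤ κ₁ - m := by
    have := (min_le_right (η / 2) _).trans (min_le_right (r₁ / 2) ((κ₁ - m) / (2 * (κ₂ + 1))))
    rwa [← hη₁d, le_div_iff₀ (by positivity)] at this
  obtain ⟨η₂, hη₂, hnear⟩ := Metric.eventually_nhds_iff_ball.mp
    ((eventually_maximizer_near (x₀ := x₀) (τ := τ) (η := η) (B := B) (by linarith : 0 < k)
      hη₁).and (ball_mem_nhds x₀ hη₁))
  set D := closedBall x₀ η ×ˢ Icc (τ - η) (τ + η) with hD
  have hDc : IsCompact D := (isCompact_closedBall _ _).prod isCompact_Icc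
  have hDm : ∀ x t, ‖x - x₀‖ ≤ η → |t - τ| ≤ η → (x, t) ∈ D := fun x t hx ht =>
    ⟨by rwa [mem_closedBall_iff_norm], by linarith [(abs_le.mp ht).1], by
      linarith [(abs_le.mp ht).2]⟩
  have hDm' : ∀ z ∈ D, ‖z.1 - x₀‖ ≤ η ∧ |z.2 - τ| ≤ η := fun z hz =>
    ⟨mem_closedBall_iff_norm.mp hz.1, abs_le.mpr ⟨by linarith [hz.2.1], by linarith [hz.2.2]⟩⟩
  set w : EucSp N → ℝ → ℝ := fun x t => v x t - (κ₁ * (t - τ) + (κ₂ + 1) * (t - τ) ^ 2) with hw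
  have hmaxz : ∀ y ∈ ball x₀ η₂, ∃ z ∈ ball x₀ η₁ ×ˢ Ioo (τ - η₁) (τ + η₁), ∀ x t,
      ‖x - x₀‖ ≤ η → |t - τ| ≤ η →
      w x t - (B + 1) * ‖x - y‖ ^ k ≤ w z.1 z.2 - (B + 1) * ‖z.1 - y‖ ^ k := by
    intro y hy
    have hcont : ContinuousOn
        (fun z : EucSp N × ℝ => w z.1 z.2 - (B + 1) * ‖z.1 - y‖ ^ k) D := by
      have hvc : ContinuousOn (fun z : EucSp N × ℝ => v z.1 z.2) D :=
        hc.mono fun z hz => ⟨mem_univ _, Ioo_subset_Ico_self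
          (hbox z.1 z.2 (hDm' z hz).1 (hDm' z hz).2).1⟩
      have hn : Continuous fun z : EucSp N × ℝ => ‖z.1 - y‖ ^ k :=
        (by fun_prop : Continuous fun z : EucSp N × ℝ => ‖z.1 - y‖).rpow_const
          fun _ => Or.inr (by linarith)
      exact (hvc.sub (by fun_prop)).sub (continuous_const.mul hn).continuousOn
    obtain ⟨z, hzD, hzm⟩ := hDc.exists_isMaxOn ⟨_, hDm x₀ τ (by simpa using hη.le)
      (by simpa using hη.le)⟩ hcont
    refine ⟨z, ?_, fun x t hx ht => hzm (hDm x t hx ht)⟩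
    by_contra hout
    have h1 := (hnear y hy).1 z ⟨hzD, hout⟩
    have h2 := hzm (hDm x₀ τ (by simpa using hη.le) (by simpa using hη.le))
    have h3 := (hbox z.1 z.2 (hDm' z hzD).1 (hDm' z hzD).2).2
    simp only [mem_ofPred_eq, hw] at h2
    simp only [sub_self] at h2
    linarith
  choose! ζ hζ hζm using hmaxz
  have hζη : ∀ y ∈ ball x₀ η₂, ‖(ζ y).1 - x₀‖ < η₁ ∧ |(ζ y).2 - τ| < η₁ := fun y hy =>
    ⟨mem_ball_iff_norm.mp (hζ y hy).1, abs_lt.mpr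
      ⟨by linarith [(hζ y hy).2.1], by linarith [(hζ y hy).2.2]⟩⟩
  have hy₁ : ∀ y ∈ ball x₀ η₂, ‖y - x₀‖ < η₁ := fun y hy => mem_ball_iff_norm.mp (hnear y hy).2
  by_cases hcase : ∃ y ∈ ball x₀ η₂, (ζ y).1 ≠ y
  · obtain ⟨y, hy, hne⟩ := hcase
    obtain ⟨hz1, hz2⟩ := hζη y hy
    have hnb : ∀ᶠ z : EucSp N × ℝ in nhds ((ζ y).1, (ζ y).2), ‖z.1 - x₀‖ < η ∧ |z.2 - τ| < η := by
      have c1 : Continuous fun z : EucSp N × ℝ => ‖z.1 - x₀‖ := by fun_prop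
      have c2 : Continuous fun z : EucSp N × ℝ => |z.2 - τ| := by fun_prop
      exact (c1.continuousAt.eventually (gt_mem_nhds (by simp only; linarith))).and
        (c2.continuousAt.eventually (gt_mem_nhds (by simp only; linarith)))
    have h1 := hv.power_slope_le hα hk (by linarith : 0 < B + 1) hne
      (hbox _ _ (by linarith : ‖(ζ y).1 - x₀‖ ≤ η) (by linarith : |(ζ y).2 - τ| ≤ η)).1
      (b := κ₁ + 2 * (κ₂ + 1) * ((ζ y).2 - τ)) (c := κ₂ + 1) (by
        filter_upwards [hnb] with z hz
        have := hζm y hy z.1 z.2 hz.1.le hz.2.le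
        simp only [hw] at this
        linarith)
    have h2 : ‖(ζ y).1 - y‖ < r₁ := by
      have h3 := norm_sub_le_norm_sub_add_norm_sub (ζ y).1 x₀ y
      rw [norm_sub_rev x₀ y] at h3
      linarith [hy₁ y hy]
    have h3 := hr _ (norm_nonneg _) h2
    have h4 := (abs_lt.mp hz2).1
    have h5 := mul_le_mul_of_nonneg_left h4.le (show 0 ≤ 2 * (κ₂ + 1) by positivity)
    linarith
  · push Not at hcase
    set M : EucSp N → ℝ := fun y => w y (ζ y).2 with hM
    have hMle : ∀ y ∈ ball x₀ η₂, ∀ x t, ‖x - x₀‖ ≤ η → |t - τ| ≤ η →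
        w x t - (B + 1) * ‖x - y‖ ^ k ≤ M y := by
      intro y hy x t hx ht
      have := hζm y hy x t hx ht
      rwa [hcase y hy, sub_self, norm_zero, Real.zero_rpow (by linarith), mul_zero, sub_zero]
        at this
    have hone : ∀ x ∈ ball x₀ η₂, ∀ y ∈ ball x₀ η₂, M x - M y ≤ (B + 1) * ‖x - y‖ ^ k := by
      intro x hx y hy
      have := hMle y hy x (ζ x).2 (by linarith [hy₁ x hx]) (by linarith [(hζη x hx).2])
      simp only [hM] at this ⊢
      linarith
    have hconst := eq_of_abs_sub_le_rpow (m := M) (x₀ := x₀) (R := η₂) (C := B + 1) hk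
      fun x hx y hy => abs_le.mpr ⟨by
        have := hone y hy x hx
        rw [norm_sub_rev] at this
        linarith, hone x hx y hy⟩
    have hx₀ : x₀ ∈ ball x₀ η₂ := mem_ball_self hη₂
    have hMx₀ : M x₀ = v x₀ τ := by
      apply le_antisymm
      · have := (hbox x₀ (ζ x₀).2 (by simpa using hη.le) (by linarith [(hζη x₀ hx₀).2])).2
        simp only [sub_self, norm_zero] at this
        rw [Real.zero_rpow (by linarith)] at this
        simp only [hM, hw]
        linarith [sq_nonneg ((ζ x₀).2 - τ)]
      · have := hMle x₀ hx₀ x₀ τ (by simpa using hη.le) (by simpa using hη.le)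
        simp only [hw, sub_self, norm_zero] at this
        rw [Real.zero_rpow (by linarith)] at this
        linarith
    have := hv.flat_slope_le x₀ τ η₁ hη₁ (fun t ht => (hbox x₀ t (by simpa using hη.le)
      (abs_le.mpr ⟨by linarith [ht.1], by linarith [ht.2]⟩)).1) κ₁ (κ₂ + 1) (by
      filter_upwards [ball_mem_nhds x₀ hη₂] with y hy
      have hMy := (hconst y hy).trans hMx₀
      refine ⟨fun s hs => ?_, (ζ y).2, (hζ y hy).2, ?_⟩
      · have := hMle y hy y s (by linarith [hy₁ y hy])
          (abs_le.mpr ⟨by linarith [hs.1], by linarith [hs.2]⟩)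
        rw [sub_self, norm_zero, Real.zero_rpow (by linarith), hMy] at this
        simp only [hw] at this
        linarith
      · simp only [hM, hw] at hMy
        linarith)
    linarith

end Singular

theorem SlopeControl.sub_le_of_barrier {T α C₀ Mf : ℝ} {v : EucSp N → ℝ → ℝ}
    (hv : SlopeControl T α C₀ Mf v) (hα : -1 < α)
    (hc : ContinuousOn (fun p : EucSp N × ℝ => v p.1 p.2) (univ ×ˢ Ico 0 T))
    {M : ℝ} (hM : ∀ x : EucSp N, ∀ t ∈ Ico (0 : ℝ) T, |v x t| ≤ M)
    {m : ℝ → ℝ} (hm : ∀ t ∈ Ioo 0 T, ∀ x y, v x t - v y t ≤ m ‖x - y‖)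
    {k B K ε ρ : ℝ} (hk : 2 < k) (hkα : 0 < (k - 1) * (1 + α) - 1) (hB : 0 < B)
    (hε : 0 ≤ ε) (hMf : 0 ≤ Mf) (hMK : Mf < K) (hmε : ∀ r, 0 ≤ r → m r ≤ ε + B * r ^ k)
    (hmρ : ∀ r, ρ < r → 0 < r → m r < B * r ^ k)
    (hK : ∀ r, 0 < r → r ≤ ρ →
      C₀ * ((B * k) ^ (1 + α) * ((1 + 18 * k + r) * r ^ ((k - 1) * (1 + α) - 1))) + Mf < K)
    {x₀ : EucSp N} {t₀ t₁ : ℝ} (ht₀ : t₀ ∈ Ioo 0 T) (ht₁ : t₁ ∈ Ioo 0 T) (htt : t₀ < t₁) :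
    v x₀ t₁ - v x₀ t₀ ≤ ε + K * (t₁ - t₀) := by
  by_contra hlt
  push Not at hlt
  have hk0 : 0 < k := by linarith
  have hM0 : 0 ≤ M := (abs_nonneg _).trans (hM x₀ t₀ (Ioo_subset_Ico_self ht₀))
  obtain ⟨T₂, hT₁, hT₂⟩ := exists_between ht₁.2
  have hT₁' : 0 < T₂ - t₁ := by linarith
  obtain ⟨R, hR0, hR⟩ : ∃ R : ℝ, 0 < R ∧ 2 * M < B * R ^ k := by
    have := (tendsto_rpow_atTop hk0).const_mul_atTop hB
    obtain ⟨R, h1, h2⟩ := ((eventually_gt_atTop (0 : ℝ)).and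
      (this.eventually (eventually_gt_atTop (2 * M)))).exists
    exact ⟨R, h1, h2⟩
  set K' := 2 * M / (T₂ - t₁) ^ 2 with hK'
  have hK'0 : 0 ≤ K' := by positivity
  have hK'1 : K' * (T₂ - t₁) ^ 2 = 2 * M := by rw [hK']; field_simp
  set Ψ : EucSp N × ℝ → ℝ := fun z => v z.1 z.2 - v x₀ t₀ - ε - B * ‖z.1 - x₀‖ ^ k -
    K * (z.2 - t₀) - K' * max (z.2 - t₁) 0 ^ 2 with hΨ
  set D := closedBall x₀ R ×ˢ Icc t₀ T₂ with hD
  have hDc : IsCompact D := (isCompact_closedBall _ _).prod isCompact_Icc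
  have hD1 : (x₀, t₁) ∈ D := ⟨mem_closedBall_self hR0.le, htt.le, hT₁.le⟩
  have hΨc : ContinuousOn Ψ D := by
    have hvc : ContinuousOn (fun z : EucSp N × ℝ => v z.1 z.2) D :=
      hc.mono fun z hz => ⟨mem_univ _, ht₀.1.le.trans hz.2.1, hz.2.2.trans_lt hT₂⟩
    have hn : Continuous fun z : EucSp N × ℝ => ‖z.1 - x₀‖ ^ k :=
      (by fun_prop : Continuous fun z : EucSp N × ℝ => ‖z.1 - x₀‖).rpow_const
        fun _ => Or.inr hk0.le
    have hn' : Continuous fun z : EucSp N × ℝ => ε + B * ‖z.1 - x₀‖ ^ k +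
      K * (z.2 - t₀) + K' * max (z.2 - t₁) 0 ^ 2 + v x₀ t₀ := by fun_prop
    refine (hvc.sub hn'.continuousOn).congr fun z _ => ?_
    simp only [hΨ, Pi.sub_apply]
    ring
  obtain ⟨⟨x, t⟩, hzD, hzm⟩ := hDc.exists_isMaxOn ⟨_, hD1⟩ hΨc
  have hpos : 0 < Ψ (x, t) := by
    refine lt_of_lt_of_le ?_ (hzm hD1)
    simp only [hΨ, sub_self, norm_zero, max_self]
    rw [Real.zero_rpow hk0.ne']
    linarith
  have hxR : ‖x - x₀‖ ≤ R := mem_closedBall_iff_norm.mp hzD.1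
  have htI : t₀ ≤ t ∧ t ≤ T₂ := hzD.2
  have ht0T : t ∈ Ioo 0 T := ⟨ht₀.1.trans_le htI.1, htI.2.trans_lt hT₂⟩
  have hv2 : v x t - v x₀ t₀ ≤ 2 * M := by
    linarith [(abs_le.mp (hM x t (Ioo_subset_Ico_self ht0T))).2,
      (abs_le.mp (hM x₀ t₀ (Ioo_subset_Ico_self ht₀))).1]
  have hpos' : 0 < v x t - v x₀ t₀ - ε - B * ‖x - x₀‖ ^ k - K * (t - t₀) -
    K' * max (t - t₁) 0 ^ 2 := hpos
  have n1 : 0 ≤ B * ‖x - x₀‖ ^ k := by positivity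
  have n2 : 0 ≤ K * (t - t₀) := mul_nonneg (by linarith) (by linarith)
  have n3 : 0 ≤ K' * max (t - t₁) 0 ^ 2 := by positivity
  have hxR' : ‖x - x₀‖ < R := by
    refine lt_of_le_of_ne hxR fun he => ?_
    rw [he] at hpos'
    linarith
  have htT : t < T₂ := by
    refine lt_of_le_of_ne htI.2 fun he => ?_
    rw [he, max_eq_left hT₁'.le, hK'1, ← he] at hpos'
    linarith
  have htt₀ : t₀ < t := by
    refine lt_of_le_of_ne htI.1 fun he => ?_
    have h1 := hm t ht0T x x₀
    have h2 := hmε ‖x - x₀‖ (norm_nonneg _)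
    rw [he] at hpos'
    linarith
  have hxρ : x ≠ x₀ → ‖x - x₀‖ ≤ ρ := by
    intro hne
    by_contra hlt
    push Not at hlt
    have h1 := hm t ht0T x x₀
    have h2 := hmρ _ hlt (norm_sub_pos_iff.mpr hne)
    have h3 : Ψ (x₀, t) ≤ Ψ (x, t) := hzm ⟨mem_closedBall_self hR0.le, htI⟩
    simp only [hΨ, sub_self, norm_zero] at h3
    rw [Real.zero_rpow hk0.ne'] at h3
    linarith
  set b := K + K' * (2 * max (t - t₁) 0) with hb
  have hbK : K ≤ b := by
    have : 0 ≤ K' * (2 * max (t - t₁) 0) := by positivity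
    linarith
  have hj : ∀ᶠ z : EucSp N × ℝ in nhds (x, t), v z.1 z.2 ≤ v x t +
      B * (‖z.1 - x₀‖ ^ k - ‖x - x₀‖ ^ k) + (b * (z.2 - t) + K' * (z.2 - t) ^ 2) := by
    have hnb : D ∈ nhds (x, t) := prod_mem_nhds
      (closedBall_mem_nhds_of_mem (mem_ball_iff_norm.mpr hxR')) (Icc_mem_nhds htt₀ htT)
    filter_upwards [hnb] with z hz
    have h1 : Ψ z ≤ Ψ (x, t) := hzm hz
    have h2 := mul_le_mul_of_nonneg_left (sq_posPart_add_le (t - t₁) (z.2 - t)) hK'0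
    rw [show t - t₁ + (z.2 - t) = z.2 - t₁ by ring] at h2
    simp only [hΨ] at h1
    rw [hb]
    linarith
  by_cases hne : x = x₀
  · subst hne
    have := hv.le_of_singular hα hc hk hkα hB ht0T hK'0 (κ₁ := b) (by
      simpa only [sub_self, norm_zero, Real.zero_rpow hk0.ne', sub_zero] using hj)
    linarith
  · have h1 := hv.power_slope_le hα hk hB hne ht0T hj
    have h2 := hK _ (norm_sub_pos_iff.mpr hne) (hxρ hne)
    linarith

theorem SlopeControl.sub_le_of_spatial_holder {T α C₀ Mf : ℝ} {v : EucSp N → ℝ → ℝ}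
    (hv : SlopeControl T α C₀ Mf v) (hα : -1 < α) (hC₀ : 0 ≤ C₀)
    (hc : ContinuousOn (fun p : EucSp N × ℝ => v p.1 p.2) (univ ×ˢ Ico 0 T))
    {M : ℝ} (hM : ∀ x : EucSp N, ∀ t ∈ Ico (0 : ℝ) T, |v x t| ≤ M)
    {L γ : ℝ} (hL : 0 < L) (h0 : 0 < γ) (h1 : γ < 1)
    (hH : ∀ t ∈ Ioo 0 T, ∀ x y, v x t - v y t ≤ L * ‖x - y‖ ^ γ)
    {k ρ : ℝ} (hk : 2 < k) (hkα : 0 < (k - 1) * (1 + α) - 1) (hρ : 0 < ρ) (hMf : 0 ≤ Mf)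
    {x₀ : EucSp N} {t₀ t₁ : ℝ} (ht₀ : t₀ ∈ Ioo 0 T) (ht₁ : t₁ ∈ Ioo 0 T) (htt : t₀ < t₁) :
    v x₀ t₁ - v x₀ t₀ ≤ L * ρ ^ γ +
      (C₀ * ((L * k) ^ (1 + α) * ((1 + 18 * k + ρ) * ρ ^ ((γ - 1) * (1 + α) - 1))) + Mf + 1) *
        (t₁ - t₀) := by
  have hB : 0 < L * ρ ^ (γ - k) := by positivity
  have hcomp : ∀ r, 0 < r → L * ρ ^ (γ - k) * r ^ k = L * r ^ γ * (r / ρ) ^ (k - γ) := by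
    intro r hr
    rw [Real.div_rpow hr.le hρ.le, div_eq_mul_inv, ← Real.rpow_neg hρ.le, neg_sub]
    rw [show L * r ^ γ * (r ^ (k - γ) * ρ ^ (γ - k)) = L * ρ ^ (γ - k) * (r ^ γ * r ^ (k - γ)) by
      ring, ← Real.rpow_add hr]
    congr 2
    ring
  refine hv.sub_le_of_barrier (k := k) (B := L * ρ ^ (γ - k)) (ρ := ρ) (m := fun r => L * r ^ γ)
    hα hc hM hH hk hkα hB (by positivity) hMf ?_ ?_ ?_ ?_ ht₀ ht₁ htt
  · have : 0 ≤ C₀ * ((L * k) ^ (1 + α) * ((1 + 18 * k + ρ) * ρ ^ ((γ - 1) * (1 + α) - 1))) := by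
      positivity
    linarith
  · intro r hr
    rcases le_or_gt r ρ with hle | hlt
    · have : L * r ^ γ ≤ L * ρ ^ γ := by gcongr
      have : 0 ≤ L * ρ ^ (γ - k) * r ^ k := by positivity
      linarith
    · have hr0 := hρ.trans hlt
      have h2 : 1 ≤ (r / ρ) ^ (k - γ) :=
        Real.one_le_rpow ((one_le_div hρ).mpr hlt.le) (by linarith)
      rw [hcomp r hr0]
      have h3 : 0 < L * r ^ γ := by positivity
      have h4 : 0 < L * ρ ^ γ := by positivity
      nlinarith
  · intro r hlt hr0
    have h2 : 1 < (r / ρ) ^ (k - γ) :=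
      Real.one_lt_rpow ((one_lt_div hρ).mpr hlt) (by linarith)
    rw [hcomp r hr0]
    have h3 : 0 < L * r ^ γ := by positivity
    nlinarith
  · intro r hr hle
    have e1 : (L * ρ ^ (γ - k) * k) ^ (1 + α) * ρ ^ ((k - 1) * (1 + α) - 1) =
        (L * k) ^ (1 + α) * ρ ^ ((γ - 1) * (1 + α) - 1) := by
      rw [show L * ρ ^ (γ - k) * k = L * k * ρ ^ (γ - k) by ring,
        Real.mul_rpow (by positivity) (by positivity), ← Real.rpow_mul hρ.le, mul_assoc,
        ← Real.rpow_add hρ]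
      congr 2
      ring
    have e2 : (L * ρ ^ (γ - k) * k) ^ (1 + α) * ((1 + 18 * k + r) * r ^ ((k - 1) * (1 + α) - 1)) ≤
        (L * k) ^ (1 + α) * ((1 + 18 * k + ρ) * ρ ^ ((γ - 1) * (1 + α) - 1)) := by
      calc _ ≤ (L * ρ ^ (γ - k) * k) ^ (1 + α) *
            ((1 + 18 * k + ρ) * ρ ^ ((k - 1) * (1 + α) - 1)) := by gcongr
        _ = (1 + 18 * k + ρ) *
            ((L * ρ ^ (γ - k) * k) ^ (1 + α) * ρ ^ ((k - 1) * (1 + α) - 1)) := by ring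
        _ = _ := by rw [e1]; ring
    have := mul_le_mul_of_nonneg_left e2 hC₀
    linarith

theorem rpow_le_rpow_mul_rpow_of_le {s T e g : ℝ} (hs : 0 < s) (hsT : s ≤ T) (h : g ≤ e) :
    s ^ e ≤ T ^ (e - g) * s ^ g := by
  calc s ^ e = s ^ (e - g) * s ^ g := by rw [← Real.rpow_add hs, sub_add_cancel]
    _ ≤ T ^ (e - g) * s ^ g := by gcongr

theorem SlopeControl.exists_time_holder {T α C₀ Mf : ℝ} {v : EucSp N → ℝ → ℝ}
    (hv : SlopeControl T α C₀ Mf v) (hα : -1 < α) (hC₀ : 0 ≤ C₀)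
    (hc : ContinuousOn (fun p : EucSp N × ℝ => v p.1 p.2) (univ ×ˢ Ico 0 T))
    {M : ℝ} (hM : ∀ x : EucSp N, ∀ t ∈ Ico (0 : ℝ) T, |v x t| ≤ M)
    {L γ : ℝ} (hL : 0 < L) (h0 : 0 < γ) (h1 : γ < 1)
    (hH : ∀ t ∈ Ioo 0 T, ∀ x y, v x t - v y t ≤ L * ‖x - y‖ ^ γ) (hMf : 0 ≤ Mf)
    {β g : ℝ} (hβ : 0 < β) (hβγ : β * ((α + 2) / γ - α) ≤ 1) (hgβ : g ≤ β) (hg1 : g ≤ 1) :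
    ∃ C, ∀ x : EucSp N, ∀ t ∈ Ioo 0 T, ∀ s, 0 < s → t + s ∈ Ioo 0 T →
      v x (t + s) - v x t ≤ C * s ^ g := by
  set k := max 2 ((α + 2) / (α + 1)) + 1 with hkd
  have hα1 : 0 < α + 1 := by linarith
  have hk : 2 < k := by
    have := le_max_left 2 ((α + 2) / (α + 1))
    linarith
  have hkα : 0 < (k - 1) * (1 + α) - 1 := by
    have := (div_le_iff₀ hα1).mp (le_max_right 2 ((α + 2) / (α + 1)))
    rw [show k - 1 = max 2 ((α + 2) / (α + 1)) by rw [hkd]; ring]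
    linarith
  set e := 1 + β / γ * ((γ - 1) * (1 + α) - 1) with he
  have heβ : β ≤ e := by
    have : e - β = 1 - β * ((α + 2) / γ - α) := by
      rw [he]
      field_simp
      ring
    linarith
  refine ⟨L * T ^ (β - g) + C₀ * ((L * k) ^ (1 + α) * ((1 + 18 * k + T ^ (β / γ)) * T ^ (e - g))) +
    (Mf + 1) * T ^ (1 - g), fun x t ht s hs hts => ?_⟩
  have hsT : s ≤ T := by linarith [ht.1, hts.2]
  have hT : 0 < T := hs.trans_le hsT
  have hρ : 0 < s ^ (β / γ) := by positivity
  have main := hv.sub_le_of_spatial_holder hα hC₀ hc hM hL h0 h1 hH hk hkα hρ hMf ht hts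
    (x₀ := x) (by linarith)
  rw [add_sub_cancel_left] at main
  have a1 : (s ^ (β / γ)) ^ γ = s ^ β := by
    rw [← Real.rpow_mul hs.le, div_mul_cancel₀ _ h0.ne']
  have a2 : (s ^ (β / γ)) ^ ((γ - 1) * (1 + α) - 1) * s = s ^ e := by
    rw [← Real.rpow_mul hs.le, he, Real.rpow_add hs, Real.rpow_one, mul_comm]
  have b1 := rpow_le_rpow_mul_rpow_of_le hs hsT hgβ
  have b2 := rpow_le_rpow_mul_rpow_of_le hs hsT (hgβ.trans heβ)
  have b3 := rpow_le_rpow_mul_rpow_of_le hs hsT hg1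
  rw [Real.rpow_one] at b3
  have b4 : s ^ (β / γ) ≤ T ^ (β / γ) := by gcongr
  rw [a1] at main
  calc _ ≤ _ := main
    _ = L * s ^ β + C₀ * ((L * k) ^ (1 + α) * ((1 + 18 * k + s ^ (β / γ)) *
        ((s ^ (β / γ)) ^ ((γ - 1) * (1 + α) - 1) * s))) + (Mf + 1) * s := by ring
    _ ≤ L * (T ^ (β - g) * s ^ g) + C₀ * ((L * k) ^ (1 + α) * ((1 + 18 * k + T ^ (β / γ)) *
        (T ^ (e - g) * s ^ g))) + (Mf + 1) * (T ^ (1 - g) * s ^ g) := by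
      rw [a2]
      gcongr
    _ = _ := by ring

/-- Uniform time Hölder regularity on `ℝ^N` (Proposition 9 of the paper). -/
theorem uniform_time_holder_RN
    (N : ℕ) (hN : 1 ≤ N) (α : ℝ) (hα : -1 < α)
    (T : ℝ) (hT : 0 < T)
    (F : EucSp N → EucSp N → MatN N → ℝ) (a A : ℝ)
    (hFc : Fcont (Set.univ : Set (EucSp N)) F)
    (hF1 : H1 (Set.univ : Set (EucSp N)) F α)
    (hF2 : H2 (Set.univ : Set (EucSp N)) F α a A)
    (hF3 : H3 (Set.univ : Set (EucSp N)) F) (hF6 : H6 F α)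
    (h : EucSp N → ℝ → EucSp N) (hh : HContBdd (Set.univ : Set (EucSp N)) T h)
    (hh5 : H5 (Set.univ : Set (EucSp N)) T h α)
    (ψ : EucSp N → ℝ) (γψ : ℝ) (hγψ : γψ ∈ Set.Ioo (0 : ℝ) 1)
    (cψ Mψ : ℝ) (hcψ : 0 < cψ)
    (hψH : ∀ x y : EucSp N, |ψ x - ψ y| ≤ cψ * ‖x - y‖ ^ γψ)
    (hψb : ∀ x : EucSp N, |ψ x| ≤ Mψ)
    (f : EucSp N → ℝ → ℝ)
    (hfu : UniformContinuousOn (fun p : EucSp N × ℝ => f p.1 p.2)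
      (Set.univ ×ˢ Set.Ioo 0 T))
    (Mf : ℝ) (hfb : ∀ x : EucSp N, ∀ t ∈ Set.Ioo (0 : ℝ) T, |f x t| ≤ Mf)
    (γf cf : ℝ) (hγf : 0 < γf) (hγf1 : γf ≤ 1) (hcf : 0 < cf)
    (hft : ∀ x : EucSp N, ∀ t ∈ Set.Ioo (0 : ℝ) T, ∀ s ∈ Set.Ioo (0 : ℝ) T,
      |f x t - f x s| ≤ cf * |t - s| ^ γf)
    (q₁ q γs : ℝ) (hq₁ : q₁ = max (2 : ℝ) ((α + 2) / (α + 1))) (hq : q = q₁ / γψ)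
    (hγs : γs = min γf (1 / (q * (α + 1) - α)))
    (u : EucSp N → ℝ → ℝ) (hu : IsSolutionRN T F h α f ψ u)
    (c₁ c₂ : ℝ)
    (hlow : ∀ x y : EucSp N, ∀ t ∈ Set.Ioo (0 : ℝ) T,
      ψ y - c₁ * ‖x - y‖ ^ γψ - c₂ * t ^ (1 / (q * (α + 1) - α)) ≤ u x t)
    (hupp : ∀ x y : EucSp N, ∀ t ∈ Set.Ioo (0 : ℝ) T,
      u x t ≤ ψ y + c₁ * ‖x - y‖ ^ γψ + c₂ * t ^ (1 / (q * (α + 1) - α))) :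
    ∃ C₂ : ℝ, ∀ x : EucSp N, ∀ t ∈ Set.Ioo (0 : ℝ) T, ∀ s : ℝ, 0 < s →
      t + s ∈ Set.Ioo (0 : ℝ) T → |u x (t + s) - u x t| ≤ C₂ * s ^ γs := by
  obtain ⟨_, Ch, hCh⟩ := hh
  replace hCh := fun x => hCh x (mem_univ x)
  obtain ⟨hc, hsub, hsup, hu0⟩ := hu
  obtain ⟨h0, h1⟩ := hγψ
  have hA : 0 < A := hF2.1.trans_le hF2.2.1
  have hα1 : 0 < α + 1 := by linarith
  have hMf : 0 ≤ Mf := (abs_nonneg _).trans (hfb 0 (T / 2) ⟨by linarith, by linarith⟩)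
  set D := q * (α + 1) - α with hD
  have hDγ : (α + 2) / γψ - α ≤ D := by
    have h2 := (div_le_iff₀ hα1).mp (le_max_right 2 ((α + 2) / (α + 1)))
    rw [hD, hq, hq₁, div_mul_eq_mul_div]
    gcongr
  have hD1 : 1 ≤ D := by
    have : α + 2 ≤ (α + 2) / γψ := by
      rw [le_div_iff₀ h0]
      nlinarith
    linarith
  have hD0 : 0 < D := by linarith
  set β := 1 / D with hβd
  have hβ : 0 < β := by positivity
  have hβ1 : β ≤ 1 := by
    rw [hβd, div_le_one hD0]
    exact hD1
  have hβγ : β * ((α + 2) / γψ - α) ≤ 1 := by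
    calc β * ((α + 2) / γψ - α) ≤ β * D := by gcongr
      _ = 1 := by rw [hβd]; field_simp
  have hgβ : γs ≤ β := by rw [hγs]; exact min_le_right _ _
  set M := Mψ + |c₂| * T ^ β with hMd
  have hM : ∀ x : EucSp N, ∀ t ∈ Ico (0 : ℝ) T, |u x t| ≤ M := by
    intro x t ht
    have hψ := abs_le.mp (hψb x)
    have n1 : 0 ≤ |c₂| * T ^ β := by positivity
    rcases ht.1.eq_or_lt with h2 | h2
    · rw [← h2, hu0]
      linarith [hψb x]
    · have l1 := hlow x x t ⟨h2, ht.2⟩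
      have l2 := hupp x x t ⟨h2, ht.2⟩
      rw [sub_self, norm_zero, Real.zero_rpow h0.ne', mul_zero] at l1 l2
      have l3 : c₂ * t ^ β ≤ |c₂| * T ^ β := by
        have := ht.2.le
        calc c₂ * t ^ β ≤ |c₂| * t ^ β := by gcongr; exact le_abs_self c₂
          _ ≤ _ := by gcongr
      rw [abs_le]
      constructor <;> linarith
  have hM0 : 0 ≤ M := (abs_nonneg _).trans (hM 0 0 ⟨le_rfl, hT⟩)
  obtain ⟨L, hL, hH⟩ := exists_spatial_holder hα hF1 hF2 hF3 hF6 hCh hfb hsub hsup hc h0 h1 hM0 hM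
    (c := cψ) fun x y => by
      rw [hu0, hu0]
      exact (le_abs_self _).trans (hψH x y)
  have hC₀ : 0 ≤ A * N + |Ch| := by positivity
  obtain ⟨C, hC⟩ := (hsub.slopeControl hα hF1 hF2 hCh hfb hc).exists_time_holder hα hC₀ hc hM hL
    h0 h1 hH hMf hβ hβγ hgβ (hgβ.trans hβ1)
  obtain ⟨C', hC'⟩ := (hsup.slopeControl_neg hα hF1 hF2 hCh hfb hc).exists_time_holder hα hC₀
    hc.neg (M := M) (fun x t ht => by rw [abs_neg]; exact hM x t ht) hL h0 h1
    (fun t ht x y => by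
      have := hH t ht y x
      rw [norm_sub_rev] at this
      linarith) hMf hβ hβγ hgβ (hgβ.trans hβ1)
  refine ⟨max C C', fun x t ht s hs hts => abs_le.mpr ⟨?_, ?_⟩⟩
  · have h2 := hC' x t ht s hs hts
    have h3 : C' * s ^ γs ≤ max C C' * s ^ γs := by
      gcongr
      exact le_max_right _ _
    linarith
  · refine (hC x t ht s hs hts).trans ?_
    gcongr
    exact le_max_left _ _
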